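/- If the Riemann Hypothesis is true, then for all real x ≥ 24.4, |Σ_{p ≤ x} 1/p - log log x - B| ≤ 3 log x / (8π√x), where B = 0.26149... is the Mertens constant. -/

import Mathlib

section
open Complex

noncomputable def xiF (s : ℂ) : ℂ := s * (s - 1) * completedRiemannZeta₀ s + 1

lemma xiF_diff : Differentiable ℂ xiF := by
  unfold xiF
  have := differentiable_completedZeta₀
  fun_prop

lemma xiF_one_sub (s : ℂ) : xiF (1 - s) = xiF s := by
  unfold xiF
  rw [completedRiemannZeta₀_one_sub]; ring

lemma xiF_eq {s : ℂ} (h0 : s ≠ 0) (h1 : s ≠ 1) :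
    xiF s = s * (s - 1) * completedRiemannZeta s := by
  rw [completedRiemannZeta_eq]
  unfold xiF
  have : 1 - s ≠ 0 := sub_ne_zero.mpr h1.symm
  field_simp
  ring

lemma xiF_zero : xiF 0 = 1 := by simp [xiF]
lemma xiF_one : xiF 1 = 1 := by simp [xiF]

lemma xiF_eq_zeta {s : ℂ} (h : 1 < s.re) :
    xiF s = s * (s - 1) * (Gammaℝ s * riemannZeta s) := by
  have h0 : s ≠ 0 := by rintro rfl; simp at h; linarith
  have h1 : s ≠ 1 := by rintro rfl; simp at h
  rw [xiF_eq h0 h1, riemannZeta_def_of_ne_zero h0,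
    mul_div_cancel₀ _ (Gammaℝ_ne_zero_of_re_pos (by linarith))]

lemma xiF_ne_zero_of_one_lt_re {s : ℂ} (h : 1 < s.re) : xiF s ≠ 0 := by
  have h0 : s ≠ 0 := by rintro rfl; simp at h; linarith
  have h1 : s ≠ 1 := by rintro rfl; simp at h
  rw [xiF_eq_zeta h]
  exact mul_ne_zero (mul_ne_zero h0 (sub_ne_zero.mpr h1)) (mul_ne_zero
    (Gammaℝ_ne_zero_of_re_pos (by linarith)) (riemannZeta_ne_zero_of_one_le_re h.le))

lemma xiF_zero_re (hRH : RiemannHypothesis) {s : ℂ} (hs : xiF s = 0) : s.re = 1 / 2 := by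
  have h0 : s ≠ 0 := by rintro rfl; simp [xiF_zero] at hs
  have h1 : s ≠ 1 := by rintro rfl; simp [xiF_one] at hs
  have hc : completedRiemannZeta s = 0 := by
    rw [xiF_eq h0 h1] at hs
    have := sub_ne_zero.mpr h1
    simp_all
  apply hRH s
  · rw [riemannZeta_def_of_ne_zero h0, hc, zero_div]
  · rintro ⟨n, rfl⟩
    have := xiF_one_sub (-2 * (n + 1))
    rw [hs] at this
    refine xiF_ne_zero_of_one_lt_re ?_ this
    simp
    positivity
  · exact h1

lemma strip_bound : ∃ C : ℝ, ∀ s : ℂ, 1 / 2 ≤ s.re → s.re ≤ 2 →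
    ‖completedRiemannZeta₀ s‖ ≤ C := by
  set P := HurwitzZeta.hurwitzEvenFEPair 0
  have hconv : ∀ s : ℂ, MellinConvergent P.f_modif s := fun s =>
    ((WeakFEPair.isStrongFEPair_toStrongFEPair P).hasMellin s).1
  refine ⟨(∫ t in Set.Ioi (0:ℝ), ‖(t : ℂ) ^ ((1/4 : ℂ) - 1) • P.f_modif t‖) +
    ∫ t in Set.Ioi (0:ℝ), ‖(t : ℂ) ^ ((1 : ℂ) - 1) • P.f_modif t‖, fun s h1 h2 => ?_⟩
  have h3 : completedRiemannZeta₀ s = mellin P.f_modif (s / 2) / 2 := rfl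
  rw [h3, norm_div]
  have h4 : ‖mellin P.f_modif (s / 2)‖ ≤ ∫ t in Set.Ioi (0:ℝ),
      (‖(t : ℂ) ^ ((1/4 : ℂ) - 1) • P.f_modif t‖ + ‖(t : ℂ) ^ ((1 : ℂ) - 1) • P.f_modif t‖) := by
    unfold mellin
    apply MeasureTheory.norm_integral_le_of_norm_le
    · exact (hconv (1/4)).norm.add (hconv 1).norm
    · filter_upwards [MeasureTheory.ae_restrict_mem measurableSet_Ioi] with t ht
      have ht : 0 < t := ht
      rw [norm_smul, norm_smul, norm_smul, ← add_mul]
      gcongr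
      rw [norm_cpow_eq_rpow_re_of_pos ht, norm_cpow_eq_rpow_re_of_pos ht,
        norm_cpow_eq_rpow_re_of_pos ht]
      have e1 : ((1/4 : ℂ) - 1).re = 1/4 - 1 := by norm_num
      have e2 : ((1 : ℂ) - 1).re = 0 := by norm_num
      have e3 : (s / 2 - 1).re = s.re / 2 - 1 := by simp
      rw [e1, e2, e3]
      rcases le_total t 1 with h | h
      · have h8 := Real.rpow_le_rpow_of_exponent_ge ht h (show (1/4:ℝ) - 1 ≤ s.re/2 - 1 by linarith)
        exact h8.trans (le_add_of_nonneg_right (Real.rpow_nonneg ht.le (0:ℝ)))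
      · have := Real.rpow_le_rpow_of_exponent_le h (show s.re/2 - 1 ≤ (0:ℝ) by linarith)
        have := Real.rpow_nonneg ht.le ((1/4:ℝ) - 1)
        linarith
  rw [MeasureTheory.integral_add (hconv (1/4)).norm (hconv 1).norm] at h4
  have : ‖(2:ℂ)‖ = 2 := by simp
  rw [this]
  have := norm_nonneg (mellin P.f_modif (s / 2))
  linarith

lemma norm_Gamma_le' {s : ℂ} (h : 0 < s.re) : ‖Gamma s‖ ≤ Real.Gamma s.re := by
  rw [Gamma_eq_integral h, Real.Gamma_eq_integral h]
  unfold GammaIntegral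
  apply MeasureTheory.norm_integral_le_of_norm_le (Real.GammaIntegral_convergent h)
  filter_upwards [MeasureTheory.ae_restrict_mem measurableSet_Ioi] with t ht
  have ht : 0 < t := ht
  rw [norm_mul, norm_cpow_eq_rpow_re_of_pos ht]
  simp [Complex.norm_exp]

lemma zeta_bdd : ∃ C : ℝ, 0 < C ∧ ∀ s : ℂ, 2 ≤ s.re → ‖riemannZeta s‖ ≤ C := by
  have hs2 : Summable (fun n : ℕ => 1 / ((n : ℝ) + 1) ^ (2:ℝ)) := by
    have := (summable_nat_add_iff 1).mpr (Real.summable_one_div_nat_rpow.mpr (show (1:ℝ) < 2 by norm_num))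
    simpa using this
  refine ⟨(∑' n : ℕ, 1 / ((n : ℝ) + 1) ^ (2:ℝ)) + 1, by positivity, fun s hs => ?_⟩
  rw [zeta_eq_tsum_one_div_nat_add_one_cpow (by linarith)]
  refine (tsum_of_norm_bounded hs2.hasSum fun n => ?_).trans (by linarith)
  have : ((n : ℂ) + 1) = (((n : ℝ) + 1 : ℝ) : ℂ) := by push_cast; rfl
  rw [norm_div, norm_one, this, norm_cpow_eq_rpow_re_of_pos (by positivity)]
  gcongr
  linarith [Nat.cast_nonneg (α := ℝ) n]

lemma Gamma_real_bound (n : ℕ) : ∀ x : ℝ, 1 ≤ x → x ≤ n + 2 → Real.Gamma x ≤ ((n:ℝ) + 2) ^ (n + 1) := by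
  induction n with
  | zero =>
    intro x h1 h2
    have hc := Real.convexOn_Gamma.2 (show (1:ℝ) ∈ Set.Ioi 0 by simp) (show (2:ℝ) ∈ Set.Ioi 0 by simp)
      (show 0 ≤ 2 - x by push_cast at h2; linarith) (show 0 ≤ x - 1 by linarith) (by ring)
    have e : (2 - x) • (1:ℝ) + (x - 1) • (2:ℝ) = x := by simp; ring
    rw [e] at hc
    simp [Real.Gamma_one, Real.Gamma_two] at hc ⊢
    linarith
  | succ n ih =>
    intro x h1 h2
    have hn : (0:ℝ) ≤ n := Nat.cast_nonneg n
    push_cast at h2 ⊢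
    rcases le_total x (n + 2) with h | h
    · refine (ih x h1 h).trans ?_
      calc ((n:ℝ) + 2) ^ (n + 1) ≤ ((n:ℝ) + 1 + 2) ^ (n + 1) := by gcongr; linarith
        _ ≤ _ := pow_le_pow_right₀ (by linarith) (by omega)
    · have e : Real.Gamma x = (x - 1) * Real.Gamma (x - 1) := by
        rw [← Real.Gamma_add_one (by linarith)]; congr 1; ring
      rw [e, pow_succ, mul_comm]
      have h3 := ih (x - 1) (by linarith) (by linarith)
      have h4 : ((n:ℝ) + 2) ^ (n + 1) ≤ ((n:ℝ) + 1 + 2) ^ (n + 1) := by gcongr; linarith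
      apply mul_le_mul (h3.trans h4) (by linarith) (by linarith) (by positivity)

lemma xiF_bound_half : ∃ A : ℝ, 1 ≤ A ∧ ∀ R : ℝ, 1 ≤ R → ∀ s : ℂ, 1 / 2 ≤ s.re → ‖s‖ ≤ R →
    ‖xiF s‖ ≤ A * Real.exp ((R + 3) * Real.log (R + 2)) := by
  obtain ⟨C, hC⟩ := strip_bound
  obtain ⟨D, hD0, hD⟩ := zeta_bdd
  refine ⟨|C| + D + 1, by linarith [abs_nonneg C], fun R hR s hs hsR => ?_⟩
  have hR2 : ‖s‖ * ‖s - 1‖ ≤ (R + 2) * (R + 2) := by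
    have : ‖s - 1‖ ≤ R + 1 := (norm_sub_le _ _).trans (by simp; linarith)
    apply mul_le_mul (by linarith) (by linarith) (norm_nonneg _) (by linarith)
  have hE : Real.exp ((R + 3) * Real.log (R + 2)) = (R + 2) * (R + 2) * Real.exp ((R + 1) * Real.log (R + 2)) := by
    rw [show (R + 3) * Real.log (R + 2) = Real.log (R+2) + Real.log (R+2) + (R + 1) * Real.log (R + 2) by ring,
      Real.exp_add, Real.exp_add, Real.exp_log (by linarith)]
  have hl : 0 ≤ Real.log (R + 2) := Real.log_nonneg (by linarith)
  have hE1 : 1 ≤ Real.exp ((R + 1) * Real.log (R + 2)) := Real.one_le_exp (by positivity)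
  rw [hE]
  set X := Real.exp ((R + 1) * Real.log (R + 2))
  have hRR : 1 ≤ (R + 2) * (R + 2) := by nlinarith
  rcases le_total s.re 2 with h | h
  · have h1 := hC s hs h
    have : ‖xiF s‖ ≤ (R + 2) * (R + 2) * |C| + 1 := by
      unfold xiF
      refine (norm_add_le _ _).trans ?_
      rw [norm_mul, norm_mul, norm_one]
      gcongr
      exact h1.trans (le_abs_self C)
    refine this.trans ?_
    have h5 : 0 ≤ |C| := abs_nonneg C
    have h6 : 1 ≤ (R + 2) * (R + 2) * X := one_le_mul_of_one_le_of_one_le hRR hE1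
    have h7 : (R + 2) * (R + 2) ≤ (R + 2) * (R + 2) * X := le_mul_of_one_le_right (by linarith) hE1
    nlinarith
  · rw [xiF_eq_zeta (by linarith), norm_mul, norm_mul, norm_mul]
    have h2 := hD s h
    have h3 : ‖Gammaℝ s‖ ≤ X := by
      rw [Gammaℝ_def, norm_mul]
      have : ‖(Real.pi : ℂ) ^ (-s / 2)‖ ≤ 1 := by
        rw [norm_cpow_eq_rpow_re_of_pos Real.pi_pos]
        apply Real.rpow_le_one_of_one_le_of_nonpos (by linarith [Real.pi_gt_three])
        simp; linarith
      have h4 : ‖Gamma (s / 2)‖ ≤ X := by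
        have hre : (s/2).re = s.re / 2 := by simp
        refine (norm_Gamma_le' (by rw [hre]; linarith)).trans ?_
        have hsr : s.re ≤ R := (re_le_norm s).trans hsR
        have hfl := Nat.lt_floor_add_one R
        refine (Gamma_real_bound ⌊R⌋₊ _ (by rw [hre]; linarith) (by rw [hre]; linarith)).trans ?_
        have hfl2 := Nat.floor_le (show 0 ≤ R by linarith)
        have : X = (R + 2) ^ (R + 1) := by
          rw [Real.rpow_def_of_pos (by linarith), mul_comm]
        rw [this, ← Real.rpow_natCast]
        push_cast
        refine (Real.rpow_le_rpow (by positivity) (show (⌊R⌋₊:ℝ) + 2 ≤ R + 2 by linarith) (by positivity)).trans ?_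
        exact Real.rpow_le_rpow_of_exponent_le (by linarith) (by linarith)
      calc _ ≤ 1 * X := by gcongr
        _ = X := one_mul _
    calc ‖s‖ * ‖s - 1‖ * (‖Gammaℝ s‖ * ‖riemannZeta s‖) ≤ (R + 2) * (R + 2) * (X * D) := by
          gcongr
      _ = D * ((R + 2) * (R + 2) * X) := by ring
      _ ≤ _ := by
        gcongr
        linarith [abs_nonneg C]

lemma xiF_growth (ε : ℝ) (hε : 0 < ε) : ∀ᶠ R : ℝ in Filter.atTop, ∀ z : ℂ, ‖z‖ ≤ R →
    ‖xiF z‖ ≤ Real.exp (ε * R ^ 2) := by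
  obtain ⟨A, hA1, hA⟩ := xiF_bound_half
  have hlog : ∀ᶠ y : ℝ in Filter.atTop, Real.log y ≤ ε / 16 * y := by
    have := Real.isLittleO_log_id_atTop.bound (show 0 < ε / 16 by positivity)
    filter_upwards [this, Filter.eventually_ge_atTop 1] with y hy h1
    simp only [id, Real.norm_eq_abs] at hy
    rw [abs_of_nonneg (show (0:ℝ) ≤ y by linarith)] at hy
    exact (le_abs_self _).trans hy
  have hlog2 := (Filter.tendsto_atTop_add_const_right Filter.atTop (3:ℝ) Filter.tendsto_id).eventually hlog
  filter_upwards [hlog2, Filter.eventually_ge_atTop 20, Filter.eventually_ge_atTop (2 * Real.log A / ε)] with R hR1 hR2 hR3 z hz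
  have key : A * Real.exp ((R + 1 + 3) * Real.log (R + 1 + 2)) ≤ Real.exp (ε * R ^ 2) := by
    rw [← Real.exp_log (show 0 < A by linarith), ← Real.exp_add]
    apply Real.exp_le_exp.mpr
    rw [div_le_iff₀ hε] at hR3
    simp only [id] at hR1
    rw [show R + 1 + 2 = R + 3 by ring]
    have : (R + 1 + 3) * Real.log (R + 3) ≤ (R + 1 + 3) * (ε / 16 * (R + 3)) := by gcongr
    have h5 : (R + 4) * (R + 3) ≤ 2 * R ^ 2 := by nlinarith
    have h6 : ε * ((R + 4) * (R + 3)) ≤ ε * (2 * R ^ 2) := by gcongr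
    have h7 : ε * R ≤ ε * R ^ 2 := by gcongr; nlinarith
    nlinarith
  rcases le_total (1/2) z.re with h | h
  · refine (hA (R + 1) (by linarith) z h (by linarith)).trans key
  · rw [← xiF_one_sub]
    refine (hA (R + 1) (by linarith) (1 - z) (by simp; linarith) ?_).trans key
    refine (norm_sub_le _ _).trans ?_
    simp; linarith

end

section
open Complex

lemma entire_order_ne_top {f : ℂ → ℂ} (hf : Differentiable ℂ f) (h0 : f 0 = 1) (a : ℂ) :
    analyticOrderAt f a ≠ ⊤ := by
  intro h
  rw [analyticOrderAt_eq_top] at h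
  have hA : AnalyticOnNhd ℂ f Set.univ := fun z _ => hf.analyticAt z
  have := hA.eqOn_zero_of_preconnected_of_eventuallyEq_zero isPreconnected_univ (Set.mem_univ a) h
  have h1 := this (Set.mem_univ 0)
  simp [h0] at h1

lemma entire_zeros_finite {f : ℂ → ℂ} (hf : Differentiable ℂ f) (h0 : f 0 = 1) (R : ℝ) :
    {z | f z = 0 ∧ ‖z‖ ≤ R}.Finite := by
  by_contra hinf
  have hA : AnalyticOnNhd ℂ f Set.univ := fun z _ => hf.analyticAt z
  obtain ⟨x, -, hx⟩ := Set.Infinite.exists_accPt_of_subset_isCompact hinf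
    (isCompact_closedBall (0:ℂ) R) (by rintro z ⟨-, h⟩; simpa using h)
  rw [accPt_iff_frequently_nhdsNE] at hx
  have := hA.eqOn_zero_of_preconnected_of_frequently_eq_zero isPreconnected_univ (Set.mem_univ x)
    (hx.mono fun z hz => hz.1)
  have h1 := this (Set.mem_univ 0)
  simp [h0] at h1

lemma entire_divide {g : ℂ → ℂ} (hg : Differentiable ℂ g) {a : ℂ} (ht : analyticOrderAt g a ≠ ⊤) :
    ∃ (n : ℕ) (h : ℂ → ℂ), Differentiable ℂ h ∧ h a ≠ 0 ∧ ∀ z, g z = (z - a) ^ n * h z := by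
  obtain ⟨k, hk, hka, hke⟩ := ((hg.analyticAt a).analyticOrderNatAt_eq_iff ht).mp rfl
  set n := analyticOrderNatAt g a
  have hne : ∀ z, z ≠ a → Function.update (fun z => g z / (z - a) ^ n) a (k a) z = g z / (z - a) ^ n :=
    fun z hz => by simp [hz]
  refine ⟨n, Function.update (fun z => g z / (z - a) ^ n) a (k a), fun z => ?_, by simpa, fun z => ?_⟩
  · by_cases hz : z = a
    · subst hz
      have : Function.update (fun w => g w / (w - z) ^ n) z (k z) =ᶠ[nhds z] k := by
        filter_upwards [hke] with w hw
        by_cases hwz : w = z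
        · subst hwz; simp
        · rw [hne w hwz, hw, smul_eq_mul]
          have := sub_ne_zero.mpr hwz
          field_simp
      exact hk.differentiableAt.congr_of_eventuallyEq this
    · have : Function.update (fun w => g w / (w - a) ^ n) a (k a) =ᶠ[nhds z] (fun w => g w / (w - a) ^ n) := by
        filter_upwards [isOpen_ne.mem_nhds hz] with w hw
        exact hne w hw
      refine DifferentiableAt.congr_of_eventuallyEq ?_ this
      have := sub_ne_zero.mpr hz
      apply DifferentiableAt.div (hg z) (by fun_prop) (by positivity)
  · by_cases hz : z = a
    · subst hz
      have := hke.self_of_nhds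
      simpa using this
    · rw [hne z hz]
      have := sub_ne_zero.mpr hz
      field_simp

lemma entire_factor {f : ℂ → ℂ} (hf : Differentiable ℂ f) (h0 : f 0 = 1) (S : Finset ℂ) :
    ∃ g : ℂ → ℂ, Differentiable ℂ g ∧ (∀ ρ ∈ S, g ρ ≠ 0) ∧
      ∀ z, f z = (∏ ρ ∈ S, (z - ρ) ^ analyticOrderNatAt f ρ) * g z := by
  classical
  induction S using Finset.induction_on with
  | empty => exact ⟨f, hf, by simp, by simp⟩
  | insert a S ha ih =>
    obtain ⟨g, hg, hgS, hfg⟩ := ih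
    have ht : analyticOrderAt g a ≠ ⊤ := by
      intro h
      rw [analyticOrderAt_eq_top] at h
      apply entire_order_ne_top hf h0 a
      rw [analyticOrderAt_eq_top]
      filter_upwards [h] with z hz
      rw [hfg, hz, mul_zero]
    obtain ⟨n, h, hh, hha, hgh⟩ := entire_divide hg ht
    have hn : analyticOrderNatAt f a = n := by
      rw [(hf.analyticAt a).analyticOrderNatAt_eq_iff (entire_order_ne_top hf h0 a)]
      refine ⟨fun z => (∏ ρ ∈ S, (z - ρ) ^ analyticOrderNatAt f ρ) * h z, ?_, ?_, ?_⟩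
      · apply Differentiable.analyticAt
        fun_prop
      · refine mul_ne_zero (Finset.prod_ne_zero_iff.mpr fun ρ hρ => pow_ne_zero _ (sub_ne_zero.mpr ?_)) hha
        rintro rfl; exact ha hρ
      · refine Filter.Eventually.of_forall fun z => ?_
        rw [hfg, hgh, smul_eq_mul]; ring
    refine ⟨h, hh, ?_, fun z => ?_⟩
    · intro ρ hρ
      rcases Finset.mem_insert.mp hρ with rfl | hρ
      · exact hha
      · intro h1
        apply hgS ρ hρ
        rw [hgh, h1, mul_zero]
    · rw [Finset.prod_insert ha, hn, hfg, hgh]; ring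

/-- variation of the log derivative for a nonvanishing function on a disc -/
lemma logDeriv_var {G : ℂ → ℂ} (hG : Differentiable ℂ G) {R M : ℝ} (hR : 0 < R) (hM : 0 < M)
    (h0 : G 0 = 1) (hne : ∀ z, ‖z‖ < R → G z ≠ 0) (hb : ∀ z, ‖z‖ < R → ‖G z‖ ≤ Real.exp M)
    {z w : ℂ} (hz : ‖z‖ < R / 8) (hw : ‖w‖ < R / 8) :
    ‖logDeriv G z - logDeriv G w‖ ≤ 64 * M / R ^ 2 * ‖z - w‖ := by
  have hG1 : Differentiable ℂ (deriv G) := hG.deriv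
  have hLd : DifferentiableOn ℂ (logDeriv G) (Metric.ball 0 R) := by
    intro x hx
    have := hne x (by simpa using hx)
    exact ((hG1 x).div (hG x) this).differentiableWithinAt
  obtain ⟨h, hh0, hh⟩ := hLd.isExactOn_ball.with_val_at 0 0
  have hexp : ∀ x ∈ Metric.ball (0:ℂ) R, G x = exp (h x) := by
    have hd : ∀ x ∈ Metric.ball (0:ℂ) R, HasDerivAt (fun x => G x * exp (-h x)) 0 x := by
      intro x hx
      have h1 := (hG x).hasDerivAt.mul ((hh x hx).neg.cexp)
      have h2 : deriv G x * exp ((-h) x) + G x * (exp ((-h) x) * -logDeriv G x) = 0 := by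
        have := hne x (by simpa using hx)
        rw [logDeriv_apply]
        field_simp
        ring
      rw [h2] at h1
      exact h1
    intro x hx
    have := (convex_ball (0:ℂ) R).is_const_of_fderivWithin_eq_zero (𝕜 := ℂ) (f := fun x => G x * exp (-h x))
      (fun y hy => (hd y hy).differentiableAt.differentiableWithinAt)
      (fun y hy => by
        rw [fderivWithin_of_isOpen Metric.isOpen_ball hy]
        ext; simp [(hd y hy).deriv])
      hx (Metric.mem_ball_self hR)
    simp only [hh0, h0, neg_zero, Complex.exp_zero, one_mul, Complex.exp_neg] at this
    have hne := exp_ne_zero (h x)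
    field_simp at this
    exact this
  have hhd : DifferentiableOn ℂ h (Metric.ball 0 R) := fun x hx => (hh x hx).differentiableAt.differentiableWithinAt
  have hre : Set.MapsTo h (Metric.ball 0 R) {z | z.re ≤ M} := by
    intro x hx
    have := hb x (by simpa using hx)
    rw [hexp x hx, Complex.norm_exp] at this
    exact Real.exp_le_exp.mp this
  have hbd : ∀ x : ℂ, ‖x‖ ≤ R / 2 → ‖h x‖ ≤ 2 * M := by
    intro x hx
    refine (borelCaratheodory_zero hM hhd hre hR (by simp; linarith) hh0).trans ?_
    rw [div_le_iff₀ (by linarith)]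
    nlinarith
  have hL1 : ∀ x : ℂ, ‖x‖ ≤ R / 4 → ‖logDeriv G x‖ ≤ 8 * M / R := by
    intro x hx
    rw [← (hh x (by simp; linarith)).deriv]
    have := norm_deriv_le_of_forall_mem_sphere_norm_le (c := x) (R := R / 4) (C := 2 * M) (f := h) (by linarith)
      (DifferentiableOn.diffContOnCl_ball (U := Metric.ball 0 R) hhd (fun y hy => by
        have h1 : ‖y - x‖ ≤ R / 4 := by simpa [dist_eq_norm] using hy
        have := norm_add_le (y - x) x
        rw [sub_add_cancel] at this
        simp; linarith))
      (fun y hy => hbd y (by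
        have h1 : ‖y - x‖ = R / 4 := by simpa [dist_eq_norm] using hy
        have := norm_add_le (y - x) x
        rw [sub_add_cancel] at this
        linarith))
    refine this.trans (le_of_eq ?_)
    field_simp; norm_num
  have hL2 : ∀ x ∈ Metric.ball (0:ℂ) (R/8), ‖deriv (logDeriv G) x‖ ≤ 64 * M / R ^ 2 := by
    intro x hx
    have hx : ‖x‖ < R / 8 := by simpa using hx
    have := norm_deriv_le_of_forall_mem_sphere_norm_le (c := x) (R := R / 8) (C := 8 * M / R) (f := logDeriv G) (by linarith)
      (DifferentiableOn.diffContOnCl_ball (U := Metric.ball 0 R) hLd (fun y hy => by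
        have h1 : ‖y - x‖ ≤ R / 8 := by simpa [dist_eq_norm] using hy
        have := norm_add_le (y - x) x
        rw [sub_add_cancel] at this
        simp; linarith))
      (fun y hy => hL1 y (by
        have h1 : ‖y - x‖ = R / 8 := by simpa [dist_eq_norm] using hy
        have := norm_add_le (y - x) x
        rw [sub_add_cancel] at this
        linarith))
    refine this.trans (le_of_eq ?_)
    field_simp; norm_num
  exact (convex_ball (0:ℂ) (R/8)).norm_image_sub_le_of_norm_deriv_le (f := logDeriv G)
    (fun x hx => (hLd.differentiableAt (Metric.isOpen_ball.mem_nhds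
      (Metric.ball_subset_ball (by linarith) hx)))) hL2 (by simpa using hw) (by simpa using hz)

end

section
open Complex Filter

abbrev Zt := {ρ : ℂ // xiF ρ = 0}
noncomputable def mz (ρ : Zt) : ℝ := analyticOrderNatAt xiF ρ
lemma mz_nonneg (ρ : Zt) : 0 ≤ mz ρ := Nat.cast_nonneg _

lemma Zn_finite (n : ℕ) : {ρ : Zt | ‖(ρ : ℂ)‖ ≤ n}.Finite := by
  have := entire_zeros_finite xiF_diff xiF_zero n
  refine Set.Finite.of_finite_image (f := Subtype.val) (this.subset ?_) Subtype.val_injective.injOn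
  rintro _ ⟨ρ, h, rfl⟩
  exact ⟨ρ.2, h⟩

noncomputable def Zn (n : ℕ) : Finset Zt := (Zn_finite n).toFinset

lemma mem_Zn {n : ℕ} {ρ : Zt} : ρ ∈ Zn n ↔ ‖(ρ : ℂ)‖ ≤ n := by simp [Zn]

lemma Zn_tendsto : Tendsto Zn atTop atTop := by
  apply tendsto_atTop_finset_of_monotone
  · intro a b hab ρ h
    rw [mem_Zn] at h ⊢
    exact h.trans (by exact_mod_cast hab)
  · intro ρ
    obtain ⟨n, hn⟩ := exists_nat_ge ‖(ρ : ℂ)‖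
    exact ⟨n, mem_Zn.mpr hn⟩

instance : Countable Zt := by
  have : (Set.univ : Set Zt).Countable := by
    have h : (Set.univ : Set Zt) = ⋃ n : ℕ, {ρ : Zt | ‖(ρ : ℂ)‖ ≤ n} := by
      ext ρ
      simp only [Set.mem_univ, Set.mem_iUnion, true_iff]
      exact exists_nat_ge ‖(ρ : ℂ)‖
    rw [h]
    exact Set.countable_iUnion fun n => (Zn_finite n).countable
  exact Set.countable_univ_iff.mp this

lemma Zt_ne_zero (ρ : Zt) : (ρ : ℂ) ≠ 0 := by
  intro h
  have := ρ.2
  rw [h, xiF_zero] at this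
  exact one_ne_zero this

set_option maxHeartbeats 600000 in
lemma hadamard_lim {z w : ℂ} (hz : xiF z ≠ 0) (hw : xiF w ≠ 0) :
    Tendsto (fun n => ∑ ρ ∈ Zn n, (mz ρ : ℂ) * (1 / (z - ρ) - 1 / (w - ρ))) atTop
      (nhds (logDeriv xiF z - logDeriv xiF w)) := by
  rw [Metric.tendsto_atTop']
  intro δ hδ
  set ε : ℝ := δ / (577 * (‖z - w‖ + 1)) with hε
  have hε0 : 0 < ε := by positivity
  have hg3 : ∀ᶠ n : ℕ in atTop, ∀ x : ℂ, ‖x‖ ≤ 3 * (n:ℝ) → ‖xiF x‖ ≤ Real.exp (ε * (3 * (n:ℝ)) ^ 2) :=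
    (Tendsto.const_mul_atTop (by norm_num : (0:ℝ) < 3) tendsto_natCast_atTop_atTop).eventually (xiF_growth ε hε0)
  have hbig : ∀ᶠ n : ℕ in atTop, 8 * (‖z‖ + ‖w‖ + 1) ≤ (n:ℝ) := tendsto_natCast_atTop_atTop.eventually_ge_atTop _
  obtain ⟨N, hN⟩ := eventually_atTop.mp (hg3.and hbig)
  refine ⟨N, fun n hn => ?_⟩
  obtain ⟨hgr, hn8⟩ := hN n hn.le
  set R : ℝ := (n : ℝ) with hRdef
  have hR : 0 < R := by have := norm_nonneg z; have := norm_nonneg w; linarith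
  obtain ⟨g, hg, hgS, hfg⟩ := entire_factor xiF_diff xiF_zero ((Zn n).map ⟨Subtype.val, Subtype.val_injective⟩)
  simp only [Finset.prod_map, Function.Embedding.coeFn_mk] at hfg
  have hfg0 : ∀ x, xiF x ≠ 0 → g x ≠ 0 := by
    intro x hx h
    rw [hfg, h, mul_zero] at hx
    exact hx rfl
  have hg0 : g 0 ≠ 0 := hfg0 0 (by rw [xiF_zero]; exact one_ne_zero)
  have hgn : ∀ x : ℂ, ‖x‖ ≤ R → g x ≠ 0 := by
    intro x hx
    by_cases h : xiF x = 0
    · exact hgS x (Finset.mem_map.mpr ⟨⟨x, h⟩, mem_Zn.mpr hx, rfl⟩)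
    · exact hfg0 x h
  set G : ℂ → ℂ := fun x => g x * (g 0)⁻¹ with hGdef
  have hG : Differentiable ℂ G := hg.mul_const _
  have hGsph : ∀ x : ℂ, ‖x‖ = 3 * R → ‖G x‖ ≤ Real.exp (ε * (3 * R) ^ 2) := by
    intro x hx
    refine le_trans ?_ (hgr x hx.le)
    have h1 := hfg 0
    rw [xiF_zero] at h1
    have h2 : (g 0)⁻¹ = ∏ ρ ∈ Zn n, (0 - (ρ:ℂ)) ^ analyticOrderNatAt xiF ρ := by
      exact (eq_inv_of_mul_eq_one_left h1.symm).symm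
    simp only [hGdef]
    rw [h2, hfg x, norm_mul, norm_mul, mul_comm]
    apply mul_le_mul_of_nonneg_right _ (norm_nonneg _)
    rw [norm_prod, norm_prod]
    apply Finset.prod_le_prod (fun _ _ => norm_nonneg _)
    intro ρ hρ
    rw [norm_pow, norm_pow]
    gcongr
    have h3 : ‖(ρ:ℂ)‖ ≤ R := mem_Zn.mp hρ
    have h4 := norm_sub_norm_le x (ρ:ℂ)
    rw [zero_sub, norm_neg]
    linarith
  have hGb : ∀ x, ‖x‖ < R → ‖G x‖ ≤ Real.exp (ε * (3 * R) ^ 2) := by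
    intro x hx
    refine norm_le_of_forall_mem_frontier_norm_le (U := Metric.ball 0 (3 * R)) Metric.isBounded_ball
      hG.diffContOnCl ?_ (subset_closure (by simp; linarith))
    intro y hy
    rw [frontier_ball _ (by positivity)] at hy
    exact hGsph y (by simpa using hy)
  have hv := logDeriv_var hG hR (show 0 < ε * (3 * R) ^ 2 by positivity) (by simp [hGdef, hg0])
    (fun x hx => mul_ne_zero (hgn x hx.le) (inv_ne_zero hg0)) hGb (z := z) (w := w)
    (by have := norm_nonneg w; linarith) (by have := norm_nonneg z; linarith)
  have hld : ∀ x, xiF x ≠ 0 → logDeriv xiF x = (∑ ρ ∈ Zn n, (mz ρ : ℂ) * (1 / (x - ρ))) + logDeriv G x := by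
    intro x hx
    have hfe : xiF = fun x => (∏ ρ ∈ Zn n, (x - (ρ:ℂ)) ^ analyticOrderNatAt xiF (ρ:ℂ)) * g x := funext hfg
    have hp : (∏ ρ ∈ Zn n, (x - (ρ:ℂ)) ^ analyticOrderNatAt xiF ρ) ≠ 0 := by
      intro h; rw [hfg, h, zero_mul] at hx; exact hx rfl
    have hxρ : ∀ ρ : Zt, x - (ρ:ℂ) ≠ 0 := by
      intro ρ h
      rw [sub_eq_zero] at h
      exact hx (h ▸ ρ.2)
    have e1 : logDeriv xiF x = logDeriv (fun x => (∏ ρ ∈ Zn n, (x - (ρ:ℂ)) ^ analyticOrderNatAt xiF (ρ:ℂ)) * g x) x :=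
      congrArg (fun f => logDeriv f x) hfe
    rw [e1, logDeriv_mul x hp (hfg0 x hx) (by fun_prop) (hg x),
      logDeriv_prod (f := fun (ρ : Zt) x => (x - (ρ:ℂ)) ^ analyticOrderNatAt xiF ρ)
        (fun ρ _ => pow_ne_zero _ (hxρ ρ)) (by fun_prop)]
    congr 1
    · apply Finset.sum_congr rfl
      intro ρ _
      rw [logDeriv_fun_pow (by fun_prop)]
      simp [mz, logDeriv_apply, deriv_sub_const]
    · rw [hGdef, logDeriv_mul_const x _ (inv_ne_zero hg0)]
  rw [hld z hz, hld w hw, dist_eq_norm]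
  simp only [mul_sub, Finset.sum_sub_distrib]
  rw [show ∀ a b c d : ℂ, a - b - (a + c - (b + d)) = -(c - d) by intros; ring, norm_neg]
  refine hv.trans_lt ?_
  have : 64 * (ε * (3 * R) ^ 2) / R ^ 2 * ‖z - w‖ = 576 * ‖z-w‖ * ε := by field_simp; norm_num; ring
  rw [this, hε, ← mul_div_assoc, div_lt_iff₀ (by positivity)]
  have := norm_nonneg (z - w)
  nlinarith


lemma Zt_re (hRH : RiemannHypothesis) (ρ : Zt) : (ρ:ℂ).re = 1/2 := xiF_zero_re hRH ρ.2

lemma Zt_one_sub (hRH : RiemannHypothesis) (ρ : Zt) : 1 - (ρ:ℂ) = (starRingEnd ℂ) ρ := by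
  have := Zt_re hRH ρ
  apply Complex.ext <;> simp [this]; norm_num

lemma Zt_norm_one_sub (hRH : RiemannHypothesis) (ρ : Zt) : ‖1 - (ρ:ℂ)‖ = ‖(ρ:ℂ)‖ := by
  rw [Zt_one_sub hRH, RCLike.norm_conj]

lemma Zt_norm_sq (hRH : RiemannHypothesis) (ρ : Zt) : ‖(ρ:ℂ)‖ ^ 2 = 1/4 + (ρ:ℂ).im ^ 2 := by
  have := Zt_re hRH ρ
  rw [← normSq_eq_norm_sq, normSq_apply, this]; ring

lemma term_one_zero (hRH : RiemannHypothesis) (ρ : Zt) : (1 / (1 - (ρ:ℂ)) - 1 / (0 - (ρ:ℂ))) = ((1 / ‖(ρ:ℂ)‖ ^ 2 : ℝ) : ℂ) := by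
  have h0 := Zt_ne_zero ρ
  have h1 : 1 - (ρ:ℂ) ≠ 0 := by
    rw [← norm_ne_zero_iff, Zt_norm_one_sub hRH, norm_ne_zero_iff]; exact h0
  have h2 : (1 - (ρ:ℂ)) * ρ = ((‖(ρ:ℂ)‖ ^ 2 : ℝ) : ℂ) := by
    rw [Zt_one_sub hRH, mul_comm, mul_conj, normSq_eq_norm_sq]
  push_cast at h2 ⊢
  rw [← h2, zero_sub]
  field_simp
  ring

lemma logDeriv_xiF_zero : logDeriv xiF 0 = - logDeriv xiF 1 := by
  have h : (fun s => xiF (1 - s)) = xiF := funext xiF_one_sub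
  have : deriv xiF 0 = - deriv xiF 1 := by
    conv_lhs => rw [← h]
    rw [deriv_comp_const_sub]; simp
  simp [logDeriv_apply, this, xiF_zero, xiF_one]

lemma hasSum_M0 (hRH : RiemannHypothesis) : HasSum (fun ρ : Zt => mz ρ / ‖(ρ:ℂ)‖ ^ 2) (2 * (logDeriv xiF 1).re) := by
  have h := hadamard_lim (z := 1) (w := 0) (by rw [xiF_one]; exact one_ne_zero) (by rw [xiF_zero]; exact one_ne_zero)
  rw [logDeriv_xiF_zero] at h
  have h2 := (continuous_re.tendsto _).comp h
  have e : (re ∘ fun n => ∑ ρ ∈ Zn n, (mz ρ : ℂ) * (1 / (1 - (ρ:ℂ)) - 1 / (0 - (ρ:ℂ)))) =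
      fun n => ∑ ρ ∈ Zn n, mz ρ / ‖(ρ:ℂ)‖ ^ 2 := by
    funext n
    simp only [Function.comp, re_sum]
    apply Finset.sum_congr rfl
    intro ρ _
    rw [term_one_zero hRH, ← ofReal_mul, ofReal_re]; ring
  rw [e] at h2
  have e2 : (logDeriv xiF 1 - -logDeriv xiF 1).re = 2 * (logDeriv xiF 1).re := by simp; ring
  rw [e2] at h2
  have hnn : ∀ ρ : Zt, 0 ≤ mz ρ / ‖(ρ:ℂ)‖ ^ 2 := fun ρ => div_nonneg (mz_nonneg ρ) (by positivity)
  have hsm : Summable (fun ρ : Zt => mz ρ / ‖(ρ:ℂ)‖ ^ 2) := by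
    apply summable_of_sum_le (c := 2 * (logDeriv xiF 1).re) hnn
    intro u
    apply ge_of_tendsto h2
    filter_upwards [Zn_tendsto.eventually_ge_atTop u] with n hn
    exact Finset.sum_le_sum_of_subset_of_nonneg hn fun ρ _ _ => hnn ρ
  have := (hsm.hasSum.comp Zn_tendsto)
  rw [tendsto_nhds_unique h2 this]
  exact hsm.hasSum

lemma summable_M0 (hRH : RiemannHypothesis) : Summable (fun ρ : Zt => mz ρ / ‖(ρ:ℂ)‖ ^ 2) := (hasSum_M0 hRH).summable

lemma hasSum_hadamard (hRH : RiemannHypothesis) {z w : ℂ} (hz : xiF z ≠ 0) (hw : xiF w ≠ 0) :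
    HasSum (fun ρ : Zt => (mz ρ : ℂ) * (1 / (z - ρ) - 1 / (w - ρ))) (logDeriv xiF z - logDeriv xiF w) := by
  have hsm : Summable (fun ρ : Zt => (mz ρ : ℂ) * (1 / (z - ρ) - 1 / (w - ρ))) := by
    apply Summable.of_norm_bounded_eventually (g := fun ρ : Zt => 4 * ‖w - z‖ * (mz ρ / ‖(ρ:ℂ)‖ ^ 2))
      ((summable_M0 hRH).mul_left _)
    obtain ⟨n, hn⟩ := exists_nat_ge (2 * (‖z‖ + ‖w‖))
    refine (Zn_finite n).subset ?_
    intro ρ hρ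
    by_contra hlt
    apply hρ
    have hlt : (n:ℝ) < ‖(ρ:ℂ)‖ := not_le.mp hlt
    have hxρ : ∀ x : ℂ, xiF x ≠ 0 → x - (ρ:ℂ) ≠ 0 := by
      intro x hx h
      rw [sub_eq_zero] at h
      exact hx (h ▸ ρ.2)
    have e : 1 / (z - (ρ:ℂ)) - 1 / (w - ρ) = (w - z) / ((z - ρ) * (w - ρ)) := by
      have := hxρ z hz
      have := hxρ w hw
      field_simp; ring
    have hz1 : ‖(ρ:ℂ)‖ / 2 ≤ ‖z - ρ‖ := by
      have := norm_sub_norm_le (ρ:ℂ) z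
      rw [norm_sub_rev] at this
      have := norm_nonneg w
      linarith
    have hw1 : ‖(ρ:ℂ)‖ / 2 ≤ ‖w - ρ‖ := by
      have := norm_sub_norm_le (ρ:ℂ) w
      rw [norm_sub_rev] at this
      have := norm_nonneg z
      linarith
    show ‖(mz ρ : ℂ) * (1 / (z - (ρ:ℂ)) - 1 / (w - (ρ:ℂ)))‖ ≤ 4 * ‖w - z‖ * (mz ρ / ‖(ρ:ℂ)‖ ^ 2)
    rw [e, norm_mul, norm_div, norm_mul, norm_real, Real.norm_of_nonneg (mz_nonneg ρ)]
    have hρ0 : 0 < ‖(ρ:ℂ)‖ := norm_pos_iff.mpr (Zt_ne_zero ρ)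
    have hm := mz_nonneg ρ
    calc mz ρ * (‖w - z‖ / (‖z - ρ‖ * ‖w - ρ‖)) ≤ mz ρ * (‖w - z‖ / (‖(ρ:ℂ)‖ / 2 * (‖(ρ:ℂ)‖ / 2))) := by gcongr
      _ = _ := by field_simp; norm_num
  have h1 := hadamard_lim hz hw
  have h2 := hsm.hasSum.comp Zn_tendsto
  rw [tendsto_nhds_unique h1 h2]
  exact hsm.hasSum

end

section
open Complex Filter

noncomputable def psiR (x : ℝ) : ℝ := deriv (Real.log ∘ Real.Gamma) x

lemma psiR_diff {x : ℝ} (hx : 0 < x) : DifferentiableAt ℝ (Real.log ∘ Real.Gamma) x := by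
  refine ((Real.differentiableAt_Gamma ?_).log (Real.Gamma_ne_zero ?_)) <;>
    exact fun m ↦ ne_of_gt (by have : (0:ℝ) ≤ m := Nat.cast_nonneg m; linarith)

lemma logGamma_rec {x : ℝ} (hx : 0 < x) :
    (Real.log ∘ Real.Gamma) (x + 1) = (Real.log ∘ Real.Gamma) x + Real.log x := by
  simp only [Function.comp_apply, Real.Gamma_add_one hx.ne',
    Real.log_mul hx.ne' (Real.Gamma_pos_of_pos hx).ne', add_comm]

lemma psiR_add_one {x : ℝ} (hx : 0 < x) : psiR (x + 1) = psiR x + 1 / x := by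
  unfold psiR
  rw [← deriv_comp_add_const, one_div, ← Real.deriv_log,
      ← deriv_add (psiR_diff <| by positivity) (Real.differentiableAt_log hx.ne')]
  apply EventuallyEq.deriv_eq
  filter_upwards [eventually_gt_nhds hx] with y hy using logGamma_rec hy

lemma psiR_add_nat {x : ℝ} (hx : 0 < x) (n : ℕ) :
    psiR (x + n) = psiR x + ∑ k ∈ Finset.range n, 1 / (x + k) := by
  induction n with
  | zero => simp
  | succ n ih =>
    rw [Finset.sum_range_succ, Nat.cast_succ, ← add_assoc, psiR_add_one (by positivity), ih]; ring

lemma log_le_psiR {x : ℝ} (hx : 0 < x) : Real.log x ≤ psiR (x + 1) := by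
  refine (le_of_eq ?_).trans <| Real.convexOn_log_Gamma.slope_le_deriv (x := x) (y := x + 1) hx
      (show (0:ℝ) < x + 1 by linarith) (by linarith) (psiR_diff <| by positivity)
  rw [slope_def_field, show x + 1 - x = (1 : ℝ) by ring, div_one, logGamma_rec hx, add_sub_cancel_left]

lemma psiR_le_log {x : ℝ} (hx : 0 < x) : psiR x ≤ Real.log x := by
  refine (Real.convexOn_log_Gamma.deriv_le_slope (x := x) (y := x + 1) hx (show (0:ℝ) < x + 1 by linarith)
        (by linarith) (psiR_diff hx)).trans (le_of_eq ?_)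
  rw [slope_def_field, show x + 1 - x = (1 : ℝ) by ring, div_one, logGamma_rec hx, add_sub_cancel_left]

lemma psiR_sub_log {x : ℝ} (hx : 0 < x) :
    Tendsto (fun n : ℕ => psiR (x + n) - Real.log n) atTop (nhds 0) := by
  have h1 : ∀ c : ℝ, Tendsto (fun n : ℕ => Real.log (n + c) - Real.log n) atTop (nhds 0) := by
    intro c
    exact (Real.tendsto_log_comp_add_sub_log c).comp tendsto_natCast_atTop_atTop
  refine tendsto_of_tendsto_of_tendsto_of_le_of_le' (h1 (x - 1)) (h1 x) ?_ ?_
  · filter_upwards [eventually_ge_atTop 1] with n hn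
    have hn : (1:ℝ) ≤ n := by exact_mod_cast hn
    have := log_le_psiR (x := n + (x - 1)) (by linarith)
    rw [show (n:ℝ) + (x - 1) + 1 = x + n by ring] at this
    linarith
  · filter_upwards with n
    have := psiR_le_log (x := x + n) (by positivity)
    rw [add_comm] at this
    rw [add_comm x]
    linarith

lemma hasSum_psiR {x : ℝ} (hx : 1 / 2 ≤ x) :
    HasSum (fun k : ℕ => 1 / (1 / 2 + (k:ℝ)) - 1 / (x + k)) (psiR x - psiR (1 / 2)) := by
  rw [hasSum_iff_tendsto_nat_of_nonneg]
  · have h := ((psiR_sub_log (x := 1 / 2) (by norm_num)).sub (psiR_sub_log (x := x) (by linarith))).add_const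
      (psiR x - psiR (1 / 2))
    simp only [sub_self, zero_add] at h
    refine h.congr fun n => ?_
    rw [psiR_add_nat (by norm_num), psiR_add_nat (by linarith), Finset.sum_sub_distrib]; ring
  · intro k
    rw [sub_nonneg]
    apply one_div_le_one_div_of_le (by positivity)
    linarith

lemma digamma_ofReal {x : ℝ} (hx : 0 < x) : digamma (x:ℂ) = (psiR x : ℂ) := by
  have hne : ∀ m : ℕ, x ≠ -m := fun m => ne_of_gt (by have : (0:ℝ) ≤ m := Nat.cast_nonneg m; linarith)
  have hd := Real.differentiableAt_Gamma hne
  have hdc : DifferentiableAt ℂ Gamma (x:ℂ) := differentiableAt_Gamma _ (fun m h => hne m (by exact_mod_cast h))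
  have h1 := hdc.hasDerivAt.comp_ofReal
  have h2 := hd.hasDerivAt.ofReal_comp
  have e : (fun y : ℝ => Gamma (y:ℂ)) = fun y : ℝ => ((Real.Gamma y : ℝ) : ℂ) := by
    funext y; exact Gamma_ofReal y
  rw [e] at h1
  have h3 := h1.unique h2
  rw [digamma_def, logDeriv_apply, h3, Gamma_ofReal]
  unfold psiR
  rw [Function.comp_def, deriv.log hd (Real.Gamma_pos_of_pos hx).ne']
  push_cast; rfl

noncomputable def dgT (k : ℕ) (z : ℂ) : ℂ := (z - 1 / 2) / ((k + 1 / 2) * (z + k))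

lemma dgT_bound (k : ℕ) (z : ℂ) (hz : 0 < z.re) (hk : 1 ≤ k) : ‖dgT k z‖ ≤ ‖z - 1/2‖ * (1 / (k:ℝ) ^ 2) := by
  unfold dgT
  have hk' : (1:ℝ) ≤ k := by exact_mod_cast hk
  rw [norm_div, norm_mul]
  have h1 : (k:ℝ) ≤ ‖(k:ℂ) + 1 / 2‖ := by
    refine le_trans ?_ (re_le_norm _)
    simp
  have h2 : (k:ℝ) ≤ ‖z + (k:ℂ)‖ := by
    refine le_trans ?_ (re_le_norm _)
    simp; linarith
  calc ‖z - 1/2‖ / (‖(k:ℂ) + 1 / 2‖ * ‖z + (k:ℂ)‖) ≤ ‖z - 1/2‖ / ((k:ℝ) * k) := by gcongr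
    _ = _ := by ring

lemma dgT_summable (z : ℂ) (hz : 0 < z.re) : Summable (fun k => dgT k z) := by
  rw [← summable_nat_add_iff 1]
  have h := ((summable_nat_add_iff 1).mpr (Real.summable_one_div_nat_pow.mpr (show 1 < 2 by norm_num))).mul_left ‖z - 1/2‖
  exact Summable.of_norm_bounded h fun k => dgT_bound (k+1) z hz (by omega)

lemma dgT_sum_diff : DifferentiableOn ℂ (fun z => ∑' k, dgT k z) {z | 0 < z.re} := by
  have hopen : IsOpen {z : ℂ | 0 < z.re} := isOpen_lt continuous_const continuous_re
  intro z₀ hz₀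
  apply DifferentiableAt.differentiableWithinAt
  have hU : IsOpen ({z : ℂ | 0 < z.re} ∩ Metric.ball z₀ 1) := hopen.inter Metric.isOpen_ball
  have hd : ∀ k, DifferentiableOn ℂ (dgT k) {z | 0 < z.re} := by
    intro k z hz
    have hz : 0 < z.re := hz
    have h1 : (k:ℂ) + 1/2 ≠ 0 := by
      intro h; have := congrArg re h; simp at this
      have h0 : (0:ℝ) ≤ k := Nat.cast_nonneg k
      linarith
    have h2 : z + (k:ℂ) ≠ 0 := by
      intro h; have := congrArg re h; simp at this
      have h0 : (0:ℝ) ≤ k := Nat.cast_nonneg k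
      linarith
    unfold dgT
    apply DifferentiableAt.differentiableWithinAt
    exact DifferentiableAt.fun_div (by fun_prop) (by fun_prop) (mul_ne_zero h1 h2)
  have h := (summable_nat_add_iff 1).mpr (Real.summable_one_div_nat_pow.mpr (show 1 < 2 by norm_num))
  have hD := differentiableOn_tsum_of_summable_norm (F := fun k z => dgT (k+1) z)
    (U := {z : ℂ | 0 < z.re} ∩ Metric.ball z₀ 1)
    (h.mul_left (‖z₀ - 1/2‖ + 1)) (fun k => (hd (k+1)).mono Set.inter_subset_left) hU (by
      intro k z hz
      refine (dgT_bound (k+1) z hz.1 (by omega)).trans ?_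
      gcongr
      have h1 : ‖z - z₀‖ < 1 := by simpa [dist_eq_norm] using hz.2
      have := norm_add_le (z - z₀) (z₀ - 1/2)
      rw [sub_add_sub_cancel] at this
      linarith)
  have hmem : {z : ℂ | 0 < z.re} ∩ Metric.ball z₀ 1 ∈ nhds z₀ := hU.mem_nhds ⟨hz₀, Metric.mem_ball_self one_pos⟩
  have h3 := (hd 0).differentiableAt (hopen.mem_nhds hz₀) |>.add (hD.differentiableAt hmem)
  refine h3.congr_of_eventuallyEq ?_
  filter_upwards [hmem] with z hz
  rw [(dgT_summable z hz.1).tsum_eq_zero_add]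
  rfl

lemma digamma_tsum {z : ℂ} (hz : 0 < z.re) : digamma z - digamma (1 / 2) = ∑' k, dgT k z := by
  have hopen : IsOpen {z : ℂ | 0 < z.re} := isOpen_lt continuous_const continuous_re
  have hGd : ∀ z : ℂ, 0 < z.re → DifferentiableAt ℂ Gamma z := by
    intro z hz
    apply differentiableAt_Gamma
    intro m h
    rw [h] at hz
    simp at hz
    have h0 : (0:ℝ) ≤ m := Nat.cast_nonneg m
    linarith
  have hA1 : AnalyticOnNhd ℂ (fun z => digamma z - digamma (1/2)) {z | 0 < z.re} := by
    apply DifferentiableOn.analyticOnNhd _ hopen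
    have hG : DifferentiableOn ℂ Gamma {z | 0 < z.re} := fun z hz => (hGd z hz).differentiableWithinAt
    have : DifferentiableOn ℂ digamma {z | 0 < z.re} := by
      rw [digamma_def]
      exact (hG.deriv hopen).div hG fun z hz => Gamma_ne_zero_of_re_pos hz
    exact this.sub_const _
  have hA2 : AnalyticOnNhd ℂ (fun z => ∑' k, dgT k z) {z | 0 < z.re} :=
    dgT_sum_diff.analyticOnNhd hopen
  have hpre : IsPreconnected {z : ℂ | 0 < z.re} := (convex_halfSpace_re_gt 0).isPreconnected
  refine hA1.eqOn_of_preconnected_of_frequently_eq hA2 hpre (show (1:ℂ) ∈ {z : ℂ | 0 < z.re} by simp) ?_ hz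
  have ht : Tendsto (fun n : ℕ => (((1 + 1 / ((n:ℝ) + 1) : ℝ)) : ℂ)) atTop (nhdsWithin 1 {1}ᶜ) := by
    rw [tendsto_nhdsWithin_iff]
    constructor
    · have h1 : Tendsto (fun n : ℕ => (1 + 1 / ((n:ℝ) + 1) : ℝ)) atTop (nhds (1 + 0)) :=
        tendsto_one_div_add_atTop_nhds_zero_nat.const_add 1
      have := (continuous_ofReal.tendsto (1 + 0 : ℝ)).comp h1
      simpa [Function.comp_def] using this
    · refine Eventually.of_forall fun n => ?_
      simp only [Set.mem_compl_iff, Set.mem_singleton_iff]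
      intro h
      have h' : (1 + 1 / ((n:ℝ) + 1) : ℝ) = 1 := by exact_mod_cast h
      have : 0 < 1 / ((n:ℝ) + 1) := by positivity
      linarith
  apply ht.frequently
  apply Frequently.of_forall
  intro n
  set x : ℝ := 1 + 1 / ((n:ℝ) + 1) with hxd
  have hx : 1 / 2 ≤ x := by
    have : 0 < 1 / ((n:ℝ) + 1) := by positivity
    linarith
  have hh : digamma (1/2) = (psiR (1/2) : ℂ) := by
    rw [← digamma_ofReal (by norm_num)]; norm_num
  rw [digamma_ofReal (by linarith), hh]
  have := (hasSum_ofReal.mpr (hasSum_psiR hx)).tsum_eq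
  rw [← ofReal_sub, ← this]
  apply tsum_congr
  intro k
  unfold dgT
  have h0 : (0:ℝ) ≤ k := Nat.cast_nonneg k
  have h1 : 1/2 + (k:ℝ) ≠ 0 := by positivity
  have h1' : (k:ℝ) + 1/2 ≠ 0 := by positivity
  have h2 : x + (k:ℝ) ≠ 0 := by positivity
  have : 1 / (1/2 + (k:ℝ)) - 1 / (x + k) = (x - 1/2) / ((k + 1/2) * (x + k)) := by
    rw [div_sub_div _ _ h1 h2]
    rw [div_eq_div_iff (mul_ne_zero h1 h2) (mul_ne_zero h1' h2)]
    ring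
  rw [this]
  push_cast
  rfl

lemma logDeriv_GammaR {s : ℂ} (hs : 0 < s.re) :
    logDeriv Gammaℝ s = -(Real.log Real.pi : ℂ) / 2 + digamma (s / 2) / 2 := by
  have hpi : (Real.pi : ℂ) ≠ 0 := by exact_mod_cast Real.pi_pos.ne'
  have e : Gammaℝ = fun s : ℂ => (Real.pi : ℂ) ^ (-s / 2) * Gamma (s / 2) := funext fun s => Gammaℝ_def s
  have hre : 0 < (s/2).re := by simpa using hs
  have hGd : DifferentiableAt ℂ Gamma (s/2) := by
    apply differentiableAt_Gamma
    intro m h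
    rw [h] at hre
    simp at hre
    have h0 : (0:ℝ) ≤ m := Nat.cast_nonneg m
    linarith
  have hGd2 : HasDerivAt (fun s : ℂ => Gamma (s / 2)) (deriv Gamma (s/2) * (1/2)) s :=
    HasDerivAt.comp s hGd.hasDerivAt ((hasDerivAt_id s).div_const 2)
  have hp : HasDerivAt (fun s : ℂ => (Real.pi : ℂ) ^ (-s / 2)) ((Real.pi : ℂ) ^ (-s / 2) * log Real.pi * (-1 / 2)) s :=
    HasDerivAt.const_cpow ((hasDerivAt_id s).neg.div_const 2) (Or.inl hpi)
  have hpn : (Real.pi : ℂ) ^ (-s / 2) ≠ 0 := by simp [cpow_eq_zero_iff, hpi]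
  have hgn : Gamma (s/2) ≠ 0 := Gamma_ne_zero_of_re_pos hre
  rw [e, logDeriv_mul s hpn hgn hp.differentiableAt hGd2.differentiableAt, logDeriv_apply, logDeriv_apply,
    hp.deriv, hGd2.deriv, digamma_def, logDeriv_apply, ← ofReal_log Real.pi_pos.le]
  field_simp

lemma logDeriv_xiF {s : ℂ} (hs : 1 < s.re) :
    logDeriv xiF s = 1 / s + 1 / (s - 1) + logDeriv Gammaℝ s + logDeriv riemannZeta s := by
  have h0 : s ≠ 0 := by rintro rfl; simp at hs; linarith
  have h1 : s ≠ 1 := by rintro rfl; simp at hs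
  have h1' := sub_ne_zero.mpr h1
  have hG : Gammaℝ s ≠ 0 := Gammaℝ_ne_zero_of_re_pos (by linarith)
  have hz : riemannZeta s ≠ 0 := riemannZeta_ne_zero_of_one_le_re hs.le
  have hdG : DifferentiableAt ℂ Gammaℝ s := by
    have := differentiable_Gammaℝ_inv s
    have h2 := this.inv (inv_ne_zero hG)
    have e2 : (fun s : ℂ => (Gammaℝ s)⁻¹)⁻¹ = Gammaℝ := by funext z; simp
    rwa [e2] at h2
  have he : xiF =ᶠ[nhds s] fun s => (s * (s - 1)) * (Gammaℝ s * riemannZeta s) := by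
    have : {z : ℂ | 1 < z.re} ∈ nhds s := (isOpen_lt continuous_const continuous_re).mem_nhds hs
    filter_upwards [this] with z hz
    exact xiF_eq_zeta hz
  have hdz := differentiableAt_riemannZeta h1
  have e : logDeriv xiF s = logDeriv (fun s => (s * (s - 1)) * (Gammaℝ s * riemannZeta s)) s := by
    rw [logDeriv_apply, logDeriv_apply, he.deriv_eq, he.self_of_nhds]
  rw [e, logDeriv_mul (f := fun s : ℂ => s * (s - 1)) (g := fun s => Gammaℝ s * riemannZeta s) s
    (mul_ne_zero h0 h1') (mul_ne_zero hG hz) (by fun_prop) (hdG.mul hdz),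
    logDeriv_mul (f := fun s : ℂ => s) (g := fun s => s - 1) s h0 h1' (by fun_prop) (by fun_prop),
    logDeriv_mul s hG hz hdG hdz]
  have : logDeriv (fun s : ℂ => s - 1) s = 1 / (s - 1) := by
    rw [logDeriv_apply, deriv_sub_const]; simp
  rw [this, logDeriv_id']
  ring

lemma logDeriv_xiF_one : logDeriv xiF 1 =
    ((1 + Real.eulerMascheroniConstant / 2 - Real.log (4 * Real.pi) / 2 : ℝ) : ℂ) := by
  have h : HasDerivAt xiF (completedRiemannZeta₀ 1) 1 := by
    have h1 : HasDerivAt (fun s : ℂ => s * (s - 1)) (1 * (1 - 1) + 1 * 1) 1 :=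
      (hasDerivAt_id (1:ℂ)).mul ((hasDerivAt_id (1:ℂ)).sub_const 1)
    have h2 := (h1.mul (differentiable_completedZeta₀ 1).hasDerivAt).add_const 1
    have e : ((1:ℂ) * (1 - 1) + 1 * 1) * completedRiemannZeta₀ 1 + 1 * (1 - 1) * deriv completedRiemannZeta₀ 1
      = completedRiemannZeta₀ 1 := by ring
    rw [e] at h2
    exact h2
  rw [logDeriv_apply, h.deriv, xiF_one, completedRiemannZeta₀_one]
  have : Complex.log (4 * Real.pi) = ((Real.log (4 * Real.pi) : ℝ) : ℂ) := by
    rw [ofReal_log (by positivity)]; push_cast; rfl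
  rw [this]
  push_cast; ring

end

section
open Complex Filter MeasureTheory

/-- `f` has exponential growth bound `C e^{3u/4}` and Laplace transform `F` on `re s = 1`. -/
def Lap (f : ℝ → ℂ) (F : ℂ → ℂ) (C : ℝ) : Prop :=
  ContinuousOn f (Set.Ioi 0) ∧ (∀ u : ℝ, 0 < u → ‖f u‖ ≤ C * Real.exp (3 / 4 * u)) ∧
  ∀ s : ℂ, s.re = 1 → ∫ u : ℝ in Set.Ioi 0, cexp (-s * u) * f u = F s

lemma lap_norm_le {f : ℝ → ℂ} {C : ℝ} {s : ℂ} (hs : s.re = 1) {u : ℝ}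
    (h : ‖f u‖ ≤ C * Real.exp (3 / 4 * u)) :
    ‖cexp (-s * u) * f u‖ ≤ C * Real.exp (-(1/4) * u) := by
  rw [norm_mul, Complex.norm_exp]
  have : (-s * (u:ℂ)).re = - u := by simp [hs]
  rw [this]
  calc Real.exp (-u) * ‖f u‖ ≤ Real.exp (-u) * (C * Real.exp (3 / 4 * u)) := by gcongr
    _ = C * (Real.exp (-u) * Real.exp (3 / 4 * u)) := by ring
    _ = _ := by rw [← Real.exp_add]; ring_nf

lemma lap_integrable {f : ℝ → ℂ} {C : ℝ} (hf : ContinuousOn f (Set.Ioi 0))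
    (hb : ∀ u : ℝ, 0 < u → ‖f u‖ ≤ C * Real.exp (3 / 4 * u)) {s : ℂ} (hs : s.re = 1) :
    IntegrableOn (fun u : ℝ ↦ cexp (-s * u) * f u) (Set.Ioi 0) := by
  refine Integrable.mono' (g := fun u ↦ C * Real.exp (-(1/4) * u)) ?_ ?_ ?_
  · exact (integrableOn_exp_mul_Ioi (by norm_num) 0).const_mul C
  · refine ContinuousOn.aestronglyMeasurable ?_ measurableSet_Ioi
    exact ContinuousOn.mul (by fun_prop) hf
  · filter_upwards [ae_restrict_mem measurableSet_Ioi] with u hu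
    exact lap_norm_le hs (hb u hu)

lemma Lap.integrable {f : ℝ → ℂ} {F : ℂ → ℂ} {C : ℝ} (h : Lap f F C) {s : ℂ} (hs : s.re = 1) :
    IntegrableOn (fun u : ℝ ↦ cexp (-s * u) * f u) (Set.Ioi 0) :=
  lap_integrable h.1 h.2.1 hs

lemma Lap.add {f g : ℝ → ℂ} {F G : ℂ → ℂ} {C D : ℝ} (hf : Lap f F C) (hg : Lap g G D) :
    Lap (fun u ↦ f u + g u) (fun s ↦ F s + G s) (C + D) := by
  refine ⟨hf.1.add hg.1, fun u hu ↦ ?_, fun s hs ↦ ?_⟩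
  · rw [add_mul]
    exact (norm_add_le _ _).trans (add_le_add (hf.2.1 u hu) (hg.2.1 u hu))
  · beta_reduce
    rw [← hf.2.2 s hs, ← hg.2.2 s hs, ← integral_add (hf.integrable hs) (hg.integrable hs)]
    simp only [mul_add]

lemma Lap.const_mul {f : ℝ → ℂ} {F : ℂ → ℂ} {C : ℝ} (hf : Lap f F C) (a : ℂ) :
    Lap (fun u ↦ a * f u) (fun s ↦ a * F s) (‖a‖ * C) := by
  refine ⟨continuousOn_const.mul hf.1, fun u hu ↦ ?_, fun s hs ↦ ?_⟩
  · rw [norm_mul, mul_assoc]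
    exact mul_le_mul_of_nonneg_left (hf.2.1 u hu) (norm_nonneg _)
  · beta_reduce
    rw [← hf.2.2 s hs, ← integral_const_mul]
    congr 1; ext u; ring

lemma Lap.sub {f g : ℝ → ℂ} {F G : ℂ → ℂ} {C D : ℝ} (hf : Lap f F C) (hg : Lap g G D) :
    Lap (fun u ↦ f u - g u) (fun s ↦ F s - G s) (C + ‖(-1:ℂ)‖ * D) := by
  have := hf.add (hg.const_mul (-1))
  simpa only [neg_one_mul, ← sub_eq_add_neg] using this

lemma Lap.tsum {ι : Type} [Countable ι] {f : ι → ℝ → ℂ} {F : ι → ℂ → ℂ} {C : ι → ℝ}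
    (hf : ∀ i, Lap (f i) (F i) (C i)) (hC : Summable C) :
    Lap (fun u ↦ ∑' i, f i u) (fun s ↦ ∑' i, F i s) (∑' i, C i) := by
  have hb : ∀ u : ℝ, 0 < u → ‖∑' i, f i u‖ ≤ (∑' i, C i) * Real.exp (3 / 4 * u) := by
    intro u hu
    rw [← tsum_mul_right]
    exact tsum_of_norm_bounded (hC.mul_right _).hasSum (fun i ↦ (hf i).2.1 u hu)
  have hC0 : ∀ i, 0 ≤ C i := fun i ↦ by
    have := (norm_nonneg _).trans ((hf i).2.1 1 one_pos)
    exact nonneg_of_mul_nonneg_left this (Real.exp_pos _)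
  have hc : ContinuousOn (fun u ↦ ∑' i, f i u) (Set.Ioi 0) := by
    intro u hu
    have : ContinuousOn (fun u ↦ ∑' i, f i u) (Set.Ioo 0 (u+1)) := by
      refine continuousOn_tsum (u := fun i ↦ C i * Real.exp (3/4*(u+1)))
        (fun i ↦ (hf i).1.mono Set.Ioo_subset_Ioi_self) (hC.mul_right _) (fun i v hv ↦ ?_)
      refine ((hf i).2.1 v hv.1).trans ?_
      have := hC0 i
      have := hv.2.le
      gcongr
    exact (this.continuousAt (Ioo_mem_nhds hu (lt_add_one u))).continuousWithinAt
  refine ⟨hc, hb, fun s hs ↦ ?_⟩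
  have key := hasSum_integral_of_summable_integral_norm (μ := volume.restrict (Set.Ioi (0:ℝ)))
    (F := fun i (u:ℝ) ↦ cexp (-s * u) * f i u) (fun i ↦ (hf i).integrable hs) ?_
  · simp only [(hf _).2.2 s hs, tsum_mul_left] at key
    exact key.tsum_eq.symm
  · refine Summable.of_nonneg_of_le (fun i ↦ integral_nonneg (fun u ↦ norm_nonneg _)) (fun i ↦ ?_)
      (hC.mul_right (∫ u in Set.Ioi (0:ℝ), Real.exp (-(1/4) * u)))
    rw [← integral_const_mul]
    refine setIntegral_mono_on ((hf i).integrable hs).norm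
      ((integrableOn_exp_mul_Ioi (by norm_num) 0).const_mul _) measurableSet_Ioi (fun u hu ↦ ?_)
    exact lap_norm_le hs ((hf i).2.1 u hu)

open FourierTransform in
lemma Lap.eq_zero {f : ℝ → ℂ} {C : ℝ} (hf : Lap f (fun _ ↦ 0) C) {u : ℝ} (hu : 0 < u) :
    f u = 0 := by
  set φ : ℝ → ℂ := Set.indicator (Set.Ioi 0) (fun u : ℝ ↦ cexp (-1 * u) * f u) with hφ
  have hi : Integrable φ := by
    rw [hφ, integrable_indicator_iff measurableSet_Ioi]
    exact hf.integrable (by simp)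
  have h0 : 𝓕 φ = 0 := by
    ext t
    rw [Real.fourier_real_eq_integral_exp_smul]
    have : (fun v : ℝ ↦ cexp (↑(-2 * Real.pi * v * t) * I) • φ v) =
        Set.indicator (Set.Ioi 0) (fun v : ℝ ↦ cexp (-(1 + 2 * Real.pi * t * I) * v) * f v) := by
      ext v
      by_cases hv : v ∈ Set.Ioi (0:ℝ)
      · simp only [hφ, Set.indicator_of_mem hv, smul_eq_mul, ← mul_assoc, ← Complex.exp_add]
        congr 2; push_cast; ring
      · simp only [hφ, Set.indicator_of_notMem hv, smul_zero]
    rw [this, integral_indicator measurableSet_Ioi]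
    exact hf.2.2 _ (by simp)
  have hc : ContinuousAt φ u := by
    have h1 : ContinuousAt (fun u : ℝ ↦ cexp (-1 * u) * f u) u := by
      refine ContinuousAt.mul (by fun_prop) (hf.1.continuousAt (Ioi_mem_nhds hu))
    refine h1.congr ?_
    filter_upwards [Ioi_mem_nhds hu] with v hv
    simp only [hφ, Set.indicator_of_mem hv]
  have := hi.fourierInv_fourier_eq (by rw [h0]; exact integrable_zero _ _ _) hc
  rw [h0] at this
  have h2 : 𝓕⁻ (0 : ℝ → ℂ) u = 0 := by
    rw [Real.fourierInv_eq]; simp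
  rw [h2] at this
  have h3 : φ u = cexp (-1 * u) * f u := by simp only [hφ, Set.indicator_of_mem (show u ∈ Set.Ioi (0:ℝ) from hu)]
  rw [h3] at this
  exact (mul_eq_zero.mp this.symm).resolve_left (Complex.exp_ne_zero _)

lemma Lap.congr {f : ℝ → ℂ} {F G : ℂ → ℂ} {C : ℝ} (hf : Lap f F C)
    (h : ∀ s : ℂ, s.re = 1 → F s = G s) : Lap f G C :=
  ⟨hf.1, hf.2.1, fun s hs ↦ (hf.2.2 s hs).trans (h s hs)⟩

lemma Lap.exp {a : ℂ} (ha : a.re ≤ 3/4) : Lap (fun u ↦ cexp (a * u)) (fun s ↦ 1 / (s - a)) 1 := by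
  refine ⟨by fun_prop, fun u hu ↦ ?_, fun s hs ↦ ?_⟩
  · rw [Complex.norm_exp, one_mul]
    apply Real.exp_le_exp.mpr
    simp; gcongr
  · simp only [← Complex.exp_add, ← add_mul]
    rw [integral_exp_mul_complex_Ioi (by simp [hs]; linarith)]
    have : s - a ≠ 0 := fun h ↦ by
      have := congrArg re h
      simp [hs] at this; linarith
    have h2 : -s + a ≠ 0 := by rw [← neg_ne_zero]; convert this using 1; ring
    simp; field_simp; ring

end

section
open Complex Filter MeasureTheory

lemma hasDerivAt_ofR (u : ℝ) : HasDerivAt (fun u : ℝ ↦ (u:ℂ)) 1 u := by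
  simpa using (hasDerivAt_id u).ofReal_comp

lemma lap_ftc {g g' f : ℝ → ℂ} {a C D : ℝ} (ha : 0 ≤ a) {s : ℂ} (hs : s.re = 1)
    (hg : ∀ u, HasDerivAt g (g' u) u)
    (hgb : ∀ u : ℝ, 0 < u → ‖g u‖ ≤ C * Real.exp (3 / 4 * u))
    (hf : ∀ u, a < u → f u = s * g u - g' u)
    (hfc : ContinuousOn f (Set.Ioi 0))
    (hfb : ∀ u : ℝ, 0 < u → ‖f u‖ ≤ D * Real.exp (3 / 4 * u)) :
    ∫ u : ℝ in Set.Ioi a, cexp (-s * u) * f u = cexp (-s * a) * g a := by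
  have hd : ∀ u : ℝ, HasDerivAt (fun u : ℝ ↦ -(cexp (-s * u) * g u))
      (cexp (-s * u) * (s * g u - g' u)) u := by
    intro u
    have h1 : HasDerivAt (fun u : ℝ ↦ cexp (-s * u)) (cexp (-s * u) * (-s * 1)) u := by
      exact ((hasDerivAt_ofR u).const_mul (-s)).cexp
    refine HasDerivAt.congr_deriv (h1.mul (hg u)).neg ?_
    ring
  have hI : IntegrableOn (fun u : ℝ ↦ cexp (-s * u) * f u) (Set.Ioi a) :=
    (lap_integrable hfc hfb hs).mono_set (Set.Ioi_subset_Ioi ha)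
  have he : Set.EqOn (fun u : ℝ ↦ cexp (-s * u) * f u)
      (fun u : ℝ ↦ cexp (-s * u) * (s * g u - g' u)) (Set.Ioi a) := fun u hu ↦ by
    simp only [hf u hu]
  rw [setIntegral_congr_fun measurableSet_Ioi he]
  have := integral_Ioi_of_hasDerivAt_of_tendsto' (a := a) (m := 0) (fun u _ ↦ hd u)
    (hI.congr_fun he measurableSet_Ioi) ?_
  · rw [this]; ring
  · apply squeeze_zero_norm' (a := fun u ↦ C * Real.exp (-(1/4) * u))
    · filter_upwards [eventually_gt_atTop 0] with u hu
      rw [norm_neg]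
      exact lap_norm_le hs (hgb u hu)
    · rw [← mul_zero C]
      refine Tendsto.const_mul _ ?_
      refine Real.tendsto_exp_atBot.comp ?_
      exact tendsto_id.const_mul_atTop_of_neg (by norm_num)

lemma exp_ge_one_aux {u : ℝ} (hu : 0 < u) : 1 ≤ Real.exp (3/4*u) := Real.one_le_exp (by positivity)
lemma exp_ge_u_aux {u : ℝ} (_hu : 0 < u) : u ≤ 2 * Real.exp (3/4*u) := by
  have := Real.add_one_le_exp (3/4*u)
  nlinarith [Real.exp_pos (3/4*u)]
lemma exp_ge_sq_aux {u : ℝ} (hu : 0 < u) : u^2 ≤ 8 * Real.exp (3/4*u) := by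
  have h := Real.add_one_le_exp (3/8*u)
  have : Real.exp (3/4*u) = Real.exp (3/8*u) ^ 2 := by rw [← Real.exp_nat_mul]; ring_nf
  rw [this]
  nlinarith [Real.exp_pos (3/8*u)]

lemma re_one_ne {s : ℂ} (hs : s.re = 1) : s ≠ 0 := fun h ↦ by simp [h] at hs

lemma max_bound {L u : ℝ} : max (u - L) 0 ≤ 2 * Real.exp (-(3/4) * L) * Real.exp (3/4*u) := by
  rw [mul_assoc, ← Real.exp_add]
  have := Real.add_one_le_exp (-(3/4)*L + 3/4*u)
  have h2 := Real.exp_pos (-(3/4)*L + 3/4*u)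
  apply max_le <;> nlinarith

lemma Lap.ramp {L : ℝ} (hL : 0 ≤ L) : Lap (fun u ↦ ((max (u - L) 0 : ℝ) : ℂ))
    (fun s ↦ cexp (-s * L) / s^2) (2 * Real.exp (-(3/4) * L)) := by
  have hb : ∀ u : ℝ, 0 < u → ‖((max (u - L) 0 : ℝ) : ℂ)‖ ≤
      2 * Real.exp (-(3/4) * L) * Real.exp (3/4*u) := fun u hu ↦ by
    rw [Complex.norm_real, Real.norm_of_nonneg (le_max_right _ _)]
    exact max_bound
  have hc : ContinuousOn (fun u ↦ ((max (u - L) 0 : ℝ) : ℂ)) (Set.Ioi 0) := by fun_prop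
  refine ⟨hc, hb, fun s hs ↦ ?_⟩
  have hs0 := re_one_ne hs
  have h1 : ∫ u : ℝ in Set.Ioi 0, cexp (-s * u) * ((max (u - L) 0 : ℝ) : ℂ) =
      ∫ u : ℝ in Set.Ioi L, cexp (-s * u) * ((max (u - L) 0 : ℝ) : ℂ) := by
    refine setIntegral_eq_of_subset_of_forall_sdiff_eq_zero measurableSet_Ioi
      (Set.Ioi_subset_Ioi hL) (fun u hu ↦ ?_)
    have : u - L ≤ 0 := by have := hu.2; simp at this; linarith
    simp [max_eq_right this]
  rw [h1, lap_ftc (g := fun u ↦ ((u:ℂ) - L) / s + 1 / s^2) (g' := fun u ↦ 1 / s)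
    (C := 2 * ‖s‖⁻¹ + L * ‖s‖⁻¹ + ‖s‖⁻¹^2) hL hs ?_ ?_ ?_ hc hb]
  · field_simp; ring
  · intro u
    have := (((hasDerivAt_ofR u).sub_const (L:ℂ)).div_const s).add_const (1/s^2)
    simpa using this
  · intro u hu
    have h1 := exp_ge_one_aux hu
    have h2 := exp_ge_u_aux hu
    calc ‖((u:ℂ) - L) / s + 1 / s^2‖ ≤ ‖((u:ℂ) - L) / s‖ + ‖1 / s^2‖ := norm_add_le _ _
      _ ≤ (u + L) * ‖s‖⁻¹ + ‖s‖⁻¹^2 := by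
        rw [norm_div, norm_div, norm_pow, div_eq_mul_inv, norm_one, one_div, inv_pow]
        gcongr
        refine (norm_sub_le _ _).trans ?_
        simp [abs_of_pos hu, abs_of_nonneg hL]
      _ ≤ (2 * Real.exp (3/4*u) + L * Real.exp (3/4*u)) * ‖s‖⁻¹ + ‖s‖⁻¹^2 * Real.exp (3/4*u) := by
        gcongr
        · exact le_mul_of_one_le_right hL h1
        · exact le_mul_of_one_le_right (by positivity) h1
      _ = _ := by ring
  · intro u hu
    rw [max_eq_left (by linarith)]
    push_cast; field_simp; ring

lemma Lap.id : Lap (fun u ↦ (u:ℂ)) (fun s ↦ 1 / s^2) 2 := by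
  obtain ⟨h1, h2, h3⟩ := Lap.ramp le_rfl
  have he : ∀ u : ℝ, 0 < u → ((max (u - 0) 0 : ℝ) : ℂ) = u := fun u hu ↦ by
    rw [sub_zero, max_eq_left hu.le]
  refine ⟨by fun_prop, fun u hu ↦ ?_, fun s hs ↦ ?_⟩
  · have := h2 u hu; beta_reduce at this; rw [he u hu] at this; simpa using this
  · have := h3 s hs
    simp only [ofReal_zero, mul_zero, Complex.exp_zero] at this
    beta_reduce
    rw [← this]
    refine setIntegral_congr_fun measurableSet_Ioi (fun u hu ↦ ?_)
    simp only [he u hu]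

lemma Lap.sq : Lap (fun u ↦ (u:ℂ)^2/2) (fun s ↦ 1 / s^3) 4 := by
  have hb : ∀ u : ℝ, 0 < u → ‖(u:ℂ)^2/2‖ ≤ 4 * Real.exp (3/4*u) := fun u hu ↦ by
    have := exp_ge_sq_aux hu
    simp; linarith
  have hc : ContinuousOn (fun u : ℝ ↦ (u:ℂ)^2/2) (Set.Ioi 0) := by fun_prop
  refine ⟨hc, hb, fun s hs ↦ ?_⟩
  have hs0 := re_one_ne hs
  rw [lap_ftc (g := fun u ↦ (u:ℂ)^2/2/s + u/s^2 + 1 / s^3) (g' := fun u ↦ u/s+1 / s^2)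
    (C := 4 * ‖s‖⁻¹ + 2 * ‖s‖⁻¹^2 + ‖s‖⁻¹^3) le_rfl hs ?_ ?_ ?_ hc hb]
  · simp
  · intro u
    have hu := hasDerivAt_ofR u
    have := ((((hu.pow 2).div_const 2).div_const s).add (hu.div_const (s^2))).add_const (1/s^3)
    refine HasDerivAt.congr_deriv this ?_
    simp
  · intro u hu
    have h1 := exp_ge_one_aux hu
    have h2 := exp_ge_u_aux hu
    have h3 := hb u hu
    calc ‖(u:ℂ)^2/2/s + u/s^2 + 1 / s^3‖ ≤ ‖(u:ℂ)^2/2/s‖ + ‖(u:ℂ)/s^2‖ + ‖1 / s^3‖ := norm_add₃_le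
      _ = ‖(u:ℂ)^2/2‖*‖s‖⁻¹ + u * ‖s‖⁻¹^2 + 1*‖s‖⁻¹^3 := by
        simp [norm_pow, div_eq_mul_inv, abs_of_pos hu]
      _ ≤ (4 * Real.exp (3/4*u)) * ‖s‖⁻¹ + (2 * Real.exp (3/4*u)) * ‖s‖⁻¹^2
            + Real.exp (3/4*u) * ‖s‖⁻¹^3 := by gcongr
      _ = _ := by ring
  · intro u hu
    field_simp; ring

lemma Lap.const (a : ℂ) : Lap (fun _ ↦ a) (fun s ↦ a / s) (‖a‖ * 1) := by
  have := (Lap.exp (a := 0) (by norm_num)).const_mul a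
  simpa [div_eq_mul_inv] using this

end

section
open Complex Filter MeasureTheory

noncomputable def Zf (u : ℝ) : ℂ := ∑' ρ : Zt, (mz ρ : ℂ) / ((ρ:ℂ) - 1)^2 * cexp (((ρ:ℂ) - 1) * u)
noncomputable def c1 : ℂ := ∑' ρ : Zt, (mz ρ : ℂ) / ((ρ:ℂ) - 1)^2
noncomputable def Vn (n : ℕ) (u : ℝ) : ℝ := ArithmeticFunction.vonMangoldt n / n * max (u - Real.log n) 0
noncomputable def Vf (u : ℝ) : ℝ := ∑' n : ℕ, Vn n u
noncomputable def Tf (u : ℝ) : ℝ := ∑' k : ℕ, (1 - Real.exp (-(2*k+3) * u)) / (2*k+3)^2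

lemma Zt_norm_coef (hRH : RiemannHypothesis) (ρ : Zt) :
    ‖(mz ρ : ℂ) / ((ρ:ℂ) - 1)^2‖ = mz ρ / ‖(ρ:ℂ)‖^2 := by
  rw [norm_div, norm_pow, norm_sub_rev, Zt_norm_one_sub hRH, Complex.norm_real,
    Real.norm_of_nonneg (mz_nonneg ρ)]

lemma Zt_coef_summable (hRH : RiemannHypothesis) :
    Summable (fun ρ : Zt ↦ (mz ρ : ℂ) / ((ρ:ℂ) - 1)^2) := by
  apply Summable.of_norm
  simpa only [Zt_norm_coef hRH] using summable_M0 hRH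

lemma Lap_Zf (hRH : RiemannHypothesis) : ∃ C, Lap Zf
    (fun s ↦ (logDeriv xiF (s+1) - logDeriv xiF 1) / s^2 + c1 / s) C := by
  have h1 : ∀ ρ : Zt, Lap (fun u ↦ (mz ρ : ℂ) / ((ρ:ℂ) - 1)^2 * cexp (((ρ:ℂ) - 1) * u))
      (fun s ↦ (mz ρ : ℂ) / ((ρ:ℂ) - 1)^2 * (1 / (s - ((ρ:ℂ) - 1)))) (mz ρ / ‖(ρ:ℂ)‖^2 * 1) := by
    intro ρ
    rw [← Zt_norm_coef hRH]
    refine Lap.const_mul (Lap.exp ?_) _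
    rw [sub_re, Zt_re hRH]; norm_num
  refine ⟨_, (Lap.tsum h1 (by simpa using summable_M0 hRH)).congr (fun s hs ↦ ?_)⟩
  have hs0 := re_one_ne hs
  have hh := (hasSum_hadamard hRH (z := s + 1) (w := 1)
    (xiF_ne_zero_of_one_lt_re (by simp [hs])) (by rw [xiF_one]; norm_num))
  have h3 := (hh.div_const (s^2)).add ((Zt_coef_summable hRH).hasSum.div_const s)
  rw [c1, ← h3.tsum_eq]
  refine tsum_congr (fun ρ ↦ ?_)
  have hr := Zt_re hRH ρ
  have e1 : (ρ:ℂ) - 1 ≠ 0 := fun h ↦ by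
    have := congrArg re h; simp [hr] at this; norm_num at this
  have e1' : 1 - (ρ:ℂ) ≠ 0 := by rw [← neg_sub]; exact neg_ne_zero.mpr e1
  have e2 : s - ((ρ:ℂ) - 1) ≠ 0 := fun h ↦ by
    have := congrArg re h; simp [hr, hs] at this; norm_num at this
  have e3 : s + 1 - (ρ:ℂ) = s - ((ρ:ℂ) - 1) := by ring
  rw [e3, ← neg_sub (ρ:ℂ) 1]
  set a := (ρ:ℂ) - 1
  field_simp
  ring

lemma odd_sq_summable : Summable (fun k : ℕ ↦ 1 / (2*(k:ℝ)+3)^2) := by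
  have h : Summable (fun k : ℕ ↦ 1 / ((k:ℝ)+1)^2) := by
    have := (summable_nat_add_iff 1).mpr (Real.summable_one_div_nat_pow.mpr (le_refl 2))
    simpa using this
  refine Summable.of_nonneg_of_le (fun k ↦ by positivity) (fun k ↦ ?_) h
  have : (0:ℝ) ≤ k := Nat.cast_nonneg k
  apply one_div_le_one_div_of_le (by positivity)
  gcongr <;> linarith

lemma Lap_Tf : ∃ C, Lap (fun u ↦ (Tf u : ℂ))
    (fun s ↦ ∑' k : ℕ, 1 / ((2*k+3 : ℂ) * s * (s + (2*k+3)))) C := by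
  have h1 : ∀ k : ℕ, Lap (fun u ↦ (1 / (2*k+3 : ℂ)^2) * (1 - cexp (-(2*k+3 : ℂ) * u)))
      (fun s ↦ (1 / (2*k+3 : ℂ)^2) * (1 / s - 1 / (s - (-(2*k+3 : ℂ))))) (‖1 / (2*k+3 : ℂ)^2‖ *
        (‖(1:ℂ)‖ * 1 + ‖(-1:ℂ)‖ * 1)) := by
    intro k
    refine Lap.const_mul (Lap.sub (Lap.const 1) (Lap.exp ?_)) _
    simp
    have : (0:ℝ) ≤ k := Nat.cast_nonneg k
    linarith
  have h2 : Summable fun k : ℕ ↦ ‖1 / (2*k+3 : ℂ)^2‖ * (‖(1:ℂ)‖ * 1 + ‖(-1:ℂ)‖ * 1) := by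
    refine Summable.mul_right _ ?_
    refine odd_sq_summable.congr (fun k ↦ ?_)
    rw [show (2*k+3:ℂ) = ((2*k+3:ℝ):ℂ) by push_cast; ring, norm_div, norm_pow, Complex.norm_real,
      Real.norm_of_nonneg (by positivity)]
    simp
  have h3 := (Lap.tsum h1 h2).congr (G := fun s ↦ ∑' k : ℕ, 1 / ((2*k+3 : ℂ) * s * (s + (2*k+3)))) ?_
  · refine ⟨_, (congrArg (fun f ↦ Lap f _ _) (funext fun u ↦ ?_)).mp h3⟩
    symm
    rw [Tf, ofReal_tsum]
    refine tsum_congr (fun k ↦ ?_)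
    push_cast; ring
  · intro s hs
    refine tsum_congr (fun k ↦ ?_)
    have hs0 := re_one_ne hs
    have e1 : s + (2*k+3) ≠ 0 := fun h ↦ by
      have := congrArg re h; simp [hs] at this
      have : (0:ℝ) ≤ k := Nat.cast_nonneg k
      linarith
    have e2 : (2*k+3 : ℂ) ≠ 0 := by exact_mod_cast (by positivity : (2*k+3:ℝ) ≠ 0)
    rw [sub_neg_eq_add]
    field_simp
    ring

open ArithmeticFunction in
lemma Vn_bound_summable : Summable (fun n : ℕ ↦
    ‖(vonMangoldt n : ℂ) / n‖ * (2 * Real.exp (-(3/4) * Real.log n))) := by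
  have h := (LSeriesSummable_vonMangoldt (s := 7/4) (by norm_num)).norm.mul_left 2
  refine h.congr (fun n ↦ ?_)
  rw [LSeries.term]
  split_ifs with hn
  · simp [hn]
  · have hn' : (0:ℝ) < n := by exact_mod_cast Nat.pos_of_ne_zero hn
    have : (7/4 : ℂ) = ((1 + 3/4 : ℝ) : ℂ) := by push_cast; norm_num
    rw [norm_div, norm_div, this, Complex.norm_natCast_cpow_of_pos (Nat.pos_of_ne_zero hn),
      ofReal_re, Real.rpow_add hn', Real.rpow_one, Complex.norm_natCast,
      show Real.exp (-(3/4) * Real.log n) = ((n:ℝ)^(3/4:ℝ))⁻¹ by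
        rw [Real.rpow_def_of_pos hn', ← Real.exp_neg]; ring_nf]
    have : (0:ℝ) < (n:ℝ)^(3/4:ℝ) := by positivity
    field_simp

open ArithmeticFunction in
lemma Lap_Vf : ∃ C, Lap (fun u ↦ (Vf u : ℂ))
    (fun s ↦ - logDeriv riemannZeta (s+1) / s^2) C := by
  have h1 : ∀ n : ℕ, Lap (fun u ↦ (vonMangoldt n : ℂ) / n * ((max (u - Real.log n) 0 : ℝ) : ℂ))
      (fun s ↦ (vonMangoldt n : ℂ) / n * (cexp (-s * Real.log n) / s^2))
      (‖(vonMangoldt n : ℂ) / n‖ * (2 * Real.exp (-(3/4) * Real.log n))) := by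
    intro n
    exact Lap.const_mul (Lap.ramp (Real.log_natCast_nonneg n)) _
  have h3 := (Lap.tsum h1 Vn_bound_summable).congr (G := fun s ↦ - logDeriv riemannZeta (s+1) / s^2) ?_
  · refine ⟨_, (congrArg (fun f ↦ Lap f _ _) (funext fun u ↦ ?_)).mp h3⟩
    symm
    rw [Vf, ofReal_tsum]
    refine tsum_congr (fun n ↦ ?_)
    rw [Vn]; push_cast; ring
  · intro s hs
    rw [logDeriv_apply, ← neg_div, ← LSeries_vonMangoldt_eq_deriv_riemannZeta_div (by simp [hs]), LSeries,
      ← tsum_div_const]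
    refine tsum_congr (fun n ↦ ?_)
    rw [LSeries.term]
    split_ifs with hn
    · simp [hn]
    · have hn' : (n:ℂ) ≠ 0 := by exact_mod_cast hn
      rw [cpow_add _ _ hn', cpow_one, cpow_def_of_ne_zero hn', natCast_log, neg_mul, mul_comm s,
        Complex.exp_neg]
      have := Complex.exp_ne_zero (Complex.log n * s)
      field_simp

lemma F_diff {s : ℂ} (hs : s.re = 1) : logDeriv xiF (s+1) - logDeriv xiF 1 =
    1 / s - Real.eulerMascheroniConstant + s^2 * (∑' k : ℕ, 1 / ((2*k+3 : ℂ) * s * (s + (2*k+3))))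
      + logDeriv riemannZeta (s+1) := by
  have hs0 := re_one_ne hs
  have hs1 : s + 1 ≠ 0 := fun h ↦ by
    have := congrArg re h; simp [hs] at this
    try norm_num at this
  have hz : 0 < ((s+1)/2).re := by
    rw [show (s+1)/2 = (s+1)/(2:ℝ) by norm_num, Complex.div_ofReal_re]; simp [hs]
  have hd := digamma_tsum hz
  rw [(dgT_summable _ hz).tsum_eq_zero_add, Complex.digamma_one_half] at hd
  rw [logDeriv_xiF (by simp [hs]), logDeriv_xiF_one, logDeriv_GammaR (by simp [hs]),
    ← sub_add_cancel (digamma ((s+1)/2)) ((-2 * Complex.log 2 - Real.eulerMascheroniConstant)), hd]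
  have e : ∑' k : ℕ, dgT (k+1) ((s+1)/2) = 2 * (s^2 * ∑' k : ℕ, 1 / ((2*k+3 : ℂ) * s * (s + (2*k+3)))) := by
    rw [← tsum_mul_left, ← tsum_mul_left]
    refine tsum_congr (fun k ↦ ?_)
    have e1 : s + (2*k+3) ≠ 0 := fun h ↦ by
      have := congrArg re h; simp [hs] at this
      have : (0:ℝ) ≤ k := Nat.cast_nonneg k
      linarith
    have e2 : (2*k+3 : ℂ) ≠ 0 := by exact_mod_cast (by positivity : (2*k+3:ℝ) ≠ 0)
    rw [dgT]
    have e3 : (((k+1:ℕ):ℂ)+1/2) * ((s+1)/2 + ((k+1:ℕ):ℂ)) = (2*k+3)*(s+(2*k+3))/4 := by push_cast; ring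
    rw [e3]
    field_simp
    ring
  have e0 : dgT 0 ((s+1)/2) = 2 * (1 - 1/(s+1)) := by
    rw [dgT]
    have e1 : (((0:ℕ):ℂ)+1/2) * ((s+1)/2 + ((0:ℕ):ℂ)) = (s+1)/4 := by push_cast; ring
    rw [e1]
    field_simp
    ring
  have e4 : ((Real.log (4*Real.pi) : ℝ):ℂ) = 2 * Complex.log 2 + Real.log Real.pi := by
    rw [Real.log_mul (by norm_num) Real.pi_ne_zero, show (4:ℝ) = 2^2 by norm_num, Real.log_pow]
    push_cast
    simp
  rw [e, e0]
  push_cast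
  rw [e4]
  rw [show s + 1 - 1 = s by ring]
  ring

theorem explicit_formula (hRH : RiemannHypothesis) {u : ℝ} (hu : 0 < u) :
    Zf u = c1 + (u:ℂ)^2/2 - Real.eulerMascheroniConstant * u + Tf u - Vf u := by
  obtain ⟨_, hZ⟩ := Lap_Zf hRH
  obtain ⟨_, hT⟩ := Lap_Tf
  obtain ⟨_, hV⟩ := Lap_Vf
  have h := hZ.sub (((((Lap.const c1).add Lap.sq).sub
    (Lap.id.const_mul (Real.eulerMascheroniConstant : ℂ))).add hT).sub hV)
  have := (h.congr (G := fun _ ↦ 0) (fun s hs ↦ ?_)).eq_zero hu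
  · exact sub_eq_zero.mp this
  · rw [F_diff hs]
    have := re_one_ne hs
    field_simp
    ring

end

section
open Complex Filter MeasureTheory

noncomputable def psi1 (x : ℝ) : ℝ := ∑ n ∈ Finset.range (⌊x⌋₊ + 1), ArithmeticFunction.vonMangoldt n / n
noncomputable def Rf (u : ℝ) : ℝ := psi1 (Real.exp u) - u + Real.eulerMascheroniConstant
noncomputable def M0 : ℝ := 2 + Real.eulerMascheroniConstant - Real.log (4 * Real.pi)

lemma lt_of_floor {u : ℝ} {n : ℕ} (hn : n ∉ Finset.range (⌊Real.exp u⌋₊ + 1)) : u < Real.log n := by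
  simp only [Finset.mem_range, not_lt] at hn
  have h1 : Real.exp u < n := (Nat.floor_lt (Real.exp_pos u).le).mp (by omega)
  rwa [Real.lt_log_iff_exp_lt (lt_trans (Real.exp_pos u) h1)]

lemma le_of_floor {u : ℝ} {n : ℕ} (hn : n ∈ Finset.range (⌊Real.exp u⌋₊ + 1)) (h0 : n ≠ 0) :
    Real.log n ≤ u := by
  simp only [Finset.mem_range] at hn
  have h1 : (n:ℝ) ≤ Real.exp u := (Nat.le_floor_iff (Real.exp_pos u).le).mp (by omega)
  rwa [Real.log_le_iff_le_exp (by exact_mod_cast Nat.pos_of_ne_zero h0)]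

lemma Vf_eq_sum {u w : ℝ} (h : u ≤ w) : Vf u = ∑ n ∈ Finset.range (⌊Real.exp w⌋₊ + 1), Vn n u := by
  rw [Vf]
  refine tsum_eq_sum (fun n hn ↦ ?_)
  have := lt_of_floor hn
  rw [Vn, max_eq_right (by linarith), mul_zero]

lemma lam_nonneg (n : ℕ) : 0 ≤ ArithmeticFunction.vonMangoldt n / (n:ℝ) :=
  div_nonneg ArithmeticFunction.vonMangoldt_nonneg (Nat.cast_nonneg n)

lemma Vf_sub_ge {u w : ℝ} (h : u ≤ w) : (w - u) * psi1 (Real.exp u) ≤ Vf w - Vf u := by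
  rw [Vf_eq_sum (le_refl w), Vf_eq_sum h, ← Finset.sum_sub_distrib, psi1, Finset.mul_sum]
  have hsub : Finset.range (⌊Real.exp u⌋₊ + 1) ⊆ Finset.range (⌊Real.exp w⌋₊ + 1) := by
    apply Finset.range_subset_range.mpr
    gcongr
  have hnn : ∀ n, 0 ≤ Vn n w - Vn n u := fun n ↦ by
    rw [Vn, Vn, ← mul_sub]
    refine mul_nonneg (lam_nonneg n) (sub_nonneg.mpr ?_)
    gcongr
  refine le_trans ?_ (Finset.sum_le_sum_of_subset_of_nonneg hsub (fun n _ _ ↦ hnn n))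
  refine Finset.sum_le_sum (fun n hn ↦ ?_)
  rcases eq_or_ne n 0 with rfl | h0
  · simp [Vn]
  · have := le_of_floor hn h0
    rw [Vn, Vn, max_eq_left (by linarith), max_eq_left (by linarith)]
    apply le_of_eq; ring

lemma Vf_sub_le {u w : ℝ} (h : u ≤ w) : Vf w - Vf u ≤ (w - u) * psi1 (Real.exp w) := by
  rw [Vf_eq_sum (le_refl w), Vf_eq_sum h, ← Finset.sum_sub_distrib, psi1, Finset.mul_sum]
  refine Finset.sum_le_sum (fun n hn ↦ ?_)
  rw [Vn, Vn, ← mul_sub, mul_comm]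
  refine mul_le_mul_of_nonneg_right ?_ (lam_nonneg n)
  rcases max_cases (w - Real.log n) 0 with ⟨h1, _⟩ | ⟨h1, _⟩ <;>
  rcases max_cases (u - Real.log n) 0 with ⟨h2, _⟩ | ⟨h2, _⟩ <;> rw [h1, h2] <;> linarith

noncomputable def Sf (T : ℝ) : ℝ := ∑' ρ : Zt, mz ρ * min (1 / ‖(ρ:ℂ)‖) (T / ‖(ρ:ℂ)‖^2)

lemma M0_hasSum (hRH : RiemannHypothesis) : HasSum (fun ρ : Zt ↦ mz ρ / ‖(ρ:ℂ)‖^2) M0 := by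
  have := hasSum_M0 hRH
  rw [logDeriv_xiF_one, ofReal_re] at this
  convert this using 1
  rw [M0]; ring

lemma M0_nonneg (hRH : RiemannHypothesis) : 0 ≤ M0 :=
  (M0_hasSum hRH).nonneg (fun ρ ↦ div_nonneg (mz_nonneg ρ) (by positivity))

lemma Sf_summable (hRH : RiemannHypothesis) {T : ℝ} (hT : 0 ≤ T) :
    Summable (fun ρ : Zt ↦ mz ρ * min (1 / ‖(ρ:ℂ)‖) (T / ‖(ρ:ℂ)‖^2)) := by
  refine Summable.of_nonneg_of_le (fun ρ ↦ mul_nonneg (mz_nonneg ρ) (by positivity)) (fun ρ ↦ ?_)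
    ((M0_hasSum hRH).summable.mul_left T)
  calc mz ρ * min (1 / ‖(ρ:ℂ)‖) (T / ‖(ρ:ℂ)‖^2) ≤ mz ρ * (T / ‖(ρ:ℂ)‖^2) :=
        mul_le_mul_of_nonneg_left (min_le_right _ _) (mz_nonneg ρ)
    _ = _ := by ring

lemma Sf_le_M0 (hRH : RiemannHypothesis) {T : ℝ} (hT : 0 ≤ T) : Sf T ≤ T * M0 := by
  rw [Sf, ← (M0_hasSum hRH).tsum_eq, ← tsum_mul_left]
  refine (Sf_summable hRH hT).tsum_le_tsum (fun ρ ↦ ?_) ((M0_hasSum hRH).summable.mul_left T)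
  calc mz ρ * min (1 / ‖(ρ:ℂ)‖) (T / ‖(ρ:ℂ)‖^2) ≤ mz ρ * (T / ‖(ρ:ℂ)‖^2) :=
        mul_le_mul_of_nonneg_left (min_le_right _ _) (mz_nonneg ρ)
    _ = _ := by ring

lemma norm_exp_sub_one_le {z : ℂ} (hz : z.re ≤ 0) : ‖cexp z - 1‖ ≤ ‖z‖ := by
  have h := Convex.norm_image_sub_le_of_norm_hasDerivWithin_le (𝕜 := ℂ) (f := cexp) (f' := cexp)
    (C := 1) (s := {w : ℂ | w.re ≤ 0}) (x := 0) (y := z)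
    (fun w _ ↦ (Complex.hasDerivAt_exp w).hasDerivWithinAt)
    (fun w hw ↦ by rw [Complex.norm_exp]; exact Real.exp_le_one_iff.mpr hw)
    (convex_halfSpace_re_le 0) (by simp) hz
  simpa using h

lemma Zf_summable (hRH : RiemannHypothesis) (u : ℝ) : Summable (fun ρ : Zt ↦
    (mz ρ : ℂ) / ((ρ:ℂ) - 1)^2 * cexp (((ρ:ℂ) - 1) * u)) := by
  apply Summable.of_norm
  refine ((M0_hasSum hRH).summable.mul_right (Real.exp (-u/2))).congr (fun ρ ↦ ?_)
  rw [norm_mul, Zt_norm_coef hRH, Complex.norm_exp]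
  congr 2
  simp [Zt_re hRH]; ring

lemma Zf_norm_le (hRH : RiemannHypothesis) (u : ℝ) : ‖Zf u‖ ≤ M0 * Real.exp (-u/2) := by
  rw [Zf]
  refine tsum_of_norm_bounded ((M0_hasSum hRH).mul_right (Real.exp (-u/2))) (fun ρ ↦ ?_)
  rw [norm_mul, Zt_norm_coef hRH, Complex.norm_exp]
  apply le_of_eq
  congr 2
  simp [Zt_re hRH]; ring

lemma Zf_diff_le (hRH : RiemannHypothesis) (u : ℝ) {η : ℝ} (hη : 0 < η) :
    ‖Zf (u + η) - Zf u‖ ≤ Real.exp (-u/2) * η * Sf (2 / η) := by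
  rw [Zf, Zf, ← (Zf_summable hRH _).tsum_sub (Zf_summable hRH _), Sf, ← tsum_mul_left]
  refine tsum_of_norm_bounded ((Sf_summable hRH (by positivity)).mul_left _).hasSum (fun ρ ↦ ?_)
  set a := (ρ:ℂ) - 1 with ha
  have hre : a.re = -1/2 := by simp [ha, Zt_re hRH]; norm_num
  have hna : ‖a‖ = ‖(ρ:ℂ)‖ := by rw [ha, norm_sub_rev, Zt_norm_one_sub hRH]
  have hpos : 0 < ‖a‖ := by
    rw [norm_pos_iff]; intro h; rw [h] at hre; norm_num at hre
  have e1 : (mz ρ : ℂ) / a^2 * cexp (a * ((u + η : ℝ):ℂ)) - (mz ρ : ℂ) / a^2 * cexp (a * u) =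
      (mz ρ : ℂ) / a^2 * (cexp (a * u) * (cexp (a * η) - 1)) := by
    push_cast; rw [mul_add, Complex.exp_add]; ring
  rw [e1, norm_mul, Zt_norm_coef hRH, norm_mul, Complex.norm_exp, ← hna]
  have e2 : (a * (u:ℂ)).re = -u/2 := by simp [hre]; ring
  rw [e2]
  have h0 : (a * (η:ℂ)).re ≤ 0 := by simp [hre]; linarith
  have h1 : ‖cexp (a * η) - 1‖ ≤ ‖a‖ * η := by
    refine (norm_exp_sub_one_le h0).trans (le_of_eq ?_)
    rw [norm_mul, Complex.norm_real, Real.norm_of_nonneg hη.le]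
  have h2 : ‖cexp (a * η) - 1‖ ≤ 2 := by
    refine (norm_sub_le _ _).trans ?_
    rw [norm_one, Complex.norm_exp]
    have := Real.exp_le_one_iff.mpr h0
    linarith
  have h3 : ‖cexp (a * η) - 1‖ / ‖a‖^2 ≤ η * min (1 / ‖a‖) (2 / η / ‖a‖^2) := by
    rw [mul_min_of_nonneg _ _ hη.le]
    refine le_min ?_ ?_
    · rw [div_le_iff₀ (by positivity)]
      refine h1.trans (le_of_eq ?_)
      field_simp
    · have : η * (2 / η / ‖a‖^2) = 2 / ‖a‖^2 := by field_simp
      rw [this]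
      gcongr
  calc mz ρ / ‖a‖^2 * (Real.exp (-u/2) * ‖cexp (a * η) - 1‖)
      = mz ρ * Real.exp (-u/2) * (‖cexp (a * η) - 1‖ / ‖a‖^2) := by ring
    _ ≤ mz ρ * Real.exp (-u/2) * (η * min (1 / ‖a‖) (2 / η / ‖a‖^2)) := by
      apply mul_le_mul_of_nonneg_left h3
      exact mul_nonneg (mz_nonneg ρ) (Real.exp_pos _).le
    _ = _ := by ring

noncomputable def tauf (u : ℝ) : ℝ := ∑' k : ℕ, Real.exp (-(2*k+3) * u) / (2*k+3)^2
noncomputable def Tinf : ℝ := ∑' k : ℕ, 1 / (2*(k:ℝ)+3)^2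

lemma tauf_summable {u : ℝ} (hu : 0 ≤ u) :
    Summable (fun k : ℕ ↦ Real.exp (-(2*k+3) * u) / (2*k+3)^2) := by
  refine Summable.of_nonneg_of_le (fun k ↦ by positivity) (fun k ↦ ?_) odd_sq_summable
  gcongr
  rw [Real.exp_le_one_iff]
  have : (0:ℝ) ≤ (2*k+3) * u := by positivity
  linarith

lemma Tf_eq {u : ℝ} (hu : 0 ≤ u) : Tf u = Tinf - tauf u := by
  rw [Tf, Tinf, tauf, ← odd_sq_summable.tsum_sub (tauf_summable hu)]
  refine tsum_congr (fun k ↦ ?_)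
  ring

lemma tauf_nonneg (u : ℝ) : 0 ≤ tauf u := tsum_nonneg (fun k ↦ by positivity)

lemma exp_geom {u : ℝ} (hu : 2 ≤ u) :
    HasSum (fun k : ℕ ↦ Real.exp (-(2*k+3) * u)) (Real.exp (-3*u) * (1 - Real.exp (-2*u))⁻¹) := by
  have h := (hasSum_geometric_of_lt_one (Real.exp_pos (-2*u)).le
    (by rw [Real.exp_lt_one_iff]; linarith)).mul_left (Real.exp (-3*u))
  have e : (fun k : ℕ ↦ Real.exp (-(2*k+3) * u)) =
      fun k : ℕ ↦ Real.exp (-3*u) * Real.exp (-2*u) ^ k := by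
    ext k
    rw [← Real.exp_nat_mul, ← Real.exp_add]; ring_nf
  rw [e]; exact h

lemma exp_geom_le {u : ℝ} (hu : 2 ≤ u) :
    Real.exp (-3*u) * (1 - Real.exp (-2*u))⁻¹ ≤ 1.05 * Real.exp (-3*u) := by
  rw [mul_comm]
  refine mul_le_mul_of_nonneg_right ?_ (Real.exp_pos _).le
  have h1 : Real.exp (-2*u) ≤ 1/21 := by
    have h4 : Real.exp (-2*u) ≤ Real.exp (-4) := Real.exp_le_exp.mpr (by linarith)
    have h5 : Real.exp (-4) = (Real.exp 1 ^ 4)⁻¹ := by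
      rw [← Real.exp_nat_mul, ← Real.exp_neg]; norm_num
    have h6 : (21:ℝ) ≤ Real.exp 1 ^ 4 := by
      have := Real.exp_one_gt_d9
      calc (21:ℝ) ≤ 2.7^4 := by norm_num
        _ ≤ _ := by gcongr; linarith
    rw [h5] at h4
    refine h4.trans ?_
    rw [one_div]
    exact inv_anti₀ (by norm_num) h6
  rw [inv_le_comm₀ (by linarith) (by norm_num)]
  norm_num at h1 ⊢
  linarith

lemma tauf_le {u : ℝ} (hu : 2 ≤ u) : tauf u ≤ 0.35 * Real.exp (-3*u) := by
  have h : tauf u ≤ ∑' k : ℕ, (1/3) * Real.exp (-(2*k+3) * u) := by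
    refine (tauf_summable (by linarith)).tsum_le_tsum (fun k ↦ ?_) ((exp_geom hu).summable.mul_left _)
    rw [show (1/3) * Real.exp (-(2*k+3) * u) = Real.exp (-(2*k+3) * u) / 3 by ring]
    have : (0:ℝ) ≤ k := Nat.cast_nonneg k
    gcongr
    nlinarith
  rw [tsum_mul_left, (exp_geom hu).tsum_eq] at h
  have := exp_geom_le hu
  linarith

lemma tauf_diff_le {u w : ℝ} (hu : 2 ≤ u) (h : u ≤ w) :
    tauf u - tauf w ≤ 0.35 * Real.exp (-3*u) * (w - u) := by
  have h1 : tauf u - tauf w ≤ ∑' k : ℕ, (1/3) * Real.exp (-(2*k+3) * u) * (w - u) := by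
    rw [tauf, tauf, ← (tauf_summable (by linarith)).tsum_sub (tauf_summable (by linarith))]
    refine ((tauf_summable (by linarith)).sub (tauf_summable (by linarith))).tsum_le_tsum
      (fun k ↦ ?_) (((exp_geom hu).summable.mul_left _).mul_right _)
    have hk : (0:ℝ) ≤ k := Nat.cast_nonneg k
    have e : Real.exp (-(2*k+3) * w) = Real.exp (-(2*k+3) * u) * Real.exp (-(2*k+3) * (w - u)) := by
      rw [← Real.exp_add]; ring_nf
    rw [e, ← sub_div]
    have h2 := Real.add_one_le_exp (-(2*k+3) * (w - u))
    have h3 := Real.exp_pos (-(2*k+3) * u)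
    rw [div_le_iff₀ (by positivity)]
    have h4 : Real.exp (-(2*k+3) * u) * (1 - Real.exp (-(2*k+3) * (w - u))) ≤
      Real.exp (-(2*k+3) * u) * ((2*k+3) * (w-u)) := by
      apply mul_le_mul_of_nonneg_left _ h3.le; linarith
    have h5 : Real.exp (-(2*k+3) * u) * ((2*k+3) * (w-u)) * 1 ≤
        Real.exp (-(2*k+3) * u) * ((2*k+3) * (w-u)) * ((2*k+3)/3) := by
      apply mul_le_mul_of_nonneg_left
      · linarith
      · have : 0 ≤ w - u := by linarith
        positivity
    calc _ = Real.exp (-(2*k+3) * u) * (1 - Real.exp (-(2*k+3) * (w - u))) := by ring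
      _ ≤ _ := h4.trans ((mul_one _).symm.le.trans h5)
      _ = _ := by ring
  rw [tsum_mul_right, tsum_mul_left, (exp_geom hu).tsum_eq] at h1
  have h2 := exp_geom_le hu
  have h3 : 0 ≤ w - u := by linarith
  nlinarith

lemma tauf_anti {u w : ℝ} (hu : 0 ≤ u) (h : u ≤ w) : tauf w ≤ tauf u := by
  refine (tauf_summable (by linarith)).tsum_le_tsum (fun k ↦ ?_) (tauf_summable (by linarith))
  have hk : (0:ℝ) ≤ k := Nat.cast_nonneg k
  gcongr Real.exp ?_ / _
  nlinarith

noncomputable def rf (u : ℝ) : ℝ := (Zf u).re + tauf u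

lemma Vf_formula (hRH : RiemannHypothesis) {u : ℝ} (hu : 0 < u) :
    Vf u = (c1.re + Tinf) + u^2/2 - Real.eulerMascheroniConstant * u - rf u := by
  have h := congrArg re (explicit_formula hRH hu)
  have e : ((u:ℂ)^2/2).re = u^2/2 := by
    rw [show (u:ℂ)^2/2 = ((u^2/2:ℝ):ℂ) by push_cast; ring, ofReal_re]
  have e2 : ((Real.eulerMascheroniConstant:ℂ) * u).re = Real.eulerMascheroniConstant * u := by
    rw [← ofReal_mul, ofReal_re]
  rw [sub_re, add_re, sub_re, add_re, e, e2, ofReal_re, ofReal_re, Tf_eq hu.le] at h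
  rw [rf]; linarith

lemma rf_abs_le (hRH : RiemannHypothesis) {u : ℝ} (hu : 2 ≤ u) :
    |rf u| ≤ M0 * Real.exp (-u/2) + 0.35 * Real.exp (-3*u) := by
  rw [rf]
  refine (abs_add_le _ _).trans (add_le_add ?_ ?_)
  · exact (abs_re_le_norm _).trans (Zf_norm_le hRH u)
  · rw [abs_of_nonneg (tauf_nonneg u)]; exact tauf_le hu

lemma Rf_le (hRH : RiemannHypothesis) {u η : ℝ} (hu : 2 ≤ u) (hη : 0 < η) :
    Rf u ≤ Real.exp (-u/2) * Sf (2/η) + η/2 + 0.35 * Real.exp (-3*u) := by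
  have h := Vf_sub_ge (show u ≤ u + η by linarith)
  rw [Vf_formula hRH (show 0 < u + η by linarith), Vf_formula hRH (show 0 < u by linarith)] at h
  have h1 := (abs_re_le_norm _).trans (Zf_diff_le hRH u hη)
  have h2 := tauf_diff_le hu (show u ≤ u + η by linarith)
  rw [sub_re] at h1
  have h1 := neg_le_of_abs_le h1
  rw [rf, rf] at h
  rw [Rf]
  have h5 : η * (psi1 (Real.exp u) - u + Real.eulerMascheroniConstant) ≤
      η * (Real.exp (-u/2) * Sf (2/η) + η/2 + 0.35 * Real.exp (-3*u)) := by
    nlinarith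
  exact le_of_mul_le_mul_left h5 hη

lemma Rf_ge (hRH : RiemannHypothesis) {u η : ℝ} (hu : 2 ≤ u) (hη : 0 < η) (hη1 : η ≤ 1) :
    -(Real.exp (-(u-η)/2) * Sf (2/η) + η/2) ≤ Rf u := by
  have h := Vf_sub_le (show u - η ≤ u by linarith)
  rw [Vf_formula hRH (show 0 < u - η by linarith), Vf_formula hRH (show 0 < u by linarith)] at h
  have h1 := (abs_re_le_norm _).trans (Zf_diff_le hRH (u - η) hη)
  have h2 := tauf_anti (show 0 ≤ u - η by linarith) (show u - η ≤ u by linarith)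
  rw [sub_re, sub_add_cancel] at h1
  have h1 := le_of_abs_le h1
  rw [rf, rf] at h
  rw [Rf]
  have h5 : η * -(Real.exp (-(u-η)/2) * Sf (2/η) + η/2) ≤
      η * (psi1 (Real.exp u) - u + Real.eulerMascheroniConstant) := by
    nlinarith
  exact le_of_mul_le_mul_left h5 hη

end

section
open Complex Filter MeasureTheory

lemma arctan_ge {y : ℝ} (h0 : 0 ≤ y) (h1 : y ≤ 1) : Real.pi / 4 * y ≤ Real.arctan y := by
  have hc : ConcaveOn ℝ (Set.Icc 0 1) Real.arctan := by
    refine AntitoneOn.concaveOn_of_deriv (convex_Icc 0 1) Real.continuous_arctan.continuousOn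
      Real.differentiable_arctan.differentiableOn ?_
    rw [interior_Icc]
    intro a ha b hb hab
    simp only [Real.deriv_arctan]
    have := ha.1
    gcongr
  have := hc.2 (show (1:ℝ) ∈ Set.Icc (0:ℝ) 1 by simp) (show (0:ℝ) ∈ Set.Icc (0:ℝ) 1 by simp) h0
    (sub_nonneg.mpr h1) (by ring)
  simp at this
  linarith

lemma min_le_arctan {r T : ℝ} (hr : 0 < r) (hT : 0 < T) :
    min (1 / r) (T / r^2) ≤ 4 / Real.pi * (Real.arctan (T / r) / r) := by
  have hpi := Real.pi_pos
  rcases le_total r T with h | h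
  · refine (min_le_left _ _).trans ?_
    have : Real.arctan 1 ≤ Real.arctan (T / r) :=
      Real.arctan_strictMono.monotone ((one_le_div hr).mpr h)
    rw [Real.arctan_one] at this
    rw [div_le_iff₀ hr, mul_assoc, div_mul_cancel₀ _ hr.ne', div_mul_eq_mul_div, le_div_iff₀ hpi]
    linarith
  · refine (min_le_right _ _).trans ?_
    have := arctan_ge (div_nonneg hT.le hr.le) ((div_le_one hr).mpr h)
    have h2 : T / r^2 = 4 / Real.pi * (Real.pi / 4 * (T / r) / r) := by field_simp
    rw [h2]
    gcongr

noncomputable def Af (T : ℝ) : ℝ := ∑' ρ : Zt, mz ρ * (Real.arctan (T / ‖(ρ:ℂ)‖) / ‖(ρ:ℂ)‖)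

lemma Zt_norm_pos (hRH : RiemannHypothesis) (ρ : Zt) : 0 < ‖(ρ:ℂ)‖ := by
  have := Zt_norm_sq hRH ρ
  have h2 : 0 < ‖(ρ:ℂ)‖^2 := by rw [this]; positivity
  exact (sq_pos_iff.mp h2).lt_of_le' (norm_nonneg _)

lemma Af_summable (hRH : RiemannHypothesis) {T : ℝ} (hT : 0 ≤ T) :
    Summable (fun ρ : Zt ↦ mz ρ * (Real.arctan (T / ‖(ρ:ℂ)‖) / ‖(ρ:ℂ)‖)) ∧ Af T ≤ T * M0 := by
  have hle : ∀ ρ : Zt, mz ρ * (Real.arctan (T / ‖(ρ:ℂ)‖) / ‖(ρ:ℂ)‖) ≤ T * (mz ρ / ‖(ρ:ℂ)‖^2) := by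
    intro ρ
    have hr := Zt_norm_pos hRH ρ
    have : Real.arctan (T / ‖(ρ:ℂ)‖) ≤ T / ‖(ρ:ℂ)‖ := by
      have h1 := Real.le_tan (Real.arctan_nonneg.mpr (show 0 ≤ T / ‖(ρ:ℂ)‖ by positivity)) (Real.arctan_lt_pi_div_two _)
      rwa [Real.tan_arctan] at h1
    calc mz ρ * (Real.arctan (T / ‖(ρ:ℂ)‖) / ‖(ρ:ℂ)‖) ≤ mz ρ * (T / ‖(ρ:ℂ)‖ / ‖(ρ:ℂ)‖) := by
          have := mz_nonneg ρ
          gcongr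
      _ = _ := by field_simp
  have hs : Summable (fun ρ : Zt ↦ mz ρ * (Real.arctan (T / ‖(ρ:ℂ)‖) / ‖(ρ:ℂ)‖)) := by
    refine Summable.of_nonneg_of_le (fun ρ ↦ ?_) hle ((M0_hasSum hRH).summable.mul_left T)
    have := Real.arctan_nonneg.mpr (show 0 ≤ T / ‖(ρ:ℂ)‖ by positivity)
    have := mz_nonneg ρ
    positivity
  refine ⟨hs, ?_⟩
  rw [Af, ← (M0_hasSum hRH).tsum_eq, ← tsum_mul_left]
  exact hs.tsum_le_tsum hle ((M0_hasSum hRH).summable.mul_left T)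

lemma Sf_le_Af (hRH : RiemannHypothesis) {T : ℝ} (hT : 0 < T) : Sf T ≤ 4 / Real.pi * Af T := by
  rw [Sf, Af, ← tsum_mul_left]
  refine (Sf_summable hRH hT.le).tsum_le_tsum (fun ρ ↦ ?_) ((Af_summable hRH hT.le).1.mul_left _)
  have := mul_le_mul_of_nonneg_left (min_le_arctan (Zt_norm_pos hRH ρ) hT) (mz_nonneg ρ)
  refine this.trans (le_of_eq ?_); ring

noncomputable def gf (c : ℝ) : ℝ := ∑' ρ : Zt, mz ρ / (c^2 + ‖(ρ:ℂ)‖^2)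

lemma Af_deriv (hRH : RiemannHypothesis) (c : ℝ) : HasDerivAt Af (gf c) c := by
  have h0 := (Af_summable hRH (le_refl (0:ℝ))).1
  have hu := (M0_hasSum hRH).summable
  have key := hasDerivAt_tsum (𝕜 := ℝ) (F := ℝ) (u := fun ρ : Zt ↦ mz ρ / ‖(ρ:ℂ)‖^2)
    (g := fun (ρ : Zt) (T:ℝ) ↦ mz ρ * (Real.arctan (T / ‖(ρ:ℂ)‖) / ‖(ρ:ℂ)‖))
    (g' := fun (ρ : Zt) (c:ℝ) ↦ mz ρ / (c^2 + ‖(ρ:ℂ)‖^2)) (y₀ := 0) hu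
  refine key (fun ρ y ↦ ?_) (fun ρ y ↦ ?_) h0 c
  · have hr := Zt_norm_pos hRH ρ
    have h1 := (((hasDerivAt_id y).div_const ‖(ρ:ℂ)‖).arctan.div_const ‖(ρ:ℂ)‖).const_mul (mz ρ)
    refine HasDerivAt.congr_deriv h1 ?_
    simp only [id]
    field_simp
    ring
  · have := mz_nonneg ρ
    rw [Real.norm_of_nonneg (by positivity)]
    have hr := Zt_norm_pos hRH ρ
    gcongr
    nlinarith [sq_nonneg y]

lemma logDeriv_xiF_one_sub (s : ℂ) : logDeriv xiF (1 - s) = - logDeriv xiF s := by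
  have h : (fun s => xiF (1 - s)) = xiF := funext xiF_one_sub
  have h2 : deriv xiF s = - deriv xiF (1 - s) := by
    conv_lhs => rw [← h]
    rw [deriv_comp_const_sub]
  rw [logDeriv_apply, logDeriv_apply, h2, xiF_one_sub]; ring

lemma gf_eq (hRH : RiemannHypothesis) {c : ℝ} (hc : 0 < c) :
    gf c = (logDeriv xiF ((1/2 + √(c^2+1/4) : ℝ):ℂ)).re / √(c^2+1/4) := by
  set b := √(c^2+1/4) with hb
  have hb2 : b^2 = c^2+1/4 := Real.sq_sqrt (by positivity)
  have hb1 : 1/2 < b := Real.lt_sqrt_of_sq_lt (by nlinarith)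
  have hz : xiF ((1/2 + b : ℝ):ℂ) ≠ 0 :=
    xiF_ne_zero_of_one_lt_re (by rw [ofReal_re]; linarith)
  have hw : xiF (1 - ((1/2 + b : ℝ):ℂ)) ≠ 0 := by rwa [xiF_one_sub]
  have h := hasSum_hadamard hRH hz hw
  rw [logDeriv_xiF_one_sub, sub_neg_eq_add, ← two_mul] at h
  have h2 := (Complex.hasSum_re h).div_const (2 * b)
  rw [gf, show (2 * logDeriv xiF ((1/2 + b : ℝ):ℂ)).re / (2*b) = (logDeriv xiF ((1/2 + b : ℝ):ℂ)).re / b by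
    simp; field_simp] at *
  rw [← h2.tsum_eq]
  refine tsum_congr (fun ρ ↦ ?_)
  have hn := Zt_norm_sq hRH ρ
  have hre := Zt_re hRH ρ
  set t := (ρ:ℂ).im
  have hρ : (ρ:ℂ) = 1/2 + t * I := by
    apply Complex.ext <;> simp [hre, t]
  have hne : b^2 + t^2 ≠ 0 := by positivity
  have e1 : (1:ℂ) / (((1/2 + b : ℝ):ℂ) - ρ) - 1 / (1 - ((1/2 + b : ℝ):ℂ) - ρ) =
      ((2 * b / (b^2 + t^2) : ℝ) : ℂ) := by
    have n1 : ((1/2 + b : ℝ):ℂ) - ρ ≠ 0 := fun h ↦ by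
      have := congrArg re h
      simp [hre] at this; linarith
    have n2 : 1 - ((1/2 + b : ℝ):ℂ) - ρ ≠ 0 := fun h ↦ by
      have := congrArg re h
      simp [hre] at this; linarith
    have n3 : ((b:ℂ)^2 + (t:ℂ)^2) ≠ 0 := by exact_mod_cast hne
    rw [div_sub_div _ _ n1 n2]
    push_cast
    rw [div_eq_div_iff (mul_ne_zero (by push_cast at n1; exact n1) (by push_cast at n2; exact n2)) n3, hρ]
    ring_nf
    simp only [I_sq]
    ring_nf
  rw [e1, ← ofReal_mul, ofReal_re, hn, show c^2 + (1/4 + t^2) = b^2+t^2 by rw [hb2]; ring]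
  field_simp

open ArithmeticFunction in
lemma logDeriv_zeta_re_nonpos {s : ℝ} (hs : 1 < s) : (logDeriv riemannZeta s).re ≤ 0 := by
  have h := LSeries_vonMangoldt_eq_deriv_riemannZeta_div (s := s) (by simpa using hs)
  have h2 : logDeriv riemannZeta s = - LSeries (fun n ↦ (vonMangoldt n : ℂ)) s := by
    rw [h, logDeriv_apply]; ring
  rw [h2, neg_re, neg_nonpos]
  rw [LSeries, Complex.re_tsum (LSeriesSummable_vonMangoldt (by simpa using hs))]
  refine tsum_nonneg (fun n ↦ ?_)
  rw [LSeries.term]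
  split_ifs with hn
  · simp
  · rw [← ofReal_natCast n, ← ofReal_cpow (Nat.cast_nonneg n), ← ofReal_div, ofReal_re]
    have : 0 ≤ vonMangoldt n := vonMangoldt_nonneg
    positivity

lemma F_re_le {s : ℝ} (hs : 1 < s) :
    (logDeriv xiF s).re ≤ 1/s + 1/(s-1) + Real.log (s / (2*Real.pi)) / 2 := by
  have hs' : 0 < s := by linarith
  rw [logDeriv_xiF (by simpa using hs), logDeriv_GammaR (by simpa using hs')]
  have e : ((s:ℂ)/2) = ((s/2:ℝ):ℂ) := by push_cast; ring
  rw [e, digamma_ofReal (by positivity)]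
  have e2 : (1/(s:ℂ) + 1/((s:ℂ)-1) + (-(Real.log Real.pi:ℂ)/2 + (psiR (s/2):ℂ)/2)) =
    ((1/s + 1/(s-1) + (-(Real.log Real.pi)/2 + (psiR (s/2))/2) : ℝ) : ℂ) := by push_cast; ring
  rw [add_re, e2, ofReal_re]
  have h1 := psiR_le_log (show 0 < s/2 by positivity)
  have h2 := logDeriv_zeta_re_nonpos hs
  have e3 : s / (2*Real.pi) = (s/2)/Real.pi := by field_simp
  rw [e3, Real.log_div (by positivity) Real.pi_ne_zero]
  linarith

lemma gf_le (hRH : RiemannHypothesis) {c : ℝ} (hc : 10 ≤ c) : gf c ≤ Real.log c / 2 / c := by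
  rw [gf_eq hRH (by linarith)]
  set b := √(c^2+1/4) with hb
  have hb0 : c ≤ b := Real.le_sqrt_of_sq_le (by linarith)
  have hb1 : b ≤ c + 1/2 := Real.sqrt_le_iff.mpr ⟨by linarith, by nlinarith⟩
  have h := F_re_le (show 1 < 1/2 + b by linarith)
  have hlog : Real.log ((1/2+b)/(2*Real.pi)) ≤ Real.log c - 1 := by
    rw [Real.log_le_iff_le_exp (by positivity), Real.exp_sub, Real.exp_log (by linarith)]
    have hp := Real.pi_gt_three
    have he := Real.exp_one_lt_d9
    rw [div_le_div_iff₀ (by positivity) (by positivity)]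
    nlinarith
  have h1 : 1/(1/2+b) ≤ 1/10 := one_div_le_one_div_of_le (by norm_num) (by linarith)
  have h2 : 1/(1/2+b-1) ≤ 1/9 := one_div_le_one_div_of_le (by norm_num) (by linarith)
  have hlc : 0 ≤ Real.log c := Real.log_nonneg (by linarith)
  calc _ ≤ (Real.log c / 2) / b := by
        gcongr
        linarith
    _ ≤ _ := by gcongr

lemma Af_le (hRH : RiemannHypothesis) (hM : M0 ≤ 0.1) {T : ℝ} (hT : 10 ≤ T) :
    Af T ≤ Real.log T ^ 2 / 4 := by
  have hanti : AntitoneOn (fun T ↦ Af T - Real.log T ^ 2 / 4) (Set.Ici 10) := by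
    have hd : ∀ c ∈ Set.Ici (10:ℝ), HasDerivAt (fun T ↦ Af T - Real.log T ^ 2 / 4)
        (gf c - Real.log c / 2 / c) c := by
      intro c hc
      have hc0 : c ≠ 0 := by have := Set.mem_Ici.mp hc; linarith
      refine HasDerivAt.congr_deriv ((Af_deriv hRH c).sub (((Real.hasDerivAt_log hc0).pow 2).div_const 4)) ?_
      field_simp; ring
    refine antitoneOn_of_deriv_nonpos (convex_Ici 10)
      (fun c hc ↦ (hd c hc).continuousAt.continuousWithinAt)
      (fun c hc ↦ (hd c (interior_subset hc)).differentiableAt.differentiableWithinAt) (fun c hc ↦ ?_)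
    rw [(hd c (interior_subset hc)).deriv]
    have := gf_le hRH (interior_subset hc)
    linarith
  have h := hanti (show (10:ℝ) ∈ Set.Ici 10 by simp) hT hT
  have h10 := (Af_summable hRH (show (0:ℝ) ≤ 10 by norm_num)).2
  have hl : 2 ≤ Real.log 10 := by
    rw [Real.le_log_iff_exp_le (by norm_num), show (2:ℝ) = 1 + 1 by norm_num, Real.exp_add]
    have := Real.exp_one_lt_d9
    nlinarith [Real.exp_pos 1]
  simp only at h
  nlinarith

lemma Sf_le_log (hRH : RiemannHypothesis) (hM : M0 ≤ 0.1) {T : ℝ} (hT : 10 ≤ T) :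
    Sf T ≤ Real.log T ^ 2 / Real.pi := by
  have h := Sf_le_Af hRH (show 0 < T by linarith)
  have h2 := Af_le hRH hM hT
  have hpi := Real.pi_pos
  calc _ ≤ 4 / Real.pi * (Real.log T ^ 2 / 4) := h.trans (by gcongr)
    _ = _ := by field_simp

end

section
open Filter

noncomputable def Pif (u : ℝ) : ℝ :=
  ∑ n ∈ Finset.range (⌊Real.exp u⌋₊ + 1), ArithmeticFunction.vonMangoldt n / n / Real.log n

noncomputable def Gn (n : ℕ) (t : ℝ) : ℝ :=
  ArithmeticFunction.vonMangoldt n / n * ((max (t - Real.log n) 0)^2 / (Real.log n * t^2))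

lemma hasDerivAt_max_sq (L t : ℝ) :
    HasDerivAt (fun t : ℝ ↦ (max (t - L) 0)^2) (2 * max (t - L) 0) t := by
  have hsq : HasDerivAt (fun t : ℝ ↦ (t - L)^2) (2 * (t - L)) t :=
    HasDerivAt.congr_deriv (((hasDerivAt_id t).sub_const L).pow 2) (by simp)
  rcases lt_trichotomy t L with h | h | h
  · rw [max_eq_right (by linarith), mul_zero]
    refine (hasDerivAt_const t (0:ℝ)).congr_of_eventuallyEq ?_
    filter_upwards [Iio_mem_nhds h] with y hy
    rw [max_eq_right (by linarith [Set.mem_Iio.mp hy])]; simp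
  · subst h
    simp only [sub_self, max_self, mul_zero] at hsq ⊢
    have h1 : HasDerivWithinAt (fun y : ℝ ↦ (max (y - t) 0)^2) 0 (Set.Iic t) t := by
      refine (hasDerivWithinAt_const t _ (0:ℝ)).congr (fun y hy ↦ ?_) (by simp)
      rw [max_eq_right (by linarith [Set.mem_Iic.mp hy])]; simp
    have h2 : HasDerivWithinAt (fun y : ℝ ↦ (max (y - t) 0)^2) 0 (Set.Ici t) t := by
      refine hsq.hasDerivWithinAt.congr (fun y hy ↦ ?_) (by simp)
      rw [max_eq_left (by linarith [Set.mem_Ici.mp hy])]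
    have := h1.union h2
    rwa [Set.Iic_union_Ici, hasDerivWithinAt_univ] at this
  · rw [max_eq_left (by linarith)]
    refine hsq.congr_of_eventuallyEq ?_
    filter_upwards [Ioi_mem_nhds h] with y hy
    rw [max_eq_left (by linarith [Set.mem_Ioi.mp hy])]

lemma Gn_deriv (n : ℕ) {t : ℝ} (ht : 0 < t) : HasDerivAt (Gn n) (2 / t^3 * Vn n t) t := by
  by_cases hL : Real.log n = 0
  · have h0 : ArithmeticFunction.vonMangoldt n = 0 := by
      rcases Real.log_eq_zero.mp hL with h | h | h
      · rw [Nat.cast_eq_zero.mp h]; simp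
      · rw [Nat.cast_eq_one.mp h]; simp
      · have : (0:ℝ) ≤ n := Nat.cast_nonneg n
        linarith
    have : Gn n = fun _ ↦ 0 := by funext y; simp [Gn, h0]
    rw [this, Vn, h0]
    simpa using hasDerivAt_const t (0:ℝ)
  · have h1 := (hasDerivAt_max_sq (Real.log n) t).div
      (((hasDerivAt_id t).pow 2).const_mul (Real.log n)) (mul_ne_zero hL (pow_ne_zero 2 ht.ne'))
    have h2 := h1.const_mul (ArithmeticFunction.vonMangoldt n / (n:ℝ))
    refine HasDerivAt.congr_deriv h2 ?_
    rw [Vn]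
    simp only [id, Pi.pow_apply]
    generalize ArithmeticFunction.vonMangoldt n / (n:ℝ) = a
    rcases max_cases (t - Real.log n) 0 with ⟨h, _⟩ | ⟨h, _⟩ <;> rw [h] <;> field_simp <;> ring

lemma Gn_sum {t w : ℝ} (ht : 0 < t) (h : t ≤ w) :
    ∑ n ∈ Finset.range (⌊Real.exp w⌋₊ + 1), Gn n t = Pif t - psi1 (Real.exp t) / t - Vf t / t^2 := by
  have hsub : Finset.range (⌊Real.exp t⌋₊ + 1) ⊆ Finset.range (⌊Real.exp w⌋₊ + 1) := by
    apply Finset.range_subset_range.mpr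
    gcongr
  rw [← Finset.sum_subset hsub, Pif, psi1, Vf_eq_sum (le_refl t), Finset.sum_div, Finset.sum_div,
    ← Finset.sum_sub_distrib, ← Finset.sum_sub_distrib]
  · refine Finset.sum_congr rfl (fun n hn ↦ ?_)
    rcases eq_or_ne n 0 with rfl | h0
    · simp [Gn, Vn]
    rcases eq_or_ne n 1 with rfl | h1
    · simp [Gn, Vn]
    have hL : Real.log n ≠ 0 := by
      have : (1:ℝ) < n := by exact_mod_cast (show 1 < n by omega)
      exact (Real.log_pos this).ne'
    have := le_of_floor hn h0
    have hn0 : (n:ℝ) ≠ 0 := by exact_mod_cast h0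
    rw [Gn, Vn, max_eq_left (by linarith)]
    field_simp
    try ring
  · intro n _ hn
    have := lt_of_floor hn
    rw [Gn, max_eq_right (by linarith)]; simp

lemma EPi_diff (hRH : RiemannHypothesis) {u w : ℝ} (hu : 2 ≤ u) (h : u ≤ w) :
    |(Pif w - Real.log w - Rf w / w) - (Pif u - Real.log u - Rf u / u)| ≤
      2 * (M0 * Real.exp (-u/2) + 0.35 * Real.exp (-3*u)) / u^2 := by
  set K := M0 * Real.exp (-u/2) + 0.35 * Real.exp (-3*u) with hK
  have hM := M0_nonneg hRH
  have hK0 : 0 ≤ K := by positivity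
  have hr : ∀ t, u ≤ t → |rf t| ≤ K := by
    intro t ht
    refine (rf_abs_le hRH (hu.trans ht)).trans ?_
    rw [hK]
    have : Real.exp (-t/2) ≤ Real.exp (-u/2) := Real.exp_le_exp.mpr (by linarith)
    have : Real.exp (-3*t) ≤ Real.exp (-3*u) := Real.exp_le_exp.mpr (by linarith)
    gcongr
  set C := c1.re + Tinf with hC
  set γ := Real.eulerMascheroniConstant with hγ
  let H : ℝ → ℝ := fun t ↦ (∑ n ∈ Finset.range (⌊Real.exp w⌋₊ + 1), Gn n t) + C / t^2 - Real.log t - 2*γ/t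
  have hH : ∀ t, u ≤ t → t ≤ w → H t = (Pif t - Real.log t - Rf t / t) - 3/2 + rf t / t^2 := by
    intro t h1 h2
    have ht : 0 < t := by linarith
    simp only [H]
    rw [Gn_sum ht h2, Vf_formula hRH ht, Rf]
    field_simp
    ring
  have hd : ∀ t, u ≤ t → t ≤ w → HasDerivAt H (-2 * rf t / t^3) t := by
    intro t h1 h2
    have ht : 0 < t := by linarith
    have e1 := HasDerivAt.fun_sum (u := Finset.range (⌊Real.exp w⌋₊ + 1)) (fun n _ ↦ Gn_deriv n ht)
    rw [← Finset.mul_sum, ← Vf_eq_sum h2, Vf_formula hRH ht] at e1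
    have e2 := ((hasDerivAt_const t C).div ((hasDerivAt_id t).pow 2) (by simp; exact ht.ne'))
    have e3 := ((hasDerivAt_const t (2*γ)).div (hasDerivAt_id t) (by simp; exact ht.ne'))
    refine HasDerivAt.congr_deriv (((e1.add e2).sub (Real.hasDerivAt_log ht.ne')).sub e3) ?_
    simp only [id, Pi.pow_apply]
    field_simp
    ring
  have hk : ∀ t, u ≤ t → HasDerivAt (fun t : ℝ ↦ K / t^2) (-2 * K / t^3) t := by
    intro t h1
    have ht : 0 < t := by linarith
    refine HasDerivAt.congr_deriv ((hasDerivAt_const t K).div ((hasDerivAt_id t).pow 2) (by simp; exact ht.ne')) ?_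
    simp only [id, Pi.pow_apply]
    field_simp
    ring
  have m1 : AntitoneOn (fun t ↦ H t + K / t^2) (Set.Icc u w) := by
    have hd1 : ∀ t ∈ Set.Icc u w, HasDerivAt (fun t ↦ H t + K / t^2) (-2 * rf t / t^3 + -2 * K / t^3) t :=
      fun t ht ↦ (hd t ht.1 ht.2).add (hk t ht.1)
    refine antitoneOn_of_deriv_nonpos (convex_Icc u w)
      (fun c hc ↦ (hd1 c hc).continuousAt.continuousWithinAt)
      (fun c hc ↦ (hd1 c (interior_subset hc)).differentiableAt.differentiableWithinAt) (fun c hc ↦ ?_)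
    have hc' := interior_subset hc
    rw [(hd1 c hc').deriv, ← add_div]
    have := hr c hc'.1
    have hc0 : 0 < c := by linarith [hc'.1]
    apply div_nonpos_of_nonpos_of_nonneg _ (by positivity)
    linarith [(abs_le.mp this).1]
  have m2 : MonotoneOn (fun t ↦ H t - K / t^2) (Set.Icc u w) := by
    have hd1 : ∀ t ∈ Set.Icc u w, HasDerivAt (fun t ↦ H t - K / t^2) (-2 * rf t / t^3 - -2 * K / t^3) t :=
      fun t ht ↦ (hd t ht.1 ht.2).sub (hk t ht.1)
    refine monotoneOn_of_deriv_nonneg (convex_Icc u w)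
      (fun c hc ↦ (hd1 c hc).continuousAt.continuousWithinAt)
      (fun c hc ↦ (hd1 c (interior_subset hc)).differentiableAt.differentiableWithinAt) (fun c hc ↦ ?_)
    have hc' := interior_subset hc
    rw [(hd1 c hc').deriv, ← sub_div]
    have := hr c hc'.1
    have hc0 : 0 < c := by linarith [hc'.1]
    apply div_nonneg _ (by positivity)
    linarith [(abs_le.mp this).2]
  have a1 := m1 (Set.left_mem_Icc.mpr h) (Set.right_mem_Icc.mpr h) h
  have a2 := m2 (Set.left_mem_Icc.mpr h) (Set.right_mem_Icc.mpr h) h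
  simp only at a1 a2
  rw [hH u le_rfl h, hH w h le_rfl] at a1 a2
  have b1 := abs_le.mp (hr u le_rfl)
  have b2 := abs_le.mp (hr w h)
  have d : ∀ {a b c : ℝ}, 0 < c → a ≤ b → a / c^2 ≤ b/c^2 := fun hc hab ↦ by gcongr
  have hu0 : 0 < u := by linarith
  have hw0 : 0 < w := by linarith
  have c1 := d hu0 b1.1
  have c2 := d hu0 b1.2
  have c3 := d hw0 b2.1
  have c4 := d hw0 b2.2
  rw [neg_div] at c1 c3
  rw [abs_le, mul_div_assoc]
  constructor <;> linarith

end

section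
open Filter

noncomputable def Pp (u : ℝ) : ℝ :=
  ∑ p ∈ (Finset.range (⌊Real.exp u⌋₊ + 1)).filter Nat.Prime, (1:ℝ) / p

noncomputable def Df (u : ℝ) : ℝ :=
  ∑ n ∈ (Finset.range (⌊Real.exp u⌋₊ + 1)).filter (fun n ↦ ¬ Nat.Prime n),
    ArithmeticFunction.vonMangoldt n / n / Real.log n

lemma Pif_eq (u : ℝ) : Pif u = Pp u + Df u := by
  rw [Pif, Pp, Df, ← Finset.sum_filter_add_sum_filter_not _ Nat.Prime]
  congr 1
  refine Finset.sum_congr rfl (fun p hp ↦ ?_)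
  have hp' := (Finset.mem_filter.mp hp).2
  rw [ArithmeticFunction.vonMangoldt_apply_prime hp']
  have h1 : (1:ℝ) < p := by exact_mod_cast hp'.one_lt
  have := (Real.log_pos h1).ne'
  field_simp

lemma Df_mono {u w : ℝ} (h : u ≤ w) : Df u ≤ Df w := by
  refine Finset.sum_le_sum_of_subset_of_nonneg ?_ (fun n _ _ ↦ div_nonneg (lam_nonneg n) (Real.log_natCast_nonneg n))
  apply Finset.filter_subset_filter
  apply Finset.range_subset_range.mpr
  gcongr

lemma Rf_div_tendsto (hRH : RiemannHypothesis) : Tendsto (fun w ↦ Rf w / w) atTop (nhds 0) := by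
  have hb : ∀ w : ℝ, 2 ≤ w → |Rf w| ≤ 2 * M0 + 1 := by
    intro w hw
    have hM := M0_nonneg hRH
    have h1 := Rf_le hRH hw one_pos
    have h2 := Rf_ge hRH hw one_pos le_rfl
    have hS := Sf_le_M0 hRH (show (0:ℝ) ≤ 2/1 by norm_num)
    have e1 : Real.exp (-w/2) ≤ 1 := Real.exp_le_one_iff.mpr (by linarith)
    have e2 : Real.exp (-(w-1)/2) ≤ 1 := Real.exp_le_one_iff.mpr (by linarith)
    have e3 : Real.exp (-3*w) ≤ 1 := Real.exp_le_one_iff.mpr (by linarith)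
    have k1 : Real.exp (-w/2) * Sf (2/1) ≤ 1 * (2/1*M0) :=
      (mul_le_mul_of_nonneg_left hS (Real.exp_pos _).le).trans (mul_le_mul_of_nonneg_right e1 (by positivity))
    have k2 : Real.exp (-(w-1)/2) * Sf (2/1) ≤ 1 * (2/1*M0) :=
      (mul_le_mul_of_nonneg_left hS (Real.exp_pos _).le).trans (mul_le_mul_of_nonneg_right e2 (by positivity))
    rw [abs_le]
    constructor <;> linarith
  rw [tendsto_zero_iff_abs_tendsto_zero]
  have hz : Tendsto (fun w : ℝ ↦ (2 * M0 + 1) / w) atTop (nhds 0) := tendsto_const_nhds.div_atTop tendsto_id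
  refine squeeze_zero' (Eventually.of_forall (fun w ↦ abs_nonneg _)) ?_ hz
  filter_upwards [eventually_ge_atTop 2] with w hw
  have hw0 : 0 < w := by linarith
  simp only [Function.comp]
  rw [abs_div, abs_of_pos hw0]
  have := hb w hw
  gcongr

lemma E_bounds (hRH : RiemannHypothesis) {B : ℝ} (hB : Tendsto (fun w ↦ Pp w - Real.log w) atTop (nhds B))
    {u : ℝ} (hu : 2 ≤ u) :
    Rf u / u - 2 * (M0 * Real.exp (-u/2) + 0.35 * Real.exp (-3*u)) / u^2 ≤ Pp u - Real.log u - B ∧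
    ∀ t, (∀ w, u ≤ w → Df w - Df u ≤ t) →
    Pp u - Real.log u - B ≤ Rf u / u + 2 * (M0 * Real.exp (-u/2) + 0.35 * Real.exp (-3*u)) / u^2 + t := by
  have hL : Tendsto (fun w ↦ Pp u - Real.log u - (Pp w - Real.log w) + Rf w / w) atTop
      (nhds (Pp u - Real.log u - B + 0)) := (hB.const_sub _).add (Rf_div_tendsto hRH)
  rw [add_zero] at hL
  constructor
  · refine ge_of_tendsto hL ?_
    filter_upwards [eventually_ge_atTop u] with w hw
    have h := (abs_le.mp (EPi_diff hRH hu hw)).2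
    rw [Pif_eq, Pif_eq] at h
    have := Df_mono hw
    linarith
  · intro t ht
    refine le_of_tendsto hL ?_
    filter_upwards [eventually_ge_atTop u] with w hw
    have h := (abs_le.mp (EPi_diff hRH hu hw)).1
    rw [Pif_eq, Pif_eq] at h
    have := ht w hw
    linarith

lemma geom_tail {p b M : ℕ} (hp : 2 ≤ p) (hb : 1 ≤ b) :
    ∑ k ∈ Finset.Ico b M, (1:ℝ) / (k * (p:ℝ)^k) ≤ 1 / (b * (p:ℝ)^(b-1) * (p-1)) := by
  have hp' : (2:ℝ) ≤ p := by exact_mod_cast hp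
  have hb' : (1:ℝ) ≤ b := by exact_mod_cast hb
  have h1 : ∀ k ∈ Finset.Ico b M, (1:ℝ) / (k * (p:ℝ)^k) ≤ 1 / b * ((1/p)^k) := by
    intro k hk
    have : (b:ℝ) ≤ k := by exact_mod_cast (Finset.mem_Ico.mp hk).1
    rw [one_div_pow, one_div_mul_one_div]
    gcongr
  refine (Finset.sum_le_sum h1).trans ?_
  rw [← Finset.mul_sum]
  have h2 := geom_sum_Ico_le_of_lt_one (m := b) (n := M) (x := (1:ℝ)/p) (by positivity)
    (by rw [div_lt_one (by linarith)]; linarith)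
  refine (mul_le_mul_of_nonneg_left h2 (by positivity)).trans (le_of_eq ?_)
  have hp1 : (p:ℝ) - 1 ≠ 0 := by linarith
  have e : (p:ℝ)^b = p^(b-1) * p := by rw [← pow_succ, Nat.sub_add_cancel hb]
  rw [one_div_pow, e]
  have hp0 : (p:ℝ) ≠ 0 := by linarith
  have : 1 - 1/(p:ℝ) = (p-1)/p := by field_simp
  rw [this]
  field_simp

noncomputable def Gb (b p : ℕ) : ℝ := 1 / (b * (p:ℝ)^(b-1) * (p-1))

lemma tail_le {u w : ℝ} (h : u ≤ w) (b : ℕ → ℕ) (hb : ∀ p, 2 ≤ b p)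
    (hbu : ∀ p : ℕ, p.Prime → ∀ k, 2 ≤ k → Real.exp u < (p:ℝ)^k → b p ≤ k) :
    Df w - Df u ≤ ∑ p ∈ (Finset.range (⌊Real.exp w⌋₊ + 1)).filter Nat.Prime, Gb (b p) p := by
  set N := ⌊Real.exp w⌋₊ + 1 with hN
  set Nu := ⌊Real.exp u⌋₊ + 1 with hNu
  have hsub : (Finset.range Nu).filter (fun n ↦ ¬ Nat.Prime n) ⊆ (Finset.range N).filter (fun n ↦ ¬ Nat.Prime n) := by
    apply Finset.filter_subset_filter
    apply Finset.range_subset_range.mpr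
    rw [hN, hNu]
    gcongr
  rw [Df, Df, ← Finset.sum_sdiff hsub, add_sub_cancel_right]
  set S := (Finset.range N).filter (fun n ↦ ¬ Nat.Prime n) \ (Finset.range Nu).filter (fun n ↦ ¬ Nat.Prime n)
  rw [← Finset.sum_filter_add_sum_filter_not S IsPrimePow]
  have hz : ∑ n ∈ S.filter (fun n ↦ ¬ IsPrimePow n), ArithmeticFunction.vonMangoldt n / (n:ℝ) / Real.log n = 0 := by
    refine Finset.sum_eq_zero (fun n hn ↦ ?_)
    rw [ArithmeticFunction.vonMangoldt_eq_zero_iff.mpr (Finset.mem_filter.mp hn).2]; simp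
  rw [hz, add_zero]
  have hmem : ∀ n ∈ S.filter IsPrimePow, n < N ∧ ¬ n.Prime ∧ Real.exp u < n ∧ IsPrimePow n := by
    intro n hn
    simp only [S, Finset.mem_filter, Finset.mem_sdiff, Finset.mem_range, not_and, not_not] at hn
    obtain ⟨⟨⟨h1, h2⟩, h3⟩, h4⟩ := hn
    refine ⟨h1, h2, ?_, h4⟩
    by_contra hc
    refine h2 (h3 ?_)
    rw [hNu, Nat.lt_succ_iff]
    exact Nat.le_floor (not_lt.mp hc)
  have hmaps : ∀ n ∈ S.filter IsPrimePow, n.minFac ∈ (Finset.range N).filter Nat.Prime := by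
    intro n hn
    obtain ⟨h1, h2, h3, h4⟩ := hmem n hn
    rw [Finset.mem_filter, Finset.mem_range]
    exact ⟨(Nat.minFac_le h4.pos).trans_lt h1, Nat.minFac_prime h4.ne_one⟩
  rw [← Finset.sum_fiberwise_of_maps_to hmaps]
  refine Finset.sum_le_sum (fun p hp ↦ ?_)
  have hpp := (Finset.mem_filter.mp hp).2
  have hinj : Set.InjOn (fun k ↦ p^k) (Finset.Ico (b p) N : Set ℕ) :=
    fun x _ y _ hxy ↦ Nat.pow_right_injective hpp.two_le hxy
  have hsub2 : (S.filter IsPrimePow).filter (fun n ↦ n.minFac = p) ⊆ (Finset.Ico (b p) N).image (fun k ↦ p^k) := by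
    intro n hn
    rw [Finset.mem_filter] at hn
    obtain ⟨h1, h2, h3, h4⟩ := hmem n hn.1
    obtain ⟨k, hk0, hk⟩ := (isPrimePow_iff_minFac_pow_factorization_eq h4.ne_one).mp h4 |> fun h ↦
      (show ∃ k, 0 < k ∧ n = p^k from ⟨n.factorization n.minFac, by
        rw [Nat.pos_iff_ne_zero]
        intro h0; rw [h0, pow_zero] at h
        exact h4.ne_one h.symm, by rw [← hn.2]; exact h.symm⟩)
    have hk2 : 2 ≤ k := by
      by_contra hc
      have : k = 1 := by omega
      rw [this, pow_one] at hk
      exact h2 (hk ▸ hpp)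
    rw [Finset.mem_image]
    refine ⟨k, Finset.mem_Ico.mpr ⟨hbu p hpp k hk2 ?_, ?_⟩, hk.symm⟩
    · rw [hk] at h3; exact_mod_cast h3
    · exact (Nat.lt_pow_self hpp.one_lt).trans (hk ▸ h1)
  refine (Finset.sum_le_sum_of_subset_of_nonneg hsub2
    (fun n _ _ ↦ div_nonneg (lam_nonneg n) (Real.log_natCast_nonneg n))).trans ?_
  rw [Finset.sum_image hinj]
  refine le_trans (le_of_eq ?_) (geom_tail (M := N) hpp.two_le (by linarith [hb p] : 1 ≤ b p))
  refine Finset.sum_congr rfl (fun k hk ↦ ?_)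
  have hk0 : k ≠ 0 := by have := (Finset.mem_Ico.mp hk).1; have := hb p; omega
  rw [ArithmeticFunction.vonMangoldt_apply_pow hk0, ArithmeticFunction.vonMangoldt_apply_prime hpp]
  push_cast
  rw [Real.log_pow]
  have h1 : (1:ℝ) < p := by exact_mod_cast hpp.one_lt
  have := (Real.log_pos h1).ne'
  have : (k:ℝ) ≠ 0 := by exact_mod_cast hk0
  field_simp

end

section
open Filter

lemma Gb_two_nonneg (b p : ℕ) (hp : p.Prime) : 0 ≤ Gb b p := by
  rw [Gb]
  have : (1:ℝ) < p := by exact_mod_cast hp.one_lt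
  have : (0:ℝ) < p - 1 := by linarith
  positivity

lemma primes_tail_aux (k : ℕ) (hk : 1 ≤ k) (d : ℕ) :
    ∑ p ∈ (Finset.Ico (6*k) (6*(k+d))).filter Nat.Prime, Gb 2 p ≤
      1/6 * (1/(6*k-1) - 1/(6*((k:ℝ)+d)-1)) := by
  induction d with
  | zero => simp
  | succ d ih =>
    set m := k + d with hm
    have hm1 : 1 ≤ m := by omega
    have hsplit : (Finset.Ico (6*k) (6*(k+(d+1)))).filter Nat.Prime ⊆
        (Finset.Ico (6*k) (6*m)).filter Nat.Prime ∪ (({6*m+1, 6*m+5} : Finset ℕ).filter Nat.Prime) := by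
      intro p hp
      rw [Finset.mem_filter, Finset.mem_Ico] at hp
      rw [Finset.mem_union, Finset.mem_filter, Finset.mem_filter, Finset.mem_Ico]
      obtain ⟨⟨h1, h2⟩, h3⟩ := hp
      rcases lt_or_ge p (6*m) with h | h
      · exact Or.inl ⟨⟨h1, h⟩, h3⟩
      · refine Or.inr ⟨?_, h3⟩
        have n2 : ¬ 2 ∣ p := fun hd ↦ by
          have := (Nat.prime_dvd_prime_iff_eq Nat.prime_two h3).mp hd; omega
        have n3 : ¬ 3 ∣ p := fun hd ↦ by
          have := (Nat.prime_dvd_prime_iff_eq Nat.prime_three h3).mp hd; omega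
        simp only [Finset.mem_insert, Finset.mem_singleton]
        omega
    refine (Finset.sum_le_sum_of_subset_of_nonneg hsplit (fun p hp _ ↦ ?_)).trans ?_
    · rw [Finset.mem_union, Finset.mem_filter, Finset.mem_filter] at hp
      exact Gb_two_nonneg 2 p (hp.elim (fun h ↦ h.2) (fun h ↦ h.2))
    rw [Finset.sum_union (by
      rw [Finset.disjoint_left]
      intro p hp hp2
      simp only [Finset.mem_filter, Finset.mem_Ico, Finset.mem_insert, Finset.mem_singleton] at hp hp2
      omega)]
    have h2 : ∑ p ∈ ({6*m+1, 6*m+5} : Finset ℕ).filter Nat.Prime, Gb 2 p ≤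
        1/(2*(6*m+1)*(6*m)) + 1/(2*(6*(m:ℝ)+5)*(6*m+4)) := by
      have hnn : ∀ p : ℕ, 1 ≤ p → 0 ≤ Gb 2 p := fun p hp ↦ by
        have : (1:ℝ) ≤ p := by exact_mod_cast hp
        have : (0:ℝ) ≤ p - 1 := by linarith
        rw [Gb]; positivity
      refine (Finset.sum_le_sum_of_subset_of_nonneg (Finset.filter_subset _ _) (fun p hp _ ↦ hnn p ?_)).trans ?_
      · simp only [Finset.mem_insert, Finset.mem_singleton] at hp; omega
      · rw [Finset.sum_pair (by omega), Gb, Gb]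
        push_cast
        apply le_of_eq
        simp only [Nat.add_one_sub_one, pow_one]
        congr 3 <;> ring
    have hm' : (k:ℝ) + d = m := by rw [hm]; push_cast; ring
    have hmr : (1:ℝ) ≤ m := by exact_mod_cast hm1
    rw [hm'] at ih
    push_cast
    rw [show (k:ℝ) + (d+1) = m + 1 by rw [← hm']; ring]
    have key : 1/(2*(6*m+1)*(6*m)) + 1/(2*(6*(m:ℝ)+5)*(6*m+4)) ≤ 1/6 * (1/(6*m-1) - 1/(6*((m:ℝ)+1)-1)) := by
      have a1 : (0:ℝ) < 6*m-1 := by linarith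
      have a2 : (0:ℝ) < 6*(m+1)-1 := by linarith
      rw [div_sub_div _ _ a1.ne' a2.ne', div_add_div _ _ (by positivity) (by positivity), one_div_mul_eq_div,
        div_div, div_le_div_iff₀ (by positivity) (by positivity)]
      obtain ⟨y, hy'⟩ : ∃ y, (m:ℝ) = y + 1 := ⟨m - 1, by ring⟩
      have hy : 0 ≤ y := by linarith
      rw [← sub_nonneg, hy']
      ring_nf
      positivity
    linarith

lemma primes_tail {k : ℕ} (hk : 1 ≤ k) (N : ℕ) (b : ℕ → ℕ) (hb : ∀ p, 6*k ≤ p → b p = 2) :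
    ∑ p ∈ (Finset.range N).filter Nat.Prime, Gb (b p) p ≤
      ∑ p ∈ (Finset.range (6*k)).filter Nat.Prime, Gb (b p) p + 1/(6*(6*k-1)) := by
  have hsub : (Finset.range N).filter Nat.Prime ⊆ (Finset.range (6*k)).filter Nat.Prime ∪
      (Finset.Ico (6*k) (6*(k+N))).filter Nat.Prime := by
    intro p hp
    simp only [Finset.mem_union, Finset.mem_filter, Finset.mem_Ico, Finset.mem_range] at hp ⊢
    rcases lt_or_ge p (6*k) with h | h
    · exact Or.inl ⟨h, hp.2⟩
    · exact Or.inr ⟨⟨h, by omega⟩, hp.2⟩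
  refine (Finset.sum_le_sum_of_subset_of_nonneg hsub (fun p hp _ ↦ ?_)).trans ?_
  · rw [Finset.mem_union, Finset.mem_filter, Finset.mem_filter] at hp
    exact Gb_two_nonneg _ p (hp.elim (fun h ↦ h.2) (fun h ↦ h.2))
  rw [Finset.sum_union (by
      rw [Finset.disjoint_left]
      intro p hp hp2
      simp only [Finset.mem_filter, Finset.mem_Ico, Finset.mem_range] at hp hp2
      omega)]
  gcongr
  have h1 := primes_tail_aux k hk N
  have h2 : ∑ p ∈ (Finset.Ico (6*k) (6*(k+N))).filter Nat.Prime, Gb (b p) p =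
     ∑ p ∈ (Finset.Ico (6*k) (6*(k+N))).filter Nat.Prime, Gb 2 p := by
    refine Finset.sum_congr rfl (fun p hp ↦ ?_)
    rw [hb p (Finset.mem_Ico.mp (Finset.mem_filter.mp hp).1).1]
  rw [h2]
  refine h1.trans ?_
  have hkr : (1:ℝ) ≤ k := by exact_mod_cast hk
  have : 0 ≤ 1/(6*((k:ℝ)+N)-1) := by
    have : (0:ℝ) ≤ N := Nat.cast_nonneg N
    have : 0 ≤ 6*((k:ℝ)+N)-1 := by linarith
    positivity
  rw [one_div_mul_eq_div] 
  rw [← div_div, div_right_comm]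
  gcongr
  linarith

def bs (X p : ℕ) : ℕ → ℕ → ℕ
  | 0, j => j
  | f+1, j => if X < p^j then j else bs X p f (j+1)

lemma bs_ge (X p f j : ℕ) : j ≤ bs X p f j := by
  induction f generalizing j with
  | zero => simp [bs]
  | succ f ih => rw [bs]; split_ifs; exacts [le_rfl, (Nat.le_succ j).trans (ih _)]

lemma bs_le (X p f j k : ℕ) (hk : j ≤ k) (h : X < p^k) : bs X p f j ≤ k := by
  induction f generalizing j with
  | zero => simpa [bs] using hk
  | succ f ih =>
    rw [bs]; split_ifs with hc
    · exact hk
    · refine ih (j+1) ?_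
      rcases hk.lt_or_eq with h1 | h1
      · exact h1
      · subst h1; exact absurd h hc

def plist : List ℕ := [2, 3, 5, 7, 11, 13, 17, 19, 23, 29, 31, 37, 41, 43, 47, 53, 59, 61, 67, 71, 73, 79, 83, 89, 97, 101, 103, 107, 109, 113, 127, 131, 137, 139, 149, 151, 157, 163, 167, 173, 179, 181, 191, 193, 197, 199, 211, 223, 227, 229, 233, 239, 241, 251, 257, 263, 269, 271, 277, 281, 283, 293, 307, 311, 313, 317, 331, 337, 347, 349, 353, 359, 367, 373, 379, 383, 389, 397, 401]

lemma mem_plist {p : ℕ} (hp : p.Prime) (h : p < 402) : p ∈ plist := by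
  have hd : ∀ n < 402, n ∈ plist ∨ n < 2 ∨ ∃ d ∈ [2,3,5,7,11,13,17,19], d ∣ n ∧ d < n := by
    decide +kernel
  rcases hd p h with h1 | h1 | ⟨d, h1, h2, h3⟩
  · exact h1
  · have := hp.two_le; omega
  · rcases (Nat.dvd_prime hp).mp h2 with h4 | h4
    · subst h4; simp at h1
    · omega

lemma Gb_le_nat {b p : ℕ} (hb : 2 ≤ b) (hp : 2 ≤ p) :
    Gb b p ≤ ((10^9 / (b * p^(b-1) * (p-1)) + 1 : ℕ) : ℝ) / 10^9 := by
  have e : Gb b p = 1 / ((b * p^(b-1) * (p-1) : ℕ) : ℝ) := by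
    rw [Gb]; push_cast [Nat.cast_sub (show 1 ≤ p by omega)]; rfl
  have hpos : 0 < b * p^(b-1) * (p-1) := by
    have : 0 < p - 1 := by omega
    positivity
  rw [e]
  set D := b * p^(b-1) * (p-1)
  have h1 : 10^9 < D * (10^9 / D + 1) := Nat.lt_mul_div_succ _ hpos
  have h2 : (10:ℝ)^9 < D * ((10^9/D + 1 : ℕ):ℝ) := by exact_mod_cast h1
  have hD : (0:ℝ) < D := by exact_mod_cast hpos
  rw [div_le_div_iff₀ hD (by positivity)]
  linarith

lemma sum_primes_le (M : ℕ) (hM : M ≤ 402) (b : ℕ → ℕ) (hb : ∀ p, 2 ≤ b p) (c : ℕ)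
    (hc : ((plist.filter (· < M)).map (fun p ↦ 10^9 / (b p * p^(b p-1) * (p-1)) + 1)).sum ≤ c) :
    ∑ p ∈ (Finset.range M).filter Nat.Prime, Gb (b p) p ≤ c / 10^9 := by
  have hnd : (plist.filter (· < M)).Nodup := List.Nodup.filter _ (by decide +kernel)
  have hsub : (Finset.range M).filter Nat.Prime ⊆ (plist.filter (· < M)).toFinset := by
    intro p hp
    simp only [Finset.mem_filter, Finset.mem_range] at hp
    simp only [List.mem_toFinset, List.mem_filter, decide_eq_true_eq]
    exact ⟨mem_plist hp.2 (by omega), hp.1⟩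
  have h1 : ∑ p ∈ (Finset.range M).filter Nat.Prime, Gb (b p) p ≤
      ∑ p ∈ (Finset.range M).filter Nat.Prime, ((10^9 / (b p * p^(b p-1) * (p-1)) + 1 : ℕ) : ℝ) / 10^9 :=
    Finset.sum_le_sum (fun p hp ↦ Gb_le_nat (hb p) (Finset.mem_filter.mp hp).2.two_le)
  refine h1.trans ((Finset.sum_le_sum_of_subset_of_nonneg hsub (fun p _ _ ↦ by positivity)).trans ?_)
  rw [← Finset.sum_div, ← Nat.cast_sum, List.sum_toFinset _ hnd]
  gcongr

lemma tail_num {u₀ : ℝ} (X k c : ℕ) (hX : (X:ℝ) ≤ Real.exp u₀) (hk : 1 ≤ k) (hk2 : k ≤ 67) (hkX : X < (6*k)^2)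
    (hc : ((plist.filter (· < 6*k)).map (fun p ↦ 10^9 / (bs X p 12 2 * p^(bs X p 12 2-1) * (p-1)) + 1)).sum ≤ c)
    {u w : ℝ} (hu : u₀ ≤ u) (h : u ≤ w) : Df w - Df u ≤ c / 10^9 + 1/(6*(6*k-1)) := by
  have h0 : Df w - Df u ≤ Df w - Df u₀ := by linarith [Df_mono hu]
  refine h0.trans ((tail_le (hu.trans h) (fun p ↦ bs X p 12 2) (fun p ↦ bs_ge _ _ _ _) ?_).trans ?_)
  · intro p hp j hj hlt
    refine bs_le _ _ _ _ _ hj ?_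
    exact_mod_cast hX.trans_lt hlt
  · refine (primes_tail hk _ _ (fun p hp ↦ ?_)).trans ?_
    · refine le_antisymm (bs_le _ _ _ _ _ le_rfl (hkX.trans_le (Nat.pow_le_pow_left hp 2))) (bs_ge _ _ _ _)
    · gcongr
      exact sum_primes_le (6*k) (by omega) _ (fun p ↦ bs_ge _ _ _ _) c hc

lemma exp5 : (148:ℝ) ≤ Real.exp 5 := by
  have := Real.exp_one_gt_d9
  rw [show (5:ℝ) = ((5:ℕ):ℝ) * 1 by norm_num, Real.exp_nat_mul]
  exact le_trans (by norm_num) (pow_le_pow_left₀ (by norm_num) this.le 5)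
lemma exp6 : (403:ℝ) ≤ Real.exp 6 := by
  have := Real.exp_one_gt_d9
  rw [show (6:ℝ) = ((6:ℕ):ℝ) * 1 by norm_num, Real.exp_nat_mul]
  exact le_trans (by norm_num) (pow_le_pow_left₀ (by norm_num) this.le 6)
lemma exp7 : (1096:ℝ) ≤ Real.exp 7 := by
  have := Real.exp_one_gt_d9
  rw [show (7:ℝ) = ((7:ℕ):ℝ) * 1 by norm_num, Real.exp_nat_mul]
  exact le_trans (by norm_num) (pow_le_pow_left₀ (by norm_num) this.le 7)

lemma tail5 {u w : ℝ} (hu : 5 ≤ u) (h : u ≤ w) : Df w - Df u ≤ 0.016155 :=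
  (tail_num 148 67 15739002 (by exact_mod_cast exp5) (by norm_num) (by norm_num) (by norm_num)
    (by decide +kernel) hu h).trans (by norm_num)
lemma tail6 {u w : ℝ} (hu : 6 ≤ u) (h : u ≤ w) : Df w - Df u ≤ 0.00845 :=
  (tail_num 403 10 5619135 (by exact_mod_cast exp6) (by norm_num) (by norm_num) (by norm_num)
    (by decide +kernel) hu h).trans (by norm_num)
lemma tail7 {u w : ℝ} (hu : 7 ≤ u) (h : u ≤ w) : Df w - Df u ≤ 0.00535 :=
  (tail_num 1096 10 2521751 (by exact_mod_cast exp7) (by norm_num) (by norm_num) (by norm_num)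
    (by decide +kernel) hu h).trans (by norm_num)

end

section
open Filter

lemma card_primes_le (k : ℕ) : ((Finset.range (6*k)).filter Nat.Prime).card ≤ 3*k := by
  have h : ((Finset.range (6*k)).filter Nat.Prime).card ≤ (Finset.range (3*k)).card := by
    refine Finset.card_le_card_of_injOn (fun p ↦ (p-1)/2) (fun p hp ↦ ?_) (fun p hp q hq hpq ↦ ?_)
    · simp only [Finset.coe_filter, Finset.mem_range, Set.mem_setOf_eq, Finset.coe_range, Set.mem_Iio] at hp ⊢
      have := hp.2.two_le
      omega
    · simp only [Finset.coe_filter, Finset.mem_range, Set.mem_setOf_eq] at hp hq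
      simp only at hpq
      have h1 := hp.2.two_le
      have h2 := hq.2.two_le
      have e1 := hp.2.eq_two_or_odd
      have e2 := hq.2.eq_two_or_odd
      omega
  simpa using h

lemma tail_crude {u w : ℝ} (hu : 8 ≤ u) (h : u ≤ w) : Df w - Df u ≤ 0.455 * Real.exp (-u/2) := by
  set y := Real.exp (u/2) with hy
  have hx : Real.exp u = y^2 := by rw [hy, ← Real.exp_nat_mul]; congr 1; push_cast; ring
  have hy54 : 54 ≤ y := by
    have h1 : Real.exp 4 ≤ y := Real.exp_le_exp.mpr (by linarith)
    refine le_trans ?_ h1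
    have := Real.exp_one_gt_d9
    rw [show (4:ℝ) = ((4:ℕ):ℝ) * 1 by norm_num, Real.exp_nat_mul]
    exact le_trans (by norm_num) (pow_le_pow_left₀ (by norm_num) this.le 4)
  have hyinv : Real.exp (-u/2) = 1 / y := by rw [hy, one_div, ← Real.exp_neg]; congr 1; ring
  set k := ⌊y/6⌋₊ with hk
  have hk1 : (6*k:ℝ) ≤ y := by
    have := Nat.floor_le (show 0 ≤ y/6 by positivity)
    rw [← hk] at this; linarith
  have hk2 : y < 6*k+6 := by
    have := Nat.lt_floor_add_one (y/6)
    rw [← hk] at this; linarith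
  have hk0 : 1 ≤ k := by
    have : (1:ℝ) < k + 1 := by linarith
    have : 1 < k + 1 := by exact_mod_cast this
    omega
  set X := ⌊Real.exp u⌋₊ with hX
  have hXle : (X:ℝ) ≤ Real.exp u := Nat.floor_le (Real.exp_pos u).le
  have hXlt : Real.exp u < X + 1 := Nat.lt_floor_add_one _
  let b : ℕ → ℕ := fun p ↦ if p < 6*k then max 2 (Nat.log p X + 1) else 2
  have hb : ∀ p, 2 ≤ b p := by
    intro p; simp only [b]; split_ifs
    · exact le_max_left _ _
    · exact le_rfl
  have hbu : ∀ p : ℕ, p.Prime → ∀ k, 2 ≤ k → Real.exp u < (p:ℝ)^k → b p ≤ k := by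
    intro p hp j hj hlt
    simp only [b]; split_ifs
    · refine max_le hj ?_
      have : X < p^j := by exact_mod_cast hXle.trans_lt hlt
      have hX0 : X ≠ 0 := by
        rw [hX, ← Nat.pos_iff_ne_zero, Nat.floor_pos, hx]; nlinarith
      exact Nat.log_lt_of_lt_pow hX0 this
    · exact hj
  refine (tail_le h b hb hbu).trans ((primes_tail hk0 _ b (fun p hp ↦ ?_)).trans ?_)
  · simp only [b]; rw [if_neg (by omega)]
  have hG : ∀ p ∈ (Finset.range (6*k)).filter Nat.Prime, Gb (b p) p ≤ 1/2/y^2 + if p = 2 then 1/6/y^2 else 0 := by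
    intro p hp
    rw [Finset.mem_filter, Finset.mem_range] at hp
    obtain ⟨hp1, hp2⟩ := hp
    have hp1r : (p:ℝ) ≤ 6*k := by exact_mod_cast hp1.le
    have hp2r : (2:ℝ) ≤ p := by exact_mod_cast hp2.two_le
    have hpX : p^2 ≤ X := by
      rw [hX]; apply Nat.le_floor; push_cast; rw [hx]
      exact pow_le_pow_left₀ (by positivity) (hp1r.trans hk1) 2
    have hlog : 2 ≤ Nat.log p X := Nat.le_log_of_pow_le hp2.one_lt hpX
    have hbp : b p = Nat.log p X + 1 := by
      simp only [b]; rw [if_pos hp1, max_eq_right (by omega)]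
    have hpow : y^2 ≤ (p:ℝ)^(Nat.log p X + 1) := by
      have : X + 1 ≤ p^(Nat.log p X + 1) := Nat.lt_pow_succ_log_self hp2.one_lt X
      have h2 : ((X:ℝ)+1) ≤ (p:ℝ)^(Nat.log p X + 1) := by exact_mod_cast this
      rw [← hx]; linarith
    have hb3 : (3:ℝ) ≤ (Nat.log p X + 1 : ℕ) := by exact_mod_cast (show 3 ≤ Nat.log p X + 1 by omega)
    have hp10 : (0:ℝ) < p - 1 := by linarith
    have e : Gb (b p) p = (p:ℝ)/(p-1) / ((Nat.log p X + 1 : ℕ) * (p:ℝ)^(Nat.log p X + 1)) := by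
      rw [hbp, Gb, Nat.add_sub_cancel, pow_succ]
      field_simp
    have h1 : Gb (b p) p ≤ (p:ℝ)/(p-1) / (3 * y^2) := by
      rw [e]; gcongr
    refine h1.trans ?_
    split_ifs with hc
    · subst hc; apply le_of_eq; push_cast; field_simp; norm_num
    · have hp3 : (3:ℝ) ≤ p := by exact_mod_cast (show 3 ≤ p by have := hp2.two_le; omega)
      have : (p:ℝ)/(p-1) ≤ 3/2 := by
        rw [div_le_div_iff₀ hp10 (by norm_num)]; linarith
      rw [add_zero]
      calc (p:ℝ)/(p-1) / (3 * y^2) ≤ 3/2/(3*y^2) := by gcongr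
        _ = _ := by field_simp
  have hS := Finset.sum_le_sum hG
  rw [Finset.sum_add_distrib, Finset.sum_const, nsmul_eq_mul, Finset.sum_ite_eq'] at hS
  have hcard : (((Finset.range (6*k)).filter Nat.Prime).card : ℝ) ≤ 3*k := by exact_mod_cast card_primes_le k
  have hif : (if 2 ∈ (Finset.range (6*k)).filter Nat.Prime then 1/6/y^2 else 0) ≤ 1/6/y^2 := by
    split_ifs
    · exact le_rfl
    · positivity
  have h3 : ∑ p ∈ (Finset.range (6*k)).filter Nat.Prime, Gb (b p) p ≤ y/2 * (1/2/y^2) + 1/6/y^2 := by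
    refine hS.trans (add_le_add ?_ hif)
    gcongr
    linarith
  have h4 : 1/(6*(6*(k:ℝ)-1)) ≤ 1/(6*(y-7)) := by
    apply one_div_le_one_div_of_le
    · linarith
    · linarith
  have h5 : y/2 * (1/2/y^2) + 1/6/y^2 + 1/(6*(y-7)) ≤ 0.455 * (1/y) := by
    have e1 : y/2 * (1/2/y^2) + 1/6/y^2 = (0.25 + 1/6/y)*(1/y) := by field_simp; ring
    have e2 : 1/6/y ≤ 1/6/54 := by gcongr
    have e3 : 1/(6*(y-7)) ≤ 0.2 * (1/y) := by
      rw [mul_one_div, div_le_div_iff₀ (by linarith) (by linarith)]; linarith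
    rw [e1]
    have : 0 < 1/y := by positivity
    nlinarith
  rw [hyinv]
  linarith

end

section
open Filter

def Ut : List ℕ := [0, 0, 693147181, 1098612289, 1386294362, 1609437913, 1791759470, 1945910495, 2079441543, 2197224578, 2302585094, 2397950130, 2484906651, 2564983602, 2639057676, 2708050202, 2772588724, 2833228902, 2890371759, 2944450224, 2995732275, 3044522784, 3091097311, 3135500641, 3178053832, 3218875826, 3258130783, 3295836867, 3332204857, 3367299078, 3401197383, 3433989874, 3465735905, 3496562419, 3526376083, 3555348408, 3583518940, 3610930739, 3637597405, 3663595891, 3688879456, 3713573580, 3737669965, 3761255987, 3784244492, 3806662491, 3828647822, 3850148382, 3871201013, 3891820990, 3912023007, 3931841191, 3951277964, 3970292460, 3988984048, 4007388043, 4025352038, 4043062513, 4060446259, 4077537842, 4094344564, 4110876893, 4127137055, 4143135073, 4158883086, 4174421515, 4189709600, 4204708450, 4219523264, 4234112930, 4248495589, 4262680108, 4276666121, 4290472478, 4304077920, 4317488115, 4330744586, 4343860625, 4356743072, 4369448021, 4382026637, 4394449156, 4406720761, 4418841099, 4430817146, 4442666815, 4454403168, 4465911367, 4477391673, 4488636488,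 4499809672, 4510894097, 4521795003, 4532602163, 4543295563, 4553888137, 4564348194, 4574711761, 4584968171, 4595174708, 4605170188, 4615136156, 4624988372, 4634763310, 4644425145, 4653960697, 4663439641, 4672828904, 4682131229, 4691402804, 4700535224, 4709543028, 4718499219, 4727399122, 4736209694, 4744938554, 4753593440, 4762208180, 4770685023, 4779139397, 4787491745, 4795900260, 4804024074, 4812185869, 4820284236, 4828313739, 4836282254, 4844187130, 4852030267, 4859868276, 4867568696, 4875252219, 4882856781, 4890360719, 4897855631, 4905274780, 4912670445, 4919987384, 4927260111, 4934474312, 4941642770, 4948760671, 4955827289, 4962933732, 4969813302, 4976736991, 4983619659, 4990433279, 4997225101, 5003946333, 5010635296, 5017291107, 5023891767, 5030453480, 5037007806, 5043427787, 5049890253, 5056245996, 5062595202, 5068904749, 5075173818, 5081411136, 5087596337, 5093751735]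
def Lt : List ℕ := [0, 0, 693147180, 1098612288, 1386294360, 1609437912, 1791759468, 1945909781, 2079441540, 2197224576, 2302585092, 2397823187, 2484906648, 2564906648, 2639056961, 2708050200, 2772588720, 2833194780, 2890371756, 2944425810, 2995732272, 3044522069, 3090970367, 3135414811, 3178053828, 3218875824, 3258053828, 3295836864, 3332204141, 3367291860, 3401197380, 3433984265, 3465735900, 3496435475, 3526341960, 3555347693, 3583518936, 3610916196, 3637572990, 3663518936, 3688879452, 3713570810, 3737669249, 3761198660, 3784117547, 3806662488, 3828561991, 3850067367, 3871201008, 3891819562, 3912023004, 3931807068, 3951201008, 3970248627, 3988984044, 4007261099, 4025351321, 4043038098, 4060439040, 4077533057, 4094344560, 4110873485, 4127131445, 4143134357, 4158883080, 4174344560, 4189582655, 4204620248, 4219489140, 4234027099, 4248494873, 4262679270, 4276666116, 4290459219, 4304063376, 4317488112, 4330720170, 4343732968, 4356666116, 4369404969, 4382026632, 4394449152, 4406717990, 4418839202, 4430816429, 4442632692, 4454345840, 4465904148, 4477264727, 4488564162, 4499809668, 4510816429, 4521709171, 4532596553, 4543214547, 4553863722, 4564348188, 4574710882, 4584966742, 4595047763,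 4605170184, 4615120432, 4624954248, 4634710345, 4644348188, 4653959981, 4663395807, 4672785478, 4682131224, 4691347813, 4700408279, 4709528484, 4718498501, 4727387389, 4736185278, 4744852723, 4753586220, 4762131224, 4770680237, 4779104561, 4787491740, 4795646374, 4804020665, 4812183098, 4820278625, 4828313736, 4836281537, 4844186675, 4852030260, 4859810948, 4867491740, 4875154575, 4882729835, 4890335591, 4897767428, 4905274776, 4912636320, 4919962327, 4927174279, 4934394495, 4941642053, 4948679655, 4955826450, 4962729835, 4969813296, 4976729772, 4983606399, 4990431850, 4997210556, 5003944562, 5010635292, 5017279810, 5023867350, 5030419356, 5036880148, 5043422177, 5049813296, 5056203072, 5062552149, 5068860915, 5075173812, 5081324592, 5087596332, 5093750178]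
def Uf (n : ℕ) : ℕ := Ut.getD n 0
def Lf (n : ℕ) : ℕ := Lt.getD n 0

lemma log_succ_lb {n : ℝ} (hn : 0 < n) : Real.log n + 2 / (2*n+1) ≤ Real.log (n+1) := by
  have h := Real.le_log_one_add_of_nonneg (x := 1/n) (by positivity)
  have e : 1 + 1/n = (n+1)/n := by field_simp
  rw [e, Real.log_div (by positivity) (by positivity)] at h
  have e2 : 2 * (1/n) / (1/n + 2) = 2/(2*n+1) := by field_simp; ring
  rw [e2] at h
  linarith

lemma nat_div_le (D : ℕ) (hD : 0 < D) : ((2*10^9/D : ℕ):ℝ)/10^9 ≤ 2 / D := by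
  have h : ((2*10^9/D : ℕ):ℝ) ≤ ((2*10^9 : ℕ):ℝ) / D := Nat.cast_div_le
  have hD' : (0:ℝ) < D := by exact_mod_cast hD
  rw [div_le_iff₀ (by positivity)]
  refine h.trans (le_of_eq ?_)
  push_cast; ring

lemma Uf_check : ∀ n < 164, n < 2 ∨ n = 2 ∨ n = 3 ∨ n = 5 ∨ n = 7 ∨
    (∃ a < n, 2 ≤ a ∧ a ∣ n ∧ Uf a + Uf (n/a) ≤ Uf n) ∨
    (∃ a < n, 2 ≤ a ∧ n/2 < n ∧ 3 ≤ n ∧ a ∣ n+1 ∧ (n+1)/a < n ∧ Uf a + Uf ((n+1)/a) ≤ Uf n + 2*10^9/(2*n+1)) := by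
  decide +kernel

lemma Lf_check : ∀ n < 164, n < 2 ∨ n = 2 ∨ n = 3 ∨ n = 5 ∨ n = 7 ∨
    (∃ a < n, 2 ≤ a ∧ a ∣ n ∧ Lf n ≤ Lf a + Lf (n/a)) ∨
    (∃ a < n, 2 ≤ a ∧ 3 ≤ n ∧ a ∣ n-1 ∧ Lf n ≤ Lf a + Lf ((n-1)/a) + 2*10^9/(2*n-1)) := by
  decide +kernel

lemma log_seven : Real.log 7 ≤ 1945910495/10^9 ∧ 1945909781/10^9 ≤ Real.log 7 := by
  have h2 := Real.log_two_lt_d9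
  have h2' := Real.log_two_gt_d9
  have h5 := Real.log_five_lt_d9
  have h3 := Real.log_three_gt_d9
  have a := log_succ_lb (n := 49) (by norm_num)
  have b := log_succ_lb (n := 48) (by norm_num)
  have e1 : Real.log 49 = 2 * Real.log 7 := by
    rw [show (49:ℝ) = 7^2 by norm_num, Real.log_pow]; norm_num
  have e2 : Real.log (49+1) = 2 * Real.log 5 + Real.log 2 := by
    rw [show (49+1:ℝ) = 5^2*2 by norm_num, Real.log_mul (by norm_num) (by norm_num), Real.log_pow]; norm_num
  have e3 : Real.log 48 = 4 * Real.log 2 + Real.log 3 := by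
    rw [show (48:ℝ) = 2^4*3 by norm_num, Real.log_mul (by norm_num) (by norm_num), Real.log_pow]; norm_num
  rw [e1, e2] at a
  rw [show (48+1:ℝ) = 49 by norm_num, e1, e3] at b
  constructor
  · norm_num at a ⊢; linarith
  · norm_num at b ⊢; linarith

lemma log_le_Uf : ∀ n : ℕ, n < 164 → Real.log n ≤ (Uf n : ℝ) / 10^9 := by
  intro n
  induction n using Nat.strong_induction_on with
  | _ n ih =>
  intro hn
  rcases Uf_check n hn with h | h | h | h | h | ⟨a, ha, ha2, hd, hU⟩ | ⟨a, ha, ha2, -, h3, hd, hlt, hU⟩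
  · have : Real.log n = 0 := by interval_cases n <;> simp
    rw [this]; positivity
  · subst h
    have : Uf 2 = 693147181 := by decide +kernel
    rw [this]; push_cast; linarith [Real.log_two_lt_d9]
  · subst h
    have : Uf 3 = 1098612289 := by decide +kernel
    rw [this]; push_cast; linarith [Real.log_three_lt_d9]
  · subst h
    have : Uf 5 = 1609437913 := by decide +kernel
    rw [this]; push_cast; linarith [Real.log_five_lt_d9]
  · subst h
    have : Uf 7 = 1945910495 := by decide +kernel
    rw [this]; push_cast; linarith [log_seven.1]
  · obtain ⟨b, rfl⟩ := hd
    have hb0 : b ≠ 0 := by rintro rfl; simp at ha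
    have hb : b < a * b := by nlinarith [Nat.pos_of_ne_zero hb0]
    rw [Nat.mul_div_cancel_left _ (by omega)] at hU
    have h1 := ih a ha (by omega)
    have h2 := ih b hb (by omega)
    push_cast
    rw [Real.log_mul (by positivity) (by exact_mod_cast hb0)]
    have : ((Uf a + Uf b : ℕ):ℝ) ≤ Uf (a*b) := by exact_mod_cast hU
    push_cast at this
    linarith
  · obtain ⟨b, hb⟩ := hd
    rw [hb, Nat.mul_div_cancel_left _ (by omega)] at hU hlt
    have hb0 : b ≠ 0 := by rintro rfl; simp at hb
    have h1 := ih a ha (by omega)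
    have h2 := ih b hlt (by omega)
    have h4 := log_succ_lb (n := n) (by positivity)
    have e : (n:ℝ) + 1 = a * b := by exact_mod_cast hb
    rw [e, Real.log_mul (by positivity) (by exact_mod_cast hb0)] at h4
    have h5 := nat_div_le (2*n+1) (by omega)
    have : ((Uf a + Uf b : ℕ):ℝ) ≤ (Uf n + 2*10^9/(2*n+1) : ℕ) := by exact_mod_cast hU
    rw [Nat.cast_add, Nat.cast_add] at this
    push_cast at h5 h4
    push_cast at this
    linarith

lemma Lf_le_log : ∀ n : ℕ, n < 164 → (Lf n:ℝ) / 10^9 ≤ Real.log n := by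
  intro n
  induction n using Nat.strong_induction_on with
  | _ n ih =>
  intro hn
  rcases Lf_check n hn with h | h | h | h | h | ⟨a, ha, ha2, hd, hU⟩ | ⟨a, ha, ha2, h3, hd, hU⟩
  · have h0 : Lf 0 = 0 := by decide +kernel
    have h1 : Lf 1 = 0 := by decide +kernel
    interval_cases n
    · rw [h0]; simp
    · rw [h1]; simp
  · subst h
    have : Lf 2 = 693147180 := by decide +kernel
    rw [this]; push_cast; linarith [Real.log_two_gt_d9]
  · subst h
    have : Lf 3 = 1098612288 := by decide +kernel
    rw [this]; push_cast; linarith [Real.log_three_gt_d9]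
  · subst h
    have : Lf 5 = 1609437912 := by decide +kernel
    rw [this]; push_cast; linarith [Real.log_five_gt_d9]
  · subst h
    have : Lf 7 = 1945909781 := by decide +kernel
    rw [this]; push_cast; linarith [log_seven.2]
  · obtain ⟨b, rfl⟩ := hd
    have hb0 : b ≠ 0 := by rintro rfl; simp at ha
    have hb : b < a * b := by nlinarith [Nat.pos_of_ne_zero hb0]
    rw [Nat.mul_div_cancel_left _ (by omega)] at hU
    have h1 := ih a ha (by omega)
    have h2 := ih b hb (by omega)
    push_cast
    rw [Real.log_mul (by positivity) (by exact_mod_cast hb0)]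
    have : (Lf (a*b):ℝ) ≤ ((Lf a + Lf b : ℕ):ℝ) := by exact_mod_cast hU
    push_cast at this
    linarith
  · obtain ⟨b, hb⟩ := hd
    rw [hb, Nat.mul_div_cancel_left _ (by omega)] at hU
    have hb0 : b ≠ 0 := by rintro rfl; omega
    have hbn : b < n := by nlinarith [Nat.pos_of_ne_zero hb0, Nat.sub_add_cancel (show 1 ≤ n by omega)]
    have h1 := ih a ha (by omega)
    have h2 := ih b hbn (by omega)
    obtain ⟨m, rfl⟩ : ∃ m, n = m + 1 := ⟨n - 1, by omega⟩
    rw [Nat.add_sub_cancel] at hb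
    have h4 := log_succ_lb (n := m) (by have : 0 < m := by omega
                                        exact_mod_cast this)
    have e : (m:ℝ) = a * b := by exact_mod_cast hb
    have e' : Real.log (m:ℝ) = Real.log a + Real.log b := by
      rw [e, Real.log_mul (by positivity) (by exact_mod_cast hb0)]
    rw [e'] at h4
    rw [show 2*(m+1)-1 = 2*m+1 by omega] at hU
    have h5 := nat_div_le (2*m+1) (by omega)
    have : (Lf (m+1):ℝ) ≤ (Lf a + Lf b + 2*10^9/(2*m+1) : ℕ) := by exact_mod_cast hU
    rw [Nat.cast_add, Nat.cast_add] at this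
    push_cast at h5 h4
    push_cast at this
    push_cast
    linarith

end

section
open Filter

lemma gamma_ub : Real.eulerMascheroniConstant ≤ 0.577243 := by
  have hanti : Antitone (fun n : ℕ ↦ (harmonic n : ℝ) - Real.log (n + 1/2)) := by
    refine antitone_nat_of_succ_le (fun n ↦ ?_)
    have h := log_succ_lb (n := n + 1/2) (by positivity)
    rw [harmonic_succ]
    push_cast
    have e : 2 / (2*((n:ℝ)+1/2)+1) = ((n:ℝ)+1)⁻¹ := by field_simp; ring
    rw [e] at h
    rw [show (n:ℝ)+1+1/2 = n+1/2+1 by ring]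
    linarith
  have hlim : Tendsto (fun n : ℕ ↦ (harmonic n : ℝ) - Real.log (n + 1/2)) atTop
      (nhds Real.eulerMascheroniConstant) := by
    refine tendsto_of_tendsto_of_tendsto_of_le_of_le' Real.tendsto_eulerMascheroniSeq
      Real.tendsto_eulerMascheroniSeq' (Eventually.of_forall fun n ↦ ?_) ?_
    · rw [Real.eulerMascheroniSeq]
      have : Real.log ((n:ℝ)+1/2) ≤ Real.log (n+1) := Real.log_le_log (by positivity) (by linarith)
      linarith
    · filter_upwards [eventually_ge_atTop 1] with n hn
      rw [Real.eulerMascheroniSeq', if_neg (by omega)]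
      have hn' : (1:ℝ) ≤ n := by exact_mod_cast hn
      have : Real.log n ≤ Real.log ((n:ℝ)+1/2) := Real.log_le_log (by positivity) (by linarith)
      linarith
  have h := hanti.le_of_tendsto hlim 40
  refine h.trans ?_
  have e : Real.log (((40:ℕ):ℝ) + 1/2) = 4 * Real.log 3 - Real.log 2 := by
    rw [show (((40:ℕ):ℝ) + 1/2) = 3^4/2 by norm_num, Real.log_div (by norm_num) (by norm_num), Real.log_pow]
    norm_num
  have hH : harmonic 40 ≤ 4.278543040 := by
    rw [harmonic]; simp only [Finset.sum_range_succ, Finset.sum_range_zero]; norm_num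
  have hH' : (harmonic 40 : ℝ) ≤ 4.278543040 := by
    have : ((harmonic 40 : ℚ):ℝ) ≤ ((4.278543040 : ℚ) : ℝ) := by exact_mod_cast hH
    refine this.trans (by norm_num)
  simp only [e]
  linarith [Real.log_two_lt_d9, Real.log_three_gt_d9]

lemma M0_le : M0 ≤ 0.0463 := by
  have h := Real.le_log_one_add_of_nonneg (x := 0.047197) (by norm_num)
  have h2 : Real.log (3 * (1+0.047197)) ≤ Real.log Real.pi :=
    Real.log_le_log (by norm_num) (by linarith [Real.pi_gt_d6])
  rw [Real.log_mul (by norm_num) (by norm_num)] at h2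
  have e : Real.log (4 * Real.pi) = 2 * Real.log 2 + Real.log Real.pi := by
    rw [Real.log_mul (by norm_num) Real.pi_pos.ne', show (4:ℝ) = 2^2 by norm_num, Real.log_pow]; norm_num
  rw [M0, e]
  norm_num at h
  norm_num at h2
  have := gamma_ub
  linarith [Real.log_two_gt_d9, Real.log_three_gt_d9]

/-- prime powers below 149 as (p,k) -/
def ppl : List (ℕ × ℕ) :=
  [(2,1),(2,2),(2,3),(2,4),(2,5),(2,6),(2,7),(3,1),(3,2),(3,3),(3,4),(5,1),(5,2),(5,3),(7,1),(7,2),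
   (11,1),(11,2)] ++ ([13, 17, 19, 23, 29, 31, 37, 41, 43, 47, 53, 59, 61, 67, 71, 73, 79, 83, 89, 97, 101, 103,
   107, 109, 113, 127, 131, 137, 139].map (fun p ↦ ((p, 1) : ℕ × ℕ)))

lemma vm_le {n : ℕ} (hn : n < 149) : ArithmeticFunction.vonMangoldt n / n ≤
    (ppl.map (fun a ↦ if a.1^a.2 = n then ((Uf a.1 / n + 1 : ℕ) : ℝ) / 10^9 else 0)).sum := by
  have hnn : 0 ≤ (ppl.map (fun a ↦ if a.1^a.2 = n then ((Uf a.1 / n + 1 : ℕ) : ℝ) / 10^9 else 0)).sum := by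
    refine List.sum_nonneg (fun x hx ↦ ?_)
    obtain ⟨a, -, rfl⟩ := List.mem_map.mp hx
    split_ifs <;> positivity
  by_cases hpp : IsPrimePow n
  · obtain ⟨p, k, hp, hk, rfl⟩ := hpp
    rw [← Nat.prime_iff] at hp
    have hp2 := hp.two_le
    have hple : p ≤ p^k := Nat.le_self_pow hk.ne' p
    have hmem : (p, k) ∈ ppl := by
      have hk8 : k < 8 := by
        by_contra h
        have h1 : 2^8 ≤ 2^k := Nat.pow_le_pow_right (by norm_num) (by omega)
        have h2 : 2^k ≤ p^k := Nat.pow_le_pow_left hp2 k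
        omega
      have hd : ∀ q < 149, q ∉ plist ∨ ∀ j < 8, j = 0 ∨ 149 ≤ q^j ∨ (q,j) ∈ ppl := by decide +kernel
      rcases hd p (by omega) with h | h
      · exact absurd (mem_plist hp (by omega)) h
      · rcases h k hk8 with h | h | h
        · omega
        · omega
        · exact h
    rw [ArithmeticFunction.vonMangoldt_apply_pow hk.ne', ArithmeticFunction.vonMangoldt_apply_prime hp]
    have h1 : Real.log p / ((p^k : ℕ):ℝ) ≤ ((Uf p / p^k + 1 : ℕ) : ℝ) / 10^9 := by
      have hlog := log_le_Uf p (by omega)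
      have hpos : 0 < p^k := by positivity
      have h3 : Uf p < p^k * (Uf p / p^k + 1) := Nat.lt_mul_div_succ _ hpos
      have h4 : (Uf p : ℝ) ≤ ((p^k : ℕ):ℝ) * ((Uf p / p^k + 1 : ℕ) : ℝ) := by exact_mod_cast h3.le
      have hr : (0:ℝ) < ((p^k : ℕ):ℝ) := by exact_mod_cast hpos
      rw [div_le_div_iff₀ hr (by norm_num)]
      rw [le_div_iff₀ (by norm_num)] at hlog
      linarith
    refine h1.trans ?_
    refine List.single_le_sum (fun x hx ↦ ?_) _ (List.mem_map.mpr ⟨(p,k), hmem, by simp⟩)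
    obtain ⟨a, -, rfl⟩ := List.mem_map.mp hx
    split_ifs <;> positivity
  · rw [ArithmeticFunction.vonMangoldt_eq_zero_iff.mpr hpp]
    simpa using hnn

lemma psi1_148 : ∑ n ∈ Finset.range 149, ArithmeticFunction.vonMangoldt n / n ≤ 4.389756 := by
  refine (Finset.sum_le_sum (fun n hn ↦ vm_le (Finset.mem_range.mp hn))).trans ?_
  have hsw : ∀ l : List (ℕ × ℕ), ∑ n ∈ Finset.range 149,
      (l.map (fun a ↦ if a.1^a.2 = n then ((Uf a.1 / n + 1 : ℕ) : ℝ) / 10^9 else 0)).sum ≤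
      (((l.map (fun a ↦ Uf a.1 / a.1^a.2 + 1)).sum : ℕ) : ℝ) / 10^9 := by
    intro l
    induction l with
    | nil => simp
    | cons a l ih =>
      simp only [List.map_cons, List.sum_cons]
      rw [Finset.sum_add_distrib, Finset.sum_ite_eq, Nat.cast_add (Uf a.1 / a.1^a.2 + 1), add_div]
      refine add_le_add ?_ ih
      split_ifs
      · exact le_rfl
      · positivity
  refine (hsw ppl).trans ?_
  have h : (ppl.map (fun a ↦ Uf a.1 / a.1^a.2 + 1)).sum ≤ 4389756000 := by decide +kernel
  have h' : (((ppl.map (fun a ↦ Uf a.1 / a.1^a.2 + 1)).sum : ℕ) : ℝ) ≤ 4389756000 := by exact_mod_cast h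
  rw [div_le_iff₀ (by norm_num)]
  refine h'.trans (by norm_num)

lemma floor_exp5 : ⌊Real.exp 5⌋₊ = 148 := by
  rw [Nat.floor_eq_iff (Real.exp_pos _).le]
  refine ⟨by exact_mod_cast exp5, ?_⟩
  have : Real.exp 5 = Real.exp 1 ^ 5 := by rw [← Real.exp_nat_mul]; norm_num
  rw [this]
  refine (pow_lt_pow_left₀ Real.exp_one_lt_d9 (Real.exp_pos _).le (by norm_num)).trans (by norm_num)

lemma Rf5 : Rf 5 ≤ -0.033001 := by
  rw [Rf, psi1, floor_exp5]
  linarith [psi1_148, gamma_ub]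
/-- sums of reciprocals of primes in 1e-9 units, from above and below -/
def PU (n : ℕ) : ℕ := ((plist.filter (· ≤ n)).map (fun p ↦ 10^9/p+1)).sum
def PL (n : ℕ) : ℕ := ((plist.filter (· ≤ n)).map (fun p ↦ 10^9/p)).sum

lemma plist_prime : ∀ p ∈ plist, p.Prime := by
  have h : ∀ p ∈ plist, 2 ≤ p ∧ ∀ m < p, 2 ≤ m → ¬ m ∣ p := by decide +kernel
  intro p hp
  exact Nat.prime_def_lt'.mpr ⟨(h p hp).1, fun m h2 hm ↦ (h p hp).2 m hm h2⟩

lemma filt_eq {n : ℕ} (hn : n < 402) :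
    (Finset.range (n+1)).filter Nat.Prime = (plist.filter (· ≤ n)).toFinset := by
  ext p
  simp only [Finset.mem_filter, Finset.mem_range, List.mem_toFinset, List.mem_filter, decide_eq_true_eq]
  constructor
  · rintro ⟨h1, h2⟩; exact ⟨mem_plist h2 (by omega), by omega⟩
  · rintro ⟨h1, h2⟩; exact ⟨by omega, plist_prime p h1⟩

lemma P_sum_eq {n : ℕ} (hn : n < 402) : ∑ p ∈ (Finset.range (n+1)).filter Nat.Prime, (1:ℝ)/p =
    ((plist.filter (· ≤ n)).map (fun p : ℕ ↦ (1:ℝ)/p)).sum := by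
  rw [filt_eq hn, List.sum_toFinset]
  exact List.Nodup.filter _ (by decide +kernel)

lemma P_le {n : ℕ} (hn : n < 402) : ∑ p ∈ (Finset.range (n+1)).filter Nat.Prime, (1:ℝ)/p ≤ PU n / 10^9 := by
  rw [P_sum_eq hn, PU]
  have : ∀ l : List ℕ, (∀ p ∈ l, p.Prime) → (l.map (fun p : ℕ ↦ (1:ℝ)/p)).sum ≤
      (((l.map (fun p ↦ 10^9/p+1)).sum : ℕ):ℝ)/10^9 := by
    intro l
    induction l with
    | nil => simp
    | cons p l ih =>
      intro h
      simp only [List.map_cons, List.sum_cons, Nat.cast_add (R := ℝ) (10^9/p+1), add_div]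
      refine add_le_add ?_ (ih fun q hq ↦ h q (List.mem_cons_of_mem _ hq))
      have hp := (h p List.mem_cons_self).pos
      have h3 : 10^9 < p * (10^9/p+1) := Nat.lt_mul_div_succ _ hp
      have h4 : (10:ℝ)^9 ≤ p * ((10^9/p+1 : ℕ):ℝ) := by exact_mod_cast h3.le
      have hp' : (0:ℝ) < p := by exact_mod_cast hp
      rw [div_le_div_iff₀ hp' (by norm_num)]
      linarith
  exact this _ fun p hp ↦ plist_prime p (List.mem_filter.mp hp).1

lemma P_ge {n : ℕ} (hn : n < 402) : (PL n : ℝ) / 10^9 ≤ ∑ p ∈ (Finset.range (n+1)).filter Nat.Prime, (1:ℝ)/p := by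
  rw [P_sum_eq hn, PL]
  have : ∀ l : List ℕ, (∀ p ∈ l, p.Prime) → 
      (((l.map (fun p ↦ 10^9/p)).sum : ℕ):ℝ)/10^9 ≤ (l.map (fun p : ℕ ↦ (1:ℝ)/p)).sum := by
    intro l
    induction l with
    | nil => simp
    | cons p l ih =>
      intro h
      simp only [List.map_cons, List.sum_cons, Nat.cast_add (R := ℝ) (10^9/p), add_div]
      refine add_le_add ?_ (ih fun q hq ↦ h q (List.mem_cons_of_mem _ hq))
      have hp := (h p List.mem_cons_self).pos
      have h4 : ((10^9/p : ℕ):ℝ) ≤ ((10^9:ℕ):ℝ)/p := Nat.cast_div_le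
      have hp' : (0:ℝ) < p := by exact_mod_cast hp
      rw [div_le_iff₀ (by norm_num)]
      refine h4.trans (le_of_eq ?_)
      push_cast; ring
  exact this _ fun p hp ↦ plist_prime p (List.mem_filter.mp hp).1

lemma B_lo (hRH : RiemannHypothesis) {B : ℝ}
    (hB : Tendsto (fun w ↦ Pp w - Real.log w) atTop (nhds B)) : 0.26049 ≤ B := by
  have h := (E_bounds hRH hB (u := 5) (by norm_num)).2 0.016155 (fun w hw ↦ tail5 le_rfl hw)
  have hP : 1.879797 ≤ Pp 5 := by
    rw [Pp, floor_exp5]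
    refine le_trans ?_ (P_ge (by norm_num))
    have h : 1879797000 ≤ PL 148 := by decide +kernel
    have h' : (1879797000:ℝ) ≤ PL 148 := by exact_mod_cast h
    rw [le_div_iff₀ (by norm_num)]
    refine le_trans (by norm_num) h'
  have hs : Real.exp (-5/2) ≤ 0.0822 := by
    have h1 : Real.exp (-5/2) ^ 2 = (Real.exp 5)⁻¹ := by
      rw [← Real.exp_nat_mul, ← Real.exp_neg]; norm_num
    have h2 : (Real.exp 5)⁻¹ ≤ 148⁻¹ := inv_anti₀ (by norm_num) exp5
    nlinarith [Real.exp_pos (-5/2)]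
  have hs3 : Real.exp (-3*5) ≤ 0.00000001 + 0.0000004 := by
    have h1 : Real.exp (-3*5) = ((Real.exp 5)⁻¹)^3 := by
      rw [← Real.exp_neg, ← Real.exp_nat_mul]; norm_num
    have h2 : (Real.exp 5)⁻¹ ≤ 148⁻¹ := inv_anti₀ (by norm_num) exp5
    rw [h1]
    refine (pow_le_pow_left₀ (by positivity) h2 3).trans (by norm_num)
  have hM := M0_le
  have hMM : M0 * Real.exp (-5/2) ≤ 0.0463 * 0.0822 :=
    mul_le_mul hM hs (Real.exp_pos _).le (by norm_num)
  have h5 := Real.log_five_lt_d9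
  have hR := Rf5
  norm_num at h hMM hs3 ⊢
  linarith

end

section
open Filter

lemma f_mono {v u : ℝ} (hv : 3 ≤ v) (hvu : v ≤ u) (hu : u ≤ 5) :
    Real.log v + 0.11936 * (v * Real.exp (-v/2)) ≤ Real.log u + 0.11936 * (u * Real.exp (-u/2)) := by
  have hu0 : 0 < u := by linarith
  have hv0 : 0 < v := by linarith
  have h1 : (u - v)/u ≤ Real.log u - Real.log v := by
    have := Real.one_sub_inv_le_log_of_pos (div_pos hu0 hv0)
    rw [Real.log_div hu0.ne' hv0.ne', inv_div] at this
    refine le_trans (le_of_eq ?_) this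
    field_simp
  have h2 : (u-v)/5 ≤ (u-v)/u := div_le_div_of_nonneg_left (by linarith) hu0 hu
  set E := Real.exp (-v/2) with hE
  have hE0 : 0 < E := Real.exp_pos _
  have h3 : E * (1 - (u-v)/2) ≤ Real.exp (-u/2) := by
    have : Real.exp (-u/2) = E * Real.exp (-(u-v)/2) := by rw [hE, ← Real.exp_add]; congr 1; ring
    rw [this]
    gcongr
    have := Real.add_one_le_exp (-(u-v)/2)
    linarith
  have h4 : v * E ≤ 1 := by
    have h5 : v ≤ Real.exp (v/2) := by
      have h6 := Real.add_one_le_exp (v/4)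
      have h7 : Real.exp (v/2) = Real.exp (v/4) ^ 2 := by rw [← Real.exp_nat_mul]; congr 1; push_cast; ring
      rw [h7]
      have h8 : (v/4+1)^2 ≤ Real.exp (v/4)^2 := pow_le_pow_left₀ (by positivity) h6 2
      nlinarith [sq_nonneg (v/4-1)]
    calc v * E ≤ Real.exp (v/2) * E := by gcongr
      _ = 1 := by rw [hE, ← Real.exp_add]; ring_nf; simp
  have h5 : v * E - u * Real.exp (-u/2) ≤ (u-v)/2 := by
    have : v * (E * (1 - (u-v)/2)) ≤ u * Real.exp (-u/2) :=
      (mul_le_mul_of_nonneg_left h3 hv0.le).trans (mul_le_mul_of_nonneg_right hvu (Real.exp_pos _).le)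
    nlinarith
  linarith

lemma cell {B u : ℝ} (hB : 0.26049 ≤ B) (hu : u ≤ 5) (C D N a b S : ℕ)
    (hc : C < 164 ∧ D < 164 ∧ 0 < D ∧ N < 402 ∧ a < 164 ∧ b < 164 ∧ 0 < b ∧ 0 < S ∧ 3 * b ≤ a ∧
      C * 10^6 ≤ S^2 * D ∧ 0 < C ∧ a * 10^9 + b * Uf D ≤ b * Lf C ∧
      PU N + Uf b ≤ Lf a + 260490000 + 119360000000*a/(b*S))
    (h1 : (C:ℝ)/D ≤ Real.exp u) (h2 : Real.exp u < N + 1) :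
    Pp u - Real.log u - B ≤ 0.11936 * (u * Real.exp (-u/2)) := by
  obtain ⟨hC, hD, hD0, hN, ha, hb, hb0, hS0, hab, hS, hC0, hl, hfin⟩ := hc
  have rD : (0:ℝ) < D := by exact_mod_cast hD0
  have rC : (0:ℝ) < C := by exact_mod_cast hC0
  have rb : (0:ℝ) < b := by exact_mod_cast hb0
  have rS : (0:ℝ) < S := by exact_mod_cast hS0
  set v := Real.log ((C:ℝ)/D) with hv
  have hev : Real.exp v = C/D := Real.exp_log (by positivity)
  have hvu : v ≤ u := by rw [← Real.exp_le_exp, hev]; exact h1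
  have hva : (a:ℝ)/b ≤ v := by
    have e1 := Lf_le_log C hC
    have e2 := log_le_Uf D hD
    rw [hv, Real.log_div rC.ne' rD.ne']
    have : (a:ℝ) * 10^9 + b * Uf D ≤ b * Lf C := by exact_mod_cast hl
    rw [div_le_iff₀ rb]
    have e3 : (a:ℝ) ≤ ((Lf C:ℝ)/10^9 - (Uf D:ℝ)/10^9) * b := by
      have : (a:ℝ) * 10^9 ≤ ((Lf C:ℝ) - Uf D) * b := by linarith
      rw [← sub_div, div_mul_eq_mul_div, le_div_iff₀ (by norm_num)]
      exact this
    refine e3.trans ?_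
    gcongr
  have rab : 3 * (b:ℝ) ≤ a := by exact_mod_cast hab
  have ra : (0:ℝ) < a := by linarith
  have h3 : (3:ℝ) ≤ a/b := by rw [le_div_iff₀ rb]; exact rab
  have hv3 : 3 ≤ v := h3.trans hva
  have hlogv : (Lf a : ℝ)/10^9 - (Uf b:ℝ)/10^9 ≤ Real.log v := by
    have e1 := Lf_le_log a ha
    have e2 := log_le_Uf b hb
    have e3 : Real.log ((a:ℝ)/b) ≤ Real.log v := Real.log_le_log (by positivity) hva
    rw [Real.log_div ra.ne' rb.ne'] at e3
    linarith
  have hexp : 1000/(S:ℝ) ≤ Real.exp (-v/2) := by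
    have e1 : Real.exp (v/2) ≤ S/1000 := by
      have e2 : Real.exp (v/2)^2 = C/D := by rw [← Real.exp_nat_mul, ← hev]; congr 1; push_cast; ring
      refine le_of_sq_le_sq ?_ (by positivity)
      rw [e2, div_pow, div_le_div_iff₀ rD (by norm_num)]
      have : (C:ℝ)*10^6 ≤ S^2*D := by exact_mod_cast hS
      linarith
    rw [neg_div, Real.exp_neg, ← inv_div]
    exact inv_anti₀ (Real.exp_pos _) e1
  have hmono := f_mono hv3 hvu hu
  have hmul : (a:ℝ)/b * (1000/S) ≤ v * Real.exp (-v/2) := by gcongr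
  have hP : Pp u ≤ PU N / 10^9 := by
    refine le_trans ?_ (P_le hN)
    rw [Pp]
    refine Finset.sum_le_sum_of_subset_of_nonneg ?_ (fun _ _ _ ↦ by positivity)
    refine Finset.filter_subset_filter _ ?_
    have : ⌊Real.exp u⌋₊ < N + 1 := (Nat.floor_lt (Real.exp_pos u).le).mpr (by exact_mod_cast h2)
    exact Finset.range_subset_range.mpr (by omega)
  have hq : ((119360000000*a/(b*S) : ℕ) : ℝ) ≤ 119360000000 * a/(b*S) := by
    refine Nat.cast_div_le.trans (le_of_eq ?_); push_cast; rfl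
  have hf : ((PU N:ℝ)) + Uf b ≤ Lf a + 260490000 + ((119360000000*a/(b*S) : ℕ):ℝ) := by exact_mod_cast hfin
  have he : 119360000000 * (a:ℝ)/(b*S) = 10^9 * (0.11936 * (a/b * (1000/S))) := by field_simp; norm_num
  rw [he] at hq
  have hf2 : (PU N:ℝ)/10^9 ≤ (Lf a:ℝ)/10^9 - Uf b/10^9 + 0.26049 + 0.11936 * (a/b * (1000/S)) := by
    rw [div_le_iff₀ (by norm_num)]
    have : ((Lf a:ℝ)/10^9 - Uf b/10^9 + 0.26049 + 0.11936 * (a/b * (1000/S))) * 10^9 =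
      Lf a - Uf b + 260490000 + 10^9 * (0.11936 * (a/b * (1000/S))) := by ring
    rw [this]; linarith
  linarith

lemma upper_small {B u : ℝ} (hB : 0.26049 ≤ B) (hu : u ≤ 5) (h1 : 24.4 ≤ Real.exp u) :
    Pp u - Real.log u - B ≤ 0.11936 * (u * Real.exp (-u/2)) := by
  have h149 : Real.exp u < 149 := by
    have h5 : ⌊Real.exp 5⌋₊ < 149 := by rw [floor_exp5]; norm_num
    have := (Nat.floor_lt (Real.exp_pos 5).le).mp h5
    exact (Real.exp_le_exp.mpr hu).trans_lt (by exact_mod_cast this)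
  rcases lt_or_ge (Real.exp u) 29 with h | h
  · exact cell hB hu 122 5 28 115 36 4940 (by decide +kernel) (by norm_num at h1 ⊢; linarith) (by norm_num; linarith)
  rcases lt_or_ge (Real.exp u) 31 with g | g
  · exact cell hB hu 29 1 30 101 30 5386 (by decide +kernel) (by norm_num; linarith) (by norm_num; linarith)
  rcases lt_or_ge (Real.exp u) 37 with h | h
  · exact cell hB hu 31 1 36 103 30 5568 (by decide +kernel) (by norm_num; linarith) (by norm_num; linarith)
  rcases lt_or_ge (Real.exp u) 41 with g | g
  · exact cell hB hu 37 1 40 148 41 6083 (by decide +kernel) (by norm_num; linarith) (by norm_num; linarith)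
  rcases lt_or_ge (Real.exp u) 47 with h | h
  · exact cell hB hu 41 1 46 141 38 6404 (by decide +kernel) (by norm_num; linarith) (by norm_num; linarith)
  rcases lt_or_ge (Real.exp u) 53 with g | g
  · exact cell hB hu 47 1 52 77 20 6856 (by decide +kernel) (by norm_num; linarith) (by norm_num; linarith)
  rcases lt_or_ge (Real.exp u) 61 with h | h
  · exact cell hB hu 53 1 60 131 33 7281 (by decide +kernel) (by norm_num; linarith) (by norm_num; linarith)
  rcases lt_or_ge (Real.exp u) 71 with g | g
  · exact cell hB hu 61 1 70 152 37 7811 (by decide +kernel) (by norm_num; linarith) (by norm_num; linarith)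
  rcases lt_or_ge (Real.exp u) 83 with h | h
  · exact cell hB hu 71 1 82 98 23 8427 (by decide +kernel) (by norm_num; linarith) (by norm_num; linarith)
  rcases lt_or_ge (Real.exp u) 101 with g | g
  · exact cell hB hu 83 1 100 53 12 9111 (by decide +kernel) (by norm_num; linarith) (by norm_num; linarith)
  rcases lt_or_ge (Real.exp u) 113 with h | h
  · exact cell hB hu 101 1 112 143 31 10050 (by decide +kernel) (by norm_num; linarith) (by norm_num; linarith)
  rcases lt_or_ge (Real.exp u) 137 with g | g
  · exact cell hB hu 113 1 136 52 11 10631 (by decide +kernel) (by norm_num; linarith) (by norm_num; linarith)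
  · exact cell hB hu 137 1 148 59 12 11705 (by decide +kernel) (by norm_num; linarith) (by norm_num; linarith)

end

section
open Filter

lemma Q_bd {u : ℝ} (m : ℕ) (h : u ≤ m/4) : Real.exp (u/4) ≤ 1.0644945^m := by
  have h1 : Real.exp (1/16) ≤ 1.0644945 := by
    refine le_of_pow_le_pow_left₀ (n := 16) (by norm_num) (by norm_num) ?_
    rw [← Real.exp_nat_mul]
    norm_num
    linarith [Real.exp_one_lt_d9]
  calc Real.exp (u/4) ≤ Real.exp (m * (1/16)) := Real.exp_le_exp.mpr (by linarith)
    _ = Real.exp (1/16)^m := Real.exp_nat_mul _ _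
    _ ≤ _ := pow_le_pow_left₀ (Real.exp_pos _).le h1 m

lemma s_Q (u : ℝ) : Real.exp (u/4)^2 * Real.exp (-u/2) = 1 := by
  rw [← Real.exp_nat_mul, ← Real.exp_add]; push_cast; rw [Real.exp_eq_one_iff]; ring

lemma exp_3u {u : ℝ} (hu : 3 ≤ u) : 0.35 * Real.exp (-3*u) ≤ 0.0002 * Real.exp (-u/2) := by
  have h : Real.exp (-3*u) = Real.exp (-(5*u/2)) * Real.exp (-u/2) := by
    rw [← Real.exp_add]; congr 1; ring
  have h2 : Real.exp (-(5*u/2)) ≤ 0.00057 := by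
    have h3 : Real.exp (-(5*u/2)) ≤ Real.exp (-(15/2)) := Real.exp_le_exp.mpr (by linarith)
    refine h3.trans ?_
    refine le_of_pow_le_pow_left₀ (n := 2) (by norm_num) (by norm_num) ?_
    rw [← Real.exp_nat_mul, show ((2:ℕ):ℝ) * -(15/2) = -((15:ℕ) * 1 : ℝ) by norm_num, Real.exp_neg, Real.exp_nat_mul]
    have h4 : (2.7182818283:ℝ)^15 ≤ Real.exp 1 ^ 15 :=
      pow_le_pow_left₀ (by norm_num) Real.exp_one_gt_d9.le _
    refine (inv_anti₀ (by norm_num) h4).trans (by norm_num)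
  rw [h]
  nlinarith [Real.exp_pos (-u/2)]

lemma Q_lb {u : ℝ} (hu : 3 ≤ u) : 2.1165 ≤ Real.exp (u/4) := by
  have h : Real.exp (3/4) ≤ Real.exp (u/4) := Real.exp_le_exp.mpr (by linarith)
  refine le_trans ?_ h
  refine le_of_pow_le_pow_left₀ (n := 4) (by norm_num) (Real.exp_pos _).le ?_
  rw [← Real.exp_nat_mul, show ((4:ℕ):ℝ) * (3/4) = (3:ℕ) * 1 by norm_num, Real.exp_nat_mul]
  refine le_trans (by norm_num) (pow_le_pow_left₀ (by norm_num) Real.exp_one_gt_d9.le 3)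

lemma exp_small {y c : ℝ} (h : y ≤ c) (hc : c < 1) : Real.exp y ≤ 1/(1-c) := by
  have h1 := Real.add_one_le_exp (-y)
  have h2 : Real.exp y = 1 / Real.exp (-y) := by rw [Real.exp_neg]; simp
  rw [h2]
  exact one_div_le_one_div_of_le (by linarith) (by linarith)

lemma Rf_mid (hRH : RiemannHypothesis) {u : ℝ} (hu : 3 ≤ u) :
    Rf u ≤ Real.exp (-u/2) * (0.43035 * Real.exp (u/4) + 0.0002) ∧
    -(Real.exp (-u/2) * (0.4548 * Real.exp (u/4))) ≤ Rf u := by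
  set Q := Real.exp (u/4) with hQ
  set s := Real.exp (-u/2) with hs
  have hQ0 : 0 < Q := Real.exp_pos _
  have hs0 : 0 < s := Real.exp_pos _
  have hQs : Q^2 * s = 1 := s_Q u
  have hQl : 2.1165 ≤ Q := Q_lb hu
  have hη : 0 < 0.43/Q := by positivity
  have hη1 : 0.43/Q ≤ 0.2032 := by rw [div_le_iff₀ hQ0]; linarith
  have hS : Sf (2/(0.43/Q)) ≤ 0.21535 * Q := by
    refine (Sf_le_M0 hRH (by positivity)).trans ?_
    have : 2/(0.43/Q) = (2/0.43) * Q := by field_simp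
    rw [this]
    have := M0_le
    calc (2/0.43) * Q * M0 ≤ (2/0.43) * Q * 0.0463 := by gcongr
      _ ≤ _ := by nlinarith
  have hinv : 0.43/Q = 0.43 * Q * s := by
    rw [div_eq_iff hQ0.ne']; linear_combination -0.43 * hQs
  constructor
  · have h := Rf_le hRH (by linarith : (2:ℝ) ≤ u) hη
    have h3 := exp_3u hu
    have h4 : Real.exp (-u/2) * Sf (2/(0.43/Q)) ≤ s * (0.21535 * Q) := mul_le_mul_of_nonneg_left hS hs0.le
    rw [hinv] at h h4
    nlinarith
  · have h := Rf_ge hRH (by linarith : (2:ℝ) ≤ u) hη (by linarith)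
    have h5 : Real.exp (-(u - 0.43/Q)/2) ≤ s * 1.1135 := by
      have : Real.exp (-(u - 0.43/Q)/2) = s * Real.exp (0.43/Q/2) := by
        rw [hs, ← Real.exp_add]; congr 1; ring
      rw [this]
      gcongr
      exact (exp_small (show 0.43/Q/2 ≤ 0.1016 by linarith) (by norm_num)).trans (by norm_num)
    have h4 : Real.exp (-(u - 0.43/Q)/2) * Sf (2/(0.43/Q)) ≤ s * 1.1135 * (0.21535 * Q) :=
      (mul_le_mul_of_nonneg_left hS (Real.exp_pos _).le).trans
        (mul_le_mul_of_nonneg_right h5 (by positivity))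
    have h6 : s * 1.1135 * (0.21535 * Q) + 0.43/Q/2 ≤ s * (0.4548 * Q) := by
      rw [hinv]
      have : 0 < s * Q := by positivity
      nlinarith
    linarith

lemma Rf_big (hRH : RiemannHypothesis) {u : ℝ} (hu : 14 ≤ u) :
    |Rf u| ≤ Real.exp (-u/2) * (0.32 * (u/2 - 0.693)^2 + 2.001) := by
  set s := Real.exp (-u/2) with hs
  have hs0 : 0 < s := Real.exp_pos _
  have hs1 : s ≤ 0.001 := by
    have h1 : s ≤ Real.exp (-7) := Real.exp_le_exp.mpr (by linarith)
    refine h1.trans ?_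
    rw [Real.exp_neg]
    exact (inv_anti₀ (by norm_num) exp7).trans (by norm_num)
  have hT : 2/(4*s) = Real.exp (u/2)/2 := by
    have : s = (Real.exp (u/2))⁻¹ := by rw [hs, ← Real.exp_neg]; congr 1; ring
    rw [this]; field_simp; norm_num
  have hT10 : 10 ≤ 2/(4*s) := by
    rw [le_div_iff₀ (by positivity)]; linarith
  have hlog : Real.log (2/(4*s)) = u/2 - Real.log 2 := by
    rw [hT, Real.log_div (Real.exp_pos _).ne' (by norm_num), Real.log_exp]
  have hS : Sf (2/(4*s)) ≤ 0.3184 * (u/2-0.693)^2 := by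
    refine (Sf_le_log hRH (M0_le.trans (by norm_num)) hT10).trans ?_
    rw [hlog, div_le_iff₀ Real.pi_pos]
    have h2 := Real.log_two_lt_d9
    have h2' := Real.log_two_gt_d9
    have h3 : (u/2 - Real.log 2)^2 ≤ (u/2-0.693)^2 :=
      pow_le_pow_left₀ (by linarith) (by linarith) 2
    refine h3.trans ?_
    have := Real.pi_gt_d6
    nlinarith [sq_nonneg (u/2-0.693)]
  have hX : 0 ≤ (u/2-0.693)^2 := sq_nonneg _
  set X := (u/2-0.693)^2 with hXd
  have h3 := exp_3u (by linarith : 3 ≤ u)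
  rw [abs_le]
  constructor
  · have h := Rf_ge hRH (by linarith : (2:ℝ) ≤ u) (by positivity : 0 < 4*s) (by linarith)
    have h5 : Real.exp (-(u - 4*s)/2) ≤ s * 1.003 := by
      have : Real.exp (-(u - 4*s)/2) = s * Real.exp (2*s) := by
        rw [hs, ← Real.exp_add]; congr 1; ring
      rw [this]
      gcongr
      exact (exp_small (show 2*s ≤ 0.002 by linarith) (by norm_num)).trans (by norm_num)
    have h4 : Real.exp (-(u - 4*s)/2) * Sf (2/(4*s)) ≤ s * 1.003 * (0.3184 * X) :=
      (mul_le_mul_of_nonneg_left hS (Real.exp_pos _).le).trans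
        (mul_le_mul_of_nonneg_right h5 (by positivity))
    nlinarith [mul_nonneg hs0.le hX]
  · have h := Rf_le hRH (by linarith : (2:ℝ) ≤ u) (by positivity : 0 < 4*s)
    have h4 : Real.exp (-u/2) * Sf (2/(4*s)) ≤ s * (0.3184 * X) := mul_le_mul_of_nonneg_left hS hs0.le
    nlinarith [mul_nonneg hs0.le hX]

lemma combine_lower (hRH : RiemannHypothesis) {B u : ℝ}
    (hB : Tendsto (fun w ↦ Pp w - Real.log w) atTop (nhds B)) (hu : 3 ≤ u) {r : ℝ}
    (hr : -(Real.exp (-u/2) * r) ≤ Rf u) (hc : r + 0.093/u ≤ 0.11936 * u^2) :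
    -(0.11936 * (u * Real.exp (-u/2))) ≤ Pp u - Real.log u - B := by
  have h := (E_bounds hRH hB (u := u) (by linarith)).1
  have h3 := exp_3u hu
  have hM := M0_le
  set s := Real.exp (-u/2) with hs
  have hs0 : 0 < s := Real.exp_pos _
  have hu0 : 0 < u := by linarith
  have hK : 2*(M0*s + 0.35*Real.exp (-3*u))/u^2 ≤ 0.093 * s/u^2 := by
    exact div_le_div_of_nonneg_right (by nlinarith) (by positivity)
  have hR : -(s*r)/u ≤ Rf u/u := by gcongr
  have key : s * (r + 0.093/u) / u ≤ s * (0.11936 * u^2)/u := by gcongr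
  have e1 : s * (r + 0.093/u) / u = (s*r)/u + 0.093*s/u^2 := by field_simp
  have e2 : s * (0.11936 * u^2)/u = 0.11936 * (u*s) := by field_simp
  rw [e1, e2] at key
  rw [neg_div] at hR
  linarith

lemma combine_upper (hRH : RiemannHypothesis) {B u : ℝ}
    (hB : Tendsto (fun w ↦ Pp w - Real.log w) atTop (nhds B)) (hu : 3 ≤ u) {r T : ℝ}
    (hr : Rf u ≤ Real.exp (-u/2) * r)
    (hT : ∀ w, u ≤ w → Df w - Df u ≤ T * Real.exp (-u/2))
    (hc : r + 0.093/u + T * u ≤ 0.11936 * u^2) :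
    Pp u - Real.log u - B ≤ 0.11936 * (u * Real.exp (-u/2)) := by
  have h := (E_bounds hRH hB (u := u) (by linarith)).2 _ hT
  have h3 := exp_3u hu
  have hM := M0_le
  set s := Real.exp (-u/2) with hs
  have hs0 : 0 < s := Real.exp_pos _
  have hu0 : 0 < u := by linarith
  have hK : 2*(M0*s + 0.35*Real.exp (-3*u))/u^2 ≤ 0.093 * s/u^2 := by
    exact div_le_div_of_nonneg_right (by nlinarith) (by positivity)
  have hR : Rf u/u ≤ (s*r)/u := by gcongr
  have key : s * (r + 0.093/u + T * u) / u ≤ s * (0.11936 * u^2)/u := by gcongr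
  have e1 : s * (r + 0.093/u + T * u) / u = (s*r)/u + 0.093*s/u^2 + T * s := by field_simp
  have e2 : s * (0.11936 * u^2)/u = 0.11936 * (u*s) := by field_simp
  rw [e1, e2] at key
  linarith

lemma cellL {u : ℝ} (a : ℝ) (m : ℕ) (ha : a ≤ u) (hb : u ≤ m/4) (h3 : 3 ≤ a)
    (hc : 0.4548 * 1.0644945^m + 0.093/a ≤ 0.11936 * a^2) :
    0.4548 * Real.exp (u/4) + 0.093/u ≤ 0.11936 * u^2 := by
  have hQ := Q_bd m hb
  have h1 : 0.093/u ≤ 0.093/a := by gcongr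
  have h2 : a^2 ≤ u^2 := pow_le_pow_left₀ (by linarith) ha 2
  linarith

lemma cellU {u : ℝ} (a T : ℝ) (m : ℕ) (ha : a ≤ u) (hb : u ≤ m/4) (h3 : 3 ≤ a) (hT : T ≤ 0.11936 * a)
    (hc : 0.43035 * 1.0644945^m + 0.0002 + 0.093/a ≤ (0.11936 * a - T) * a) :
    (0.43035 * Real.exp (u/4) + 0.0002) + 0.093/u + T * u ≤ 0.11936 * u^2 := by
  have hQ := Q_bd m hb
  have h1 : 0.093/u ≤ 0.093/a := by gcongr
  have h2 : (0.11936 * a - T) * a ≤ (0.11936 * u - T) * u :=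
    mul_le_mul (by linarith) ha (by linarith) (by linarith)
  nlinarith

lemma cellT {u t : ℝ} (m : ℕ) (hb : u ≤ m/4) (ht : 0 ≤ t) (hd : ∀ w, u ≤ w → Df w - Df u ≤ t) :
    ∀ w, u ≤ w → Df w - Df u ≤ (t * (1.0644945^m)^2) * Real.exp (-u/2) := by
  intro w hw
  refine (hd w hw).trans ?_
  have hQ := Q_bd m hb
  have h2 : Real.exp (u/4)^2 ≤ (1.0644945^m)^2 := pow_le_pow_left₀ (Real.exp_pos _).le hQ 2
  have := s_Q u
  calc t = t * (Real.exp (u/4)^2 * Real.exp (-u/2)) := by rw [this, mul_one]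
    _ ≤ t * ((1.0644945^m)^2 * Real.exp (-u/2)) := by gcongr
    _ = _ := by ring

lemma lower_all (hRH : RiemannHypothesis) {B u : ℝ}
    (hB : Tendsto (fun w ↦ Pp w - Real.log w) atTop (nhds B)) (hu : 3.19 ≤ u) :
    -(0.11936 * (u * Real.exp (-u/2))) ≤ Pp u - Real.log u - B := by
  have hu3 : 3 ≤ u := by linarith
  rcases le_or_gt u 14 with h14 | h14
  · refine combine_lower hRH hB hu3 (Rf_mid hRH hu3).2 ?_
    rcases le_or_gt u 3.5 with h | h
    · exact cellL 3.19 14 hu (by norm_num at h ⊢; linarith) (by norm_num) (by norm_num)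
    rcases le_or_gt u 4 with g | g
    · exact cellL 3.5 16 h.le (by norm_num; linarith) (by norm_num) (by norm_num)
    rcases le_or_gt u 5 with h | h
    · exact cellL 4 20 g.le (by norm_num; linarith) (by norm_num) (by norm_num)
    rcases le_or_gt u 6.5 with g | g
    · exact cellL 5 26 h.le (by norm_num at g ⊢; linarith) (by norm_num) (by norm_num)
    rcases le_or_gt u 8.5 with h | h
    · exact cellL 6.5 34 g.le (by norm_num at h ⊢; linarith) (by norm_num) (by norm_num)
    rcases le_or_gt u 10.5 with g | g
    · exact cellL 8.5 42 h.le (by norm_num at g ⊢; linarith) (by norm_num) (by norm_num)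
    rcases le_or_gt u 12.5 with h | h
    · exact cellL 10.5 50 g.le (by norm_num at h ⊢; linarith) (by norm_num) (by norm_num)
    · exact cellL 12.5 56 h.le (by norm_num; linarith) (by norm_num) (by norm_num)
  · refine combine_lower hRH hB hu3 (abs_le.mp (Rf_big hRH h14.le)).1 ?_
    have : 0.093/u ≤ 0.093/14 := by gcongr
    nlinarith

lemma upper_all (hRH : RiemannHypothesis) {B u : ℝ}
    (hB : Tendsto (fun w ↦ Pp w - Real.log w) atTop (nhds B)) (hu : 5 ≤ u) :
    Pp u - Real.log u - B ≤ 0.11936 * (u * Real.exp (-u/2)) := by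
  have hu3 : 3 ≤ u := by linarith
  have hR := (Rf_mid hRH hu3).1
  rcases lt_or_ge u 6 with h6 | h6
  · have ht : ∀ w, u ≤ w → Df w - Df u ≤ 0.016155 := fun w hw ↦ tail5 hu hw
    rcases le_or_gt u 5.25 with h | h
    · have hb : u ≤ (21:ℕ)/4 := by norm_num at h ⊢; linarith
      exact combine_upper hRH hB hu3 hR (cellT 21 hb (by norm_num) ht)
        (cellU 5 _ 21 hu hb (by norm_num) (by norm_num) (by norm_num))
    rcases le_or_gt u 5.5 with g | g
    · have hb : u ≤ (22:ℕ)/4 := by norm_num at g ⊢; linarith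
      exact combine_upper hRH hB hu3 hR (cellT 22 hb (by norm_num) ht)
        (cellU 5.25 _ 22 h.le hb (by norm_num) (by norm_num) (by norm_num))
    rcases le_or_gt u 5.75 with h | h
    · have hb : u ≤ (23:ℕ)/4 := by norm_num at h ⊢; linarith
      exact combine_upper hRH hB hu3 hR (cellT 23 hb (by norm_num) ht)
        (cellU 5.5 _ 23 g.le hb (by norm_num) (by norm_num) (by norm_num))
    · have hb : u ≤ (24:ℕ)/4 := by norm_num; linarith
      exact combine_upper hRH hB hu3 hR (cellT 24 hb (by norm_num) ht)
        (cellU 5.75 _ 24 h.le hb (by norm_num) (by norm_num) (by norm_num))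
  rcases lt_or_ge u 7 with h7 | h7
  · have ht : ∀ w, u ≤ w → Df w - Df u ≤ 0.00845 := fun w hw ↦ tail6 h6 hw
    rcases le_or_gt u 6.5 with h | h
    · have hb : u ≤ (26:ℕ)/4 := by norm_num at h ⊢; linarith
      exact combine_upper hRH hB hu3 hR (cellT 26 hb (by norm_num) ht)
        (cellU 6 _ 26 h6 hb (by norm_num) (by norm_num) (by norm_num))
    · have hb : u ≤ (28:ℕ)/4 := by norm_num; linarith
      exact combine_upper hRH hB hu3 hR (cellT 28 hb (by norm_num) ht)
        (cellU 6.5 _ 28 h.le hb (by norm_num) (by norm_num) (by norm_num))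
  rcases lt_or_ge u 8 with h8 | h8
  · have ht : ∀ w, u ≤ w → Df w - Df u ≤ 0.00535 := fun w hw ↦ tail7 h7 hw
    rcases le_or_gt u 7.5 with h | h
    · have hb : u ≤ (30:ℕ)/4 := by norm_num at h ⊢; linarith
      exact combine_upper hRH hB hu3 hR (cellT 30 hb (by norm_num) ht)
        (cellU 7 _ 30 h7 hb (by norm_num) (by norm_num) (by norm_num))
    · have hb : u ≤ (32:ℕ)/4 := by norm_num; linarith
      exact combine_upper hRH hB hu3 hR (cellT 32 hb (by norm_num) ht)
        (cellU 7.5 _ 32 h.le hb (by norm_num) (by norm_num) (by norm_num))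
  have ht : ∀ w, u ≤ w → Df w - Df u ≤ 0.455 * Real.exp (-u/2) := fun w hw ↦ tail_crude h8 hw
  rcases le_or_gt u 14 with h14 | h14
  · refine combine_upper hRH hB hu3 hR ht ?_
    rcases le_or_gt u 8.5 with h | h
    · exact cellU 8 _ 34 h8 (by norm_num at h ⊢; linarith) (by norm_num) (by norm_num) (by norm_num)
    rcases le_or_gt u 9.5 with g | g
    · exact cellU 8.5 _ 38 h.le (by norm_num at g ⊢; linarith) (by norm_num) (by norm_num) (by norm_num)
    rcases le_or_gt u 10.5 with h | h
    · exact cellU 9.5 _ 42 g.le (by norm_num at h ⊢; linarith) (by norm_num) (by norm_num) (by norm_num)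
    rcases le_or_gt u 11.5 with g | g
    · exact cellU 10.5 _ 46 h.le (by norm_num at g ⊢; linarith) (by norm_num) (by norm_num) (by norm_num)
    rcases le_or_gt u 12.5 with h | h
    · exact cellU 11.5 _ 50 g.le (by norm_num at h ⊢; linarith) (by norm_num) (by norm_num) (by norm_num)
    rcases le_or_gt u 13.25 with g | g
    · exact cellU 12.5 _ 53 h.le (by norm_num at g ⊢; linarith) (by norm_num) (by norm_num) (by norm_num)
    · exact cellU 13.25 _ 56 g.le (by norm_num; linarith) (by norm_num) (by norm_num) (by norm_num)
  · refine combine_upper hRH hB hu3 (abs_le.mp (Rf_big hRH h14.le)).2 ht ?_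
    have : 0.093/u ≤ 0.093/14 := by gcongr
    nlinarith

lemma main_u (hRH : RiemannHypothesis) {B u : ℝ}
    (hB : Tendsto (fun w ↦ Pp w - Real.log w) atTop (nhds B)) (hu : 24.4 ≤ Real.exp u) :
    |Pp u - Real.log u - B| ≤ 0.11936 * (u * Real.exp (-u/2)) := by
  have hu3 : 3.19 ≤ u := by
    have h : Real.exp 3.19 ≤ 24.4 := by
      refine le_of_pow_le_pow_left₀ (n := 5) (by norm_num) (by norm_num) ?_
      rw [← Real.exp_nat_mul]
      have h1 : Real.exp (((5:ℕ):ℝ) * 3.19) ≤ Real.exp ((16:ℕ) * 1) * Real.exp (-0.05) := by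
        rw [← Real.exp_add]; exact Real.exp_le_exp.mpr (by norm_num)
      have h2 : Real.exp (-0.05) ≤ 1/(1-(-0.05)) := exp_small le_rfl (by norm_num)
      refine h1.trans ?_
      rw [Real.exp_nat_mul]
      have h3 : Real.exp 1 ^ 16 ≤ 2.7182818286^16 :=
        pow_le_pow_left₀ (Real.exp_pos _).le Real.exp_one_lt_d9.le _
      refine (mul_le_mul h3 h2 (Real.exp_pos _).le (by norm_num)).trans (by norm_num)
    exact Real.exp_le_exp.mp (h.trans hu)
  rw [abs_le]
  refine ⟨lower_all hRH hB hu3, ?_⟩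
  rcases le_or_gt u 5 with h5 | h5
  · exact upper_small (B_lo hRH hB) h5 hu
  · exact upper_all hRH hB h5.le

end

open Real Finset Filter

theorem mertens_second_RH (hRH : RiemannHypothesis) (B : ℝ)
    (hB : Filter.Tendsto
      (fun x : ℝ => (∑ p ∈ (Finset.range (⌊x⌋₊ + 1)).filter Nat.Prime,
        (1 : ℝ) / p) - Real.log (Real.log x)) Filter.atTop (nhds B)) :
    ∀ x : ℝ, 24.4 ≤ x →
      |(∑ p ∈ (Finset.range (⌊x⌋₊ + 1)).filter Nat.Prime, (1 : ℝ) / p)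
          - Real.log (Real.log x) - B|
        ≤ 3 * Real.log x / (8 * π * Real.sqrt x) := by
  intro x hx
  have hx0 : 0 < x := by linarith
  set u := Real.log x with hu
  have hxu : x = Real.exp u := (Real.exp_log hx0).symm
  have hB' : Filter.Tendsto (fun w ↦ Pp w - Real.log w) Filter.atTop (nhds B) := by
    refine (hB.comp Real.tendsto_exp_atTop).congr (fun w ↦ ?_)
    simp only [Function.comp_apply, Real.log_exp, Pp]
  have h := main_u hRH hB' (u := u) (by rw [← hxu]; exact hx)
  have hu0 : 0 ≤ u := Real.log_nonneg (by linarith)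
  have hs : Real.sqrt x = Real.exp (u/2) := by
    rw [Real.sqrt_eq_iff_mul_self_eq hx0.le (Real.exp_pos _).le, ← Real.exp_add, add_halves, ← hxu]
  rw [Pp, ← hxu] at h
  refine h.trans ?_
  rw [hs, neg_div, Real.exp_neg, le_div_iff₀ (by positivity)]
  have hp := Real.pi_lt_d6
  have e : 0.11936 * (u * (Real.exp (u/2))⁻¹) * (8 * Real.pi * Real.exp (u/2)) = 0.11936 * 8 * Real.pi * u := by
    field_simp
  rw [e]
  nlinarith
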